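/- Let η ∈ {1,2} and let q, r, s be primes with q ≡ 3 (mod 4), r ≡ s ≡ 5 (mod 8), Legendre symbols (q/r) = (q/s) = (−1)^{δ_{η,2}} and (r/s) = 1, let (γ, γ′) be the fundamental solution of X² − ηqrs·Y² = 1, and assume 2^{δ_{η,1}}·q·(γ−1) is not a perfect square. Then the triquadratic field K₁ = ℚ(√2, √q, √(rs)) satisfies 2·h₂(K₁) = h₂(rs)·h₂(ηqrs). -/

import Mathlib

open IntermediateField NumberField

/-- The `n`-th layer `k(2·cos(2π/2^(n+2)))` of the cyclotomic `ℤ₂`-extension of a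
(totally real) subfield of `ℝ`. -/
noncomputable def layer (F : IntermediateField ℚ ℝ) (n : ℕ) : IntermediateField ℚ ℝ :=
  F ⊔ IntermediateField.adjoin ℚ {2 * Real.cos (2 * Real.pi / 2 ^ (n + 2))}

/-- The 2-part of the class number of a subfield of `ℝ` (the largest power of 2 dividing
the cardinality of the class group of its ring of integers). -/
noncomputable def h2 (F : IntermediateField ℚ ℝ) : ℕ :=
  2 ^ ((Nat.card (ClassGroup (NumberField.RingOfIntegers F))).factorization 2)

section
open scoped ENNReal
open NumberField

lemma zEuler_finset {R : Type*} [CommRing R] [IsDedekindDomain R] (w : Ideal R → ENNReal)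
    (w1 : w 1 = 1) (wm : ∀ I J, w (I * J) = w I * w J) (T : Finset (Ideal R))
    (hT : ∀ P ∈ T, Prime P) :
    ∑' I : {I : Ideal R // I ≠ 0 ∧ ∀ P, Prime P → P ∣ I → P ∈ T}, w I.1 =
      ∏ P ∈ T, (1 - w P)⁻¹ := by
  classical
  induction T using Finset.induction_on with
  | empty =>
    have : ∀ I : {I : Ideal R // I ≠ 0 ∧ ∀ P, Prime P → P ∣ I → P ∈ (∅ : Finset (Ideal R))},
        I = ⟨1, one_ne_zero, fun P hP h => absurd (isUnit_of_dvd_one h) hP.not_isUnit⟩ := by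
      intro I
      apply Subtype.ext
      by_contra h
      obtain ⟨P, hP, hPI⟩ := WfDvdMonoid.exists_irreducible_factor
        (fun hu => h ((Ideal.isUnit_iff.mp hu).trans Ideal.one_eq_top.symm)) I.2.1
      simpa using I.2.2 P hP.prime hPI
    let _ : Unique {I : Ideal R // I ≠ 0 ∧ ∀ P, Prime P → P ∣ I → P ∈ (∅ : Finset (Ideal R))} :=
      ⟨⟨⟨1, one_ne_zero, fun P hP h => absurd (isUnit_of_dvd_one h) hP.not_isUnit⟩⟩, this⟩
    rw [tsum_eq_single default (fun b hb => absurd (Subsingleton.elim _ _) hb)]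
    rw [Finset.prod_empty]
    exact w1
  | insert P T hPT ih =>
    rw [Finset.prod_insert hPT, ← ih (fun P' h => hT P' (Finset.mem_insert_of_mem h))]
    have hP : Prime P := hT P (Finset.mem_insert_self _ _)
    have wpow : ∀ k : ℕ, w (P ^ k) = w P ^ k := by
      intro k
      induction k with
      | zero => simpa using w1
      | succ n ihn => rw [pow_succ, wm, ihn, pow_succ]
    rw [← ENNReal.tsum_geometric, ← ENNReal.tsum_mul_right]
    simp_rw [← ENNReal.tsum_mul_left]
    rw [← ENNReal.tsum_prod]
    let φ : ℕ × {I : Ideal R // I ≠ 0 ∧ ∀ P, Prime P → P ∣ I → P ∈ T} →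
        {I : Ideal R // I ≠ 0 ∧ ∀ P', Prime P' → P' ∣ I → P' ∈ insert P T} := fun x =>
      ⟨P ^ x.1 * x.2.1, mul_ne_zero (pow_ne_zero _ hP.ne_zero) x.2.2.1, by
        intro P' hP' hd
        rcases hP'.dvd_or_dvd hd with h | h
        · have := hP'.dvd_of_dvd_pow h
          have := (hP'.dvd_prime_iff_associated hP).mp this
          rw [associated_iff_eq] at this
          simp [this]
        · exact Finset.mem_insert_of_mem (x.2.2.2 P' hP' h)⟩
    have hnd : ∀ I : {I : Ideal R // I ≠ 0 ∧ ∀ P, Prime P → P ∣ I → P ∈ T}, ¬ P ∣ I.1 :=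
      fun I h => hPT (I.2.2 P hP h)
    have hφ : Function.Bijective φ := by
      constructor
      · rintro ⟨k, I⟩ ⟨l, J⟩ h
        have h' : P ^ k * I.1 = P ^ l * J.1 := congrArg Subtype.val h
        have hkl : k = l := by
          by_contra hne
          rcases lt_or_gt_of_ne hne with hlt | hlt
          · obtain ⟨m, rfl⟩ := Nat.exists_eq_add_of_lt hlt
            rw [show k + m + 1 = k + (m+1) by ring, pow_add, mul_assoc] at h'
            have := mul_left_cancel₀ (pow_ne_zero _ hP.ne_zero) h'
            apply hnd I
            rw [this, pow_succ, mul_assoc, mul_left_comm]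
            exact dvd_mul_right _ _
          · obtain ⟨m, rfl⟩ := Nat.exists_eq_add_of_lt hlt
            rw [show l + m + 1 = l + (m+1) by ring, pow_add, mul_assoc] at h'
            have := mul_left_cancel₀ (pow_ne_zero _ hP.ne_zero) h'
            apply hnd J
            rw [← this, pow_succ, mul_assoc, mul_left_comm]
            exact dvd_mul_right _ _
        subst hkl
        have := mul_left_cancel₀ (pow_ne_zero _ hP.ne_zero) h'
        exact Prod.ext rfl (Subtype.ext this)
      · rintro ⟨I, hI0, hI⟩
        obtain ⟨n, c, hc, hIc⟩ := WfDvdMonoid.max_power_factor hI0 hP.irreducible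
        refine ⟨⟨n, ⟨c, ?_, ?_⟩⟩, Subtype.ext hIc.symm⟩
        · rintro rfl; exact hc (dvd_zero _)
        · intro P' hP' h
          rcases Finset.mem_insert.mp (hI P' hP' (hIc ▸ h.mul_left _)) with rfl | h'
          · exact absurd h hc
          · exact h'
    rw [← (Equiv.ofBijective φ hφ).tsum_eq]
    refine tsum_congr fun x => ?_
    simp [φ, wm, wpow]

/-- ideal weights -/
noncomputable def zw (F : Type*) [Field F] [NumberField F] (s : ℝ) (I : Ideal (𝓞 F)) : ENNReal :=
  ((Ideal.absNorm I : ℕ) : ENNReal) ^ (-s)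

noncomputable def zfun (F : Type*) [Field F] [NumberField F] (s : ℝ) : ENNReal :=
  ∑' I : {I : Ideal (𝓞 F) // I ≠ 0}, zw F s I.1

noncomputable def zlocal (F : Type*) [Field F] [NumberField F] (s : ℝ) (p : ℕ) : ENNReal :=
  ∏ P ∈ IsDedekindDomain.primesOverFinset (Ideal.span {(p : ℤ)}) (𝓞 F), (1 - zw F s P)⁻¹

lemma zw_one (F : Type*) [Field F] [NumberField F] (s : ℝ) : zw F s 1 = 1 := by
  simp [zw]

lemma zw_mul (F : Type*) [Field F] [NumberField F] (s : ℝ) (I J) :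
    zw F s (I * J) = zw F s I * zw F s J := by
  unfold zw
  rw [map_mul, Nat.cast_mul, ENNReal.mul_rpow_of_ne_top (by simp) (by simp)]

open Filter Topology in
lemma zfun_tendsto (F : Type*) [Field F] [NumberField F] (s : ℝ) :
    Tendsto (fun S : Finset {p : ℕ // p.Prime} => ∏ p ∈ S, zlocal F s p.1) atTop
      (𝓝 (zfun F s)) := by
  classical
  have key : ∀ S : Finset {p : ℕ // p.Prime}, ∏ p ∈ S, zlocal F s p.1 =
      ∑' I : {I : Ideal (𝓞 F) // I ≠ 0}, if ∀ P, Prime P → P ∣ I.1 → 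
        P ∈ S.biUnion (fun p => IsDedekindDomain.primesOverFinset (Ideal.span {(p.1 : ℤ)}) (𝓞 F))
        then zw F s I.1 else 0 := by
    intro S
    have hb : ∀ p : {p : ℕ // p.Prime}, (Ideal.span {(p.1 : ℤ)}) ≠ ⊥ := fun p => by
      simp [p.2.ne_zero]
    have hm : ∀ p : {p : ℕ // p.Prime}, (Ideal.span {(p.1 : ℤ)}).IsMaximal := fun p => by
      have := Nat.prime_iff_prime_int.mp p.2
      exact ((Ideal.span_singleton_prime this.ne_zero).mpr this).isMaximal (hb p)
    unfold zlocal
    rw [← Finset.prod_biUnion, ← zEuler_finset (zw F s) (zw_one F s) (zw_mul F s)]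
    · let e : {I : Ideal (𝓞 F) // I ≠ 0 ∧ ∀ P, Prime P → P ∣ I → P ∈ S.biUnion (fun p => IsDedekindDomain.primesOverFinset (Ideal.span {(p.1 : ℤ)}) (𝓞 F))} → {I : Ideal (𝓞 F) // I ≠ 0} := fun I => ⟨I.1, I.2.1⟩
      have he : Function.Injective e := fun I J h => Subtype.ext (congrArg (fun x => x.1) h)
      rw [← he.tsum_eq]
      · refine tsum_congr fun I => ?_
        rw [if_pos]
        intro P hP hd
        exact I.2.2 P hP hd
      · intro I hI
        have : ∀ P, Prime P → P ∣ I.1 → P ∈ S.biUnion (fun p => IsDedekindDomain.primesOverFinset (Ideal.span {(p.1 : ℤ)}) (𝓞 F)) := by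
          by_contra h
          apply hI
          simp only []
          rw [if_neg h]
        exact ⟨⟨I.1, I.2, this⟩, rfl⟩
    · intro P hP
      obtain ⟨p, hp, hPp⟩ := Finset.mem_biUnion.mp hP
      have := hm p
      rw [← Finset.mem_coe, IsDedekindDomain.coe_primesOverFinset (hb p)] at hPp
      have h1 := hPp.1
      have h2 := hPp.2
      exact Ideal.prime_of_isPrime (Ideal.ne_bot_of_liesOver_of_ne_bot (hb p) P) h1
    · intro p hp p' hp' hne
      rw [Function.onFun, Finset.disjoint_left]
      intro P h1 h2
      have := hm p
      have := hm p'
      rw [← Finset.mem_coe, IsDedekindDomain.coe_primesOverFinset (hb p)] at h1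
      rw [← Finset.mem_coe, IsDedekindDomain.coe_primesOverFinset (hb p')] at h2
      have e1 := h1.2.over
      have e2 := h2.2.over
      rw [← e1] at e2
      rw [Ideal.span_singleton_eq_span_singleton, Int.associated_iff_natAbs] at e2
      exact hne (Subtype.ext (by simpa using e2.symm))
  simp_rw [key]
  have hmono : Monotone (fun S : Finset {p : ℕ // p.Prime} => ∑' I : {I : Ideal (𝓞 F) // I ≠ 0}, if ∀ P, Prime P → P ∣ I.1 → 
        P ∈ S.biUnion (fun p => IsDedekindDomain.primesOverFinset (Ideal.span {(p.1 : ℤ)}) (𝓞 F))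
        then zw F s I.1 else 0) := by
    intro S S' h
    refine ENNReal.tsum_le_tsum fun I => ?_
    split_ifs with h1 h2
    · exact le_rfl
    · exact absurd (fun P a b => Finset.biUnion_subset_biUnion_of_subset_left _ h (h1 P a b)) h2
    · simp
    · simp
  have : zfun F s = ⨆ S : Finset {p : ℕ // p.Prime}, ∑' I : {I : Ideal (𝓞 F) // I ≠ 0}, if ∀ P, Prime P → P ∣ I.1 → 
        P ∈ S.biUnion (fun p => IsDedekindDomain.primesOverFinset (Ideal.span {(p.1 : ℤ)}) (𝓞 F))
        then zw F s I.1 else 0 := by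
    apply le_antisymm
    · unfold zfun
      rw [ENNReal.tsum_eq_iSup_sum]
      refine iSup_le fun A => ?_
      have hfin : ∀ I : {I : Ideal (𝓞 F) // I ≠ 0}, ∃ S : Finset {p : ℕ // p.Prime}, ∀ P, Prime P → P ∣ I.1 → 
        P ∈ S.biUnion (fun p => IsDedekindDomain.primesOverFinset (Ideal.span {(p.1 : ℤ)}) (𝓞 F)) := by
        intro I
        refine ⟨(Ideal.absNorm I.1).primeFactors.attach.image (fun p => ⟨p.1, Nat.prime_of_mem_primeFactors p.2⟩), ?_⟩
        intro P hP hd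
        have hPp := (Ideal.isPrime_of_prime hP)
        have hPm := hPp.isMaximal hP.ne_zero
        obtain ⟨p, hp, hpP⟩ : ∃ p : ℕ, p.Prime ∧ (p:ℤ) ∈ P.under ℤ := by
          have h0 : Ideal.absNorm P ≠ 1 := by
            rw [Ne, Ideal.absNorm_eq_one_iff]; exact hPp.ne_top
          have hmem : ((Ideal.absNorm P : ℕ) : ℤ) ∈ P.under ℤ := by
            rw [Ideal.mem_comap]; simpa using Ideal.absNorm_mem P
          have hn0 : Ideal.absNorm P ≠ 0 := by
            rw [Ne, Ideal.absNorm_eq_zero_iff]; exact hP.ne_zero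
          have hprime : (P.under ℤ).IsPrime := inferInstance
          have : ∀ n : ℕ, n ≠ 0 → (n:ℤ) ∈ P.under ℤ → ∃ p : ℕ, p.Prime ∧ (p:ℤ) ∈ P.under ℤ := by
            intro n
            induction n using Nat.strong_induction_on with
            | _ n ih =>
            intro hn hmem
            by_cases h1 : n = 1
            · subst h1
              exact absurd ((Ideal.eq_top_iff_one _).mpr (by simpa using hmem)) hprime.ne_top
            · have hmp := Nat.minFac_prime h1
              obtain ⟨m, hm⟩ := Nat.minFac_dvd n
              rw [hm, Nat.cast_mul] at hmem
              rcases hprime.mem_or_mem hmem with h | h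
              · exact ⟨_, hmp, h⟩
              · refine ih m ?_ ?_ h
                · by_contra hle
                  push Not at hle
                  have hm0 : m ≠ 0 := by rintro rfl; omega
                  have := hmp.two_le
                  nlinarith [Nat.pos_of_ne_zero hm0]
                · rintro rfl; omega
          exact this _ hn0 hmem
        have hpp : (Ideal.span {(p:ℤ)}) = P.under ℤ := by
          have := Nat.prime_iff_prime_int.mp hp
          have hmx : (Ideal.span {(p:ℤ)}).IsMaximal := ((Ideal.span_singleton_prime this.ne_zero).mpr this).isMaximal (by simp [hp.ne_zero])
          refine hmx.eq_of_le (Ideal.IsPrime.ne_top inferInstance) ?_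
          rw [Ideal.span_singleton_le_iff_mem]; exact hpP
        have hpN : p ∣ Ideal.absNorm I.1 := by
          have h1 : Ideal.absNorm P ∣ Ideal.absNorm I.1 := map_dvd _ hd
          refine dvd_trans ?_ h1
          have hm := Ideal.absNorm_mem P
          have : ((Ideal.absNorm P : ℕ) : ℤ) ∈ P.under ℤ := by
            rw [Ideal.mem_comap]; simpa using hm
          rw [← hpp, Ideal.mem_span_singleton] at this
          exact_mod_cast this
        rw [Finset.mem_biUnion]
        refine ⟨⟨p, hp⟩, ?_, ?_⟩
        · rw [Finset.mem_image]
          refine ⟨⟨p, ?_⟩, by simp, rfl⟩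
          rw [Nat.mem_primeFactors]
          exact ⟨hp, hpN, by rw [Ne, Ideal.absNorm_eq_zero_iff]; exact I.2⟩
        · have := Nat.prime_iff_prime_int.mp hp
          have hmx : (Ideal.span {(p:ℤ)}).IsMaximal := ((Ideal.span_singleton_prime this.ne_zero).mpr this).isMaximal (by simp [hp.ne_zero])
          rw [← Finset.mem_coe, IsDedekindDomain.coe_primesOverFinset (by simp [hp.ne_zero])]
          exact ⟨hPp, ⟨hpp⟩⟩
      choose g hg using hfin
      refine le_trans ?_ (le_iSup _ (A.biUnion g))
      refine le_trans (Finset.sum_le_sum fun I hI => ?_) (ENNReal.sum_le_tsum A)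
      rw [if_pos]
      intro P hP hd
      exact Finset.biUnion_subset_biUnion_of_subset_left _ (Finset.subset_biUnion_of_mem g hI) (hg I P hP hd)
    · refine iSup_le fun S => ENNReal.tsum_le_tsum fun I => ?_
      split_ifs <;> simp
  rw [this]
  exact tendsto_atTop_iSup hmono
end

section
open scoped ENNReal Pointwise
open NumberField

lemma zspan_prime {p : ℕ} (hp : p.Prime) : (Ideal.span {(p : ℤ)}).IsMaximal := by
  have := Nat.prime_iff_prime_int.mp hp
  exact ((Ideal.span_singleton_prime this.ne_zero).mpr this).isMaximal (by simp [hp.ne_zero])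

lemma zlocal_eq (F : Type*) [Field F] [NumberField F] [IsGalois ℚ F] (s : ℝ) {p : ℕ}
    (hp : p.Prime) :
    zlocal F s p = ((1 - ((p : ENNReal) ^ (-s)) ^ ((Ideal.span {(p : ℤ)}).inertiaDegIn (𝓞 F)))⁻¹) ^
      ((Ideal.span {(p : ℤ)}).primesOver (𝓞 F)).ncard := by
  have hm := zspan_prime hp
  have hb : (Ideal.span {(p : ℤ)}) ≠ ⊥ := by simp [hp.ne_zero]
  unfold zlocal
  rw [← IsDedekindDomain.coe_primesOverFinset hb, Set.ncard_coe_finset, ← Finset.prod_const]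
  refine Finset.prod_congr rfl fun P hP => ?_
  rw [← Finset.mem_coe, IsDedekindDomain.coe_primesOverFinset hb] at hP
  have h1 := hP.1
  have h2 := hP.2
  have : IsGaloisGroup Gal(F/ℚ) ℤ (𝓞 F) := IsGaloisGroup.of_isFractionRing _ _ _ ℚ F
  rw [Ideal.inertiaDegIn_eq_inertiaDeg (Ideal.span {(p : ℤ)}) P Gal(F/ℚ)]
  unfold zw
  have hPm : P.IsMaximal := h1.isMaximal (Ideal.ne_bot_of_liesOver_of_ne_bot hb P)
  rw [Ideal.absNorm_eq_pow_inertiaDeg' P hp, Ideal.inertiaDeg'_eq_inertiaDeg]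
  congr 2
  push_cast
  rw [← ENNReal.rpow_natCast, ← ENNReal.rpow_natCast, ← ENNReal.rpow_mul, ← ENNReal.rpow_mul,
    mul_comm]

lemma zcard_sub (K : Type*) [Field K] [NumberField K] [IsGalois ℚ K] (E : IntermediateField ℚ K)
    [IsGalois ℚ E] {p : ℕ} (hp : p.Prime) (P : Ideal (𝓞 K)) [P.IsPrime]
    [P.LiesOver (Ideal.span {(p : ℤ)})] :
    Nat.card ((P.inertia Gal(K/ℚ)) ⊓ E.fixingSubgroup : Subgroup Gal(K/ℚ)) *
      ((Ideal.span {(p : ℤ)}).ramificationIdxIn (𝓞 E)) = Nat.card (P.inertia Gal(K/ℚ)) ∧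
    Nat.card ((MulAction.stabilizer Gal(K/ℚ) P) ⊓ E.fixingSubgroup : Subgroup Gal(K/ℚ)) *
      (((Ideal.span {(p : ℤ)}).ramificationIdxIn (𝓞 E)) *
        ((Ideal.span {(p : ℤ)}).inertiaDegIn (𝓞 E))) =
        Nat.card (MulAction.stabilizer Gal(K/ℚ) P) := by
  have hm := zspan_prime hp
  have hb : (Ideal.span {(p : ℤ)}) ≠ ⊥ := by simp [hp.ne_zero]
  have i1 : IsGaloisGroup Gal(K/ℚ) ℤ (𝓞 K) := IsGaloisGroup.of_isFractionRing _ _ _ ℚ K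
  have i2 : IsGaloisGroup Gal(E/ℚ) ℤ (𝓞 E) := IsGaloisGroup.of_isFractionRing _ _ _ ℚ E
  have i3 : IsGaloisGroup E.fixingSubgroup (𝓞 E) (𝓞 K) :=
    have : IsGaloisGroup E.fixingSubgroup E K := IsGaloisGroup.intermediateField Gal(K/ℚ) ℚ K E
    IsGaloisGroup.of_isFractionRing _ _ _ E K
  have hPb : P ≠ ⊥ := Ideal.ne_bot_of_liesOver_of_ne_bot hb P
  let p' : Ideal (𝓞 E) := P.under (𝓞 E)
  have : P.LiesOver p' := ⟨rfl⟩
  have : p'.LiesOver (Ideal.span {(p : ℤ)}) := by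
    constructor
    rw [Ideal.under_under]; exact Ideal.LiesOver.over
  have hp'b : p' ≠ ⊥ := Ideal.ne_bot_of_liesOver_of_ne_bot hb p'
  have hp'p : p'.IsPrime := inferInstance
  have hp'm : p'.IsMaximal := hp'p.isMaximal hp'b
  have : Nonempty (p'.primesOver (𝓞 K)) := ⟨⟨P, ‹_›, ‹_›⟩⟩
  have : Finite (Ideal.ResidueField p') := by
    have : Finite (𝓞 E ⧸ p') := Ideal.finiteQuotientOfFreeOfNeBot p' hp'b
    exact Finite.of_surjective _ (Ideal.bijective_algebraMap_quotient_residueField p').2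
  have : Finite (Ideal.ResidueField (Ideal.span {(p : ℤ)})) := by
    have : Finite (ℤ ⧸ (Ideal.span {(p : ℤ)})) := Ideal.finiteQuotientOfFreeOfNeBot _ hb
    exact Finite.of_surjective _ (Ideal.bijective_algebraMap_quotient_residueField _).2
  have eI : Nat.card (P.inertia E.fixingSubgroup) =
     Nat.card ((P.inertia Gal(K/ℚ)) ⊓ E.fixingSubgroup : Subgroup Gal(K/ℚ)) := by
    rw [← Subgroup.subgroupOf_map_subtype, Subgroup.card_map_of_injective (Subgroup.subtype_injective _)]
    congr!
  have eD : Nat.card (MulAction.stabilizer E.fixingSubgroup P) =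
     Nat.card ((MulAction.stabilizer Gal(K/ℚ) P) ⊓ E.fixingSubgroup : Subgroup Gal(K/ℚ)) := by
    rw [← Subgroup.subgroupOf_map_subtype, Subgroup.card_map_of_injective (Subgroup.subtype_injective _)]
    congr!
  have a1 := eI.symm.trans (Ideal.card_inertia_eq_ramificationIdxIn (G := E.fixingSubgroup) p' P)
  have a2 := eD.symm.trans (Ideal.card_stabilizer_eq (G := E.fixingSubgroup) p' P)
  have a3 : Nat.card (P.inertia Gal(K/ℚ)) = _ :=
    Ideal.card_inertia_eq_ramificationIdxIn (G := Gal(K/ℚ)) (Ideal.span {(p : ℤ)}) P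
  have a4 : Nat.card (MulAction.stabilizer Gal(K/ℚ) P) = _ :=
    Ideal.card_stabilizer_eq (G := Gal(K/ℚ)) (Ideal.span {(p : ℤ)}) P
  rw [a1, a2, a3, a4,
    ← Ideal.ramificationIdxIn_mul_ramificationIdxIn (p := Ideal.span {(p : ℤ)}) p' Gal(E/ℚ) (𝓞 K)
      Gal(K/ℚ) E.fixingSubgroup,
    ← Ideal.inertiaDegIn_mul_inertiaDegIn (Ideal.span {(p : ℤ)}) p' Gal(E/ℚ) (𝓞 K) Gal(K/ℚ)
      E.fixingSubgroup]
  constructor <;> ring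

lemma zinertiaDeg_le (K : Type*) [Field K] [NumberField K] [IsGalois ℚ K]
    (hexp : ∀ σ : Gal(K/ℚ), σ * σ = 1) {p : ℕ} (hp : p.Prime) (P : Ideal (𝓞 K)) [P.IsPrime]
    [P.LiesOver (Ideal.span {(p : ℤ)})] : P.inertiaDeg ℤ ≤ 2 := by
  have hm := zspan_prime hp
  have hb : (Ideal.span {(p : ℤ)}) ≠ ⊥ := by simp [hp.ne_zero]
  have i1 : IsGaloisGroup Gal(K/ℚ) ℤ (𝓞 K) := IsGaloisGroup.of_isFractionRing _ _ _ ℚ K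
  have hPb : P ≠ ⊥ := Ideal.ne_bot_of_liesOver_of_ne_bot hb P
  have hfin : Finite (𝓞 K ⧸ P) := Ideal.finiteQuotientOfFreeOfNeBot P hPb
  have hPm : P.IsMaximal := Ideal.IsPrime.isMaximal ‹_› hPb
  obtain ⟨σ, hσ⟩ := IsArithFrobAt.exists_of_isInvariant ℤ Gal(K/ℚ) P
  have hcard : Nat.card (ℤ ⧸ P.under ℤ) = p := by
    rw [← Ideal.LiesOver.over (P := P) (p := Ideal.span {(p : ℤ)}), Nat.card_congr (Int.quotientSpanEquivZMod p).toEquiv]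
    simp
  have h1 : ∀ x : 𝓞 K, x ^ (p ^ 2) - x ∈ P := by
    intro x
    have a : σ • x - x ^ p ∈ P := by
      have := hσ x
      rwa [hcard] at this
    have b : σ • (σ • x) - (σ • x) ^ p ∈ P := by
      have := hσ (σ • x)
      rwa [hcard] at this
    rw [smul_smul, hexp, one_smul] at b
    have c : (σ • x) ^ p - (x ^ p) ^ p ∈ P := by
      have := sub_dvd_pow_sub_pow (σ • x) (x ^ p) p
      exact P.mem_of_dvd this a
    have := P.neg_mem (P.add_mem b c)
    rw [pow_two, pow_mul]
    convert this using 1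
    ring
  have h2 : Nat.card (𝓞 K ⧸ P) ≤ p ^ 2 := by
    let _ := Ideal.Quotient.field P
    let _ := Fintype.ofFinite (𝓞 K ⧸ P)
    have hp2 : 1 < p ^ 2 := Nat.one_lt_pow (by norm_num) hp.one_lt
    have hne := FiniteField.X_pow_card_sub_X_ne_zero (𝓞 K ⧸ P) hp2
    have hdeg := FiniteField.X_pow_card_sub_X_natDegree_eq (𝓞 K ⧸ P) hp2
    have := Polynomial.card_le_degree_of_subset_roots (p := (Polynomial.X ^ (p^2) - Polynomial.X : Polynomial (𝓞 K ⧸ P))) (Z := Finset.univ) (by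
      intro y _
      obtain ⟨x, rfl⟩ := Ideal.Quotient.mk_surjective y
      rw [Polynomial.mem_roots hne]
      simp only [Polynomial.IsRoot.def, Polynomial.eval_sub, Polynomial.eval_pow, Polynomial.eval_X]
      rw [← map_pow, ← map_sub]
      exact Ideal.Quotient.eq_zero_iff_mem.mpr (h1 x))
    rw [hdeg, Finset.card_univ] at this
    rwa [Nat.card_eq_fintype_card]
  have h3 : Ideal.absNorm P = p ^ P.inertiaDeg ℤ := by
    rw [Ideal.absNorm_eq_pow_inertiaDeg' P hp, Ideal.inertiaDeg'_eq_inertiaDeg]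
  rw [← Submodule.cardQuot_apply, ← Ideal.absNorm_apply, h3] at h2
  exact (Nat.pow_le_pow_iff_right hp.one_lt).mp h2
end

section
open scoped ENNReal Pointwise
open NumberField

lemma zcount {G : Type*} [Group G] [Finite G] (H : Fin 7 → Subgroup G)
    (hcount : ∀ σ : G, σ ≠ 1 → Nat.card {i // σ ∈ H i} = 3) (D : Subgroup G) :
    ∑ i, Nat.card (D ⊓ H i : Subgroup G) = 3 * Nat.card D + 4 := by
  classical
  let _ := Fintype.ofFinite G
  have h1 : ∀ i, Nat.card (D ⊓ H i : Subgroup G) = ∑ σ : D, if σ.1 ∈ H i then 1 else 0 := by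
    intro i
    rw [Finset.sum_ite, Finset.sum_const_zero, add_zero, ← Finset.card_eq_sum_ones, ← Fintype.card_subtype,
      ← Nat.card_eq_fintype_card]
    refine Nat.card_congr ⟨fun x => ⟨⟨x.1, x.2.1⟩, x.2.2⟩, fun x => ⟨x.1.1, x.1.2, x.2⟩, fun _ => rfl, fun _ => rfl⟩
  simp_rw [h1]
  rw [Finset.sum_comm]
  have h2 : ∀ σ : D, (∑ i, if σ.1 ∈ H i then 1 else 0) = 3 + if σ = 1 then 4 else 0 := by
    intro σ
    split_ifs with h
    · subst h; simp [one_mem]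
    · rw [Finset.sum_ite, Finset.sum_const_zero, add_zero, ← Finset.card_eq_sum_ones, ← Fintype.card_subtype,
      ← Nat.card_eq_fintype_card]
      exact hcount σ.1 (fun h' => h (Subtype.ext h'))
  simp_rw [h2]
  rw [Finset.sum_add_distrib]
  simp [Nat.card_eq_fintype_card, mul_comm]

lemma zlocal_rat (s : ℝ) {p : ℕ} (hp : p.Prime) :
    zlocal ℚ s p = (1 - (p : ENNReal) ^ (-s))⁻¹ := by
  have hm := zspan_prime hp
  have i1 : IsGaloisGroup Gal(ℚ/ℚ) ℤ (𝓞 ℚ) := IsGaloisGroup.of_isFractionRing _ _ _ ℚ ℚ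
  have := Ideal.ncard_primesOver_mul_ramificationIdxIn_mul_inertiaDegIn (Ideal.span {(p : ℤ)}) (𝓞 ℚ) Gal(ℚ/ℚ)
  have ig : IsGalois ℚ ℚ := IsGalois.self ℚ
  rw [IsGalois.card_aut_eq_finrank, Module.finrank_self] at this
  have ig2 : @IsGalois ℚ _ ℚ _ DivisionRing.toRatAlgebra := by
    convert IsGalois.self ℚ
    exact Subsingleton.elim _ _
  rw [zlocal_eq _ _ hp]
  have h1 := Nat.eq_one_of_mul_eq_one_right this
  have h2 := Nat.eq_one_of_mul_eq_one_left this
  have h3 := Nat.eq_one_of_mul_eq_one_left h2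
  rw [h1, h3]; simp

lemma zlocal_form (F : Type*) [Field F] [NumberField F] [IsGalois ℚ F] (s : ℝ) {p : ℕ}
    (hp : p.Prime) (hf : (Ideal.span {(p : ℤ)}).inertiaDegIn (𝓞 F) = 1 ∨ 
      (Ideal.span {(p : ℤ)}).inertiaDegIn (𝓞 F) = 2) (g m : ℕ)
    (hg : ((Ideal.span {(p : ℤ)}).primesOver (𝓞 F)).ncard = g)
    (hm : ((Ideal.span {(p : ℤ)}).primesOver (𝓞 F)).ncard * (Ideal.span {(p : ℤ)}).inertiaDegIn (𝓞 F) = m) :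
    g ≤ m ∧ m ≤ 2 * g ∧ zlocal F s p = ((1 - ((p : ENNReal) ^ (-s)) ^ 2)⁻¹) ^ (m - g) * 
      ((1 - ((p : ENNReal) ^ (-s)))⁻¹) ^ (2 * g - m) := by
  subst hg
  rw [zlocal_eq _ _ hp]
  rcases hf with h | h
  · rw [h, mul_one] at hm
    subst hm
    rw [h]
    refine ⟨le_rfl, by omega, ?_⟩
    rw [Nat.sub_self, two_mul, Nat.add_sub_cancel]; simp
  · rw [h] at hm
    subst hm
    rw [h]
    refine ⟨by omega, by omega, ?_⟩
    rw [mul_comm 2, Nat.sub_self, mul_two, Nat.add_sub_cancel]; simp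

theorem zlocal_identity (K : Type*) [Field K] [NumberField K] [IsGalois ℚ K]
    (hK : Module.finrank ℚ K = 8) (hexp : ∀ σ : Gal(K/ℚ), σ * σ = 1)
    (k : Fin 7 → IntermediateField ℚ K) [∀ i, IsGalois ℚ (k i)]
    (hk : ∀ i, Module.finrank ℚ (k i) = 2)
    (hcount : ∀ σ : Gal(K/ℚ), σ ≠ 1 → Nat.card {i // σ ∈ (k i).fixingSubgroup} = 3)
    {p : ℕ} (hp : p.Prime) (s : ℝ) :
    zlocal K s p * zlocal ℚ s p ^ 6 = ∏ i, zlocal (k i) s p := by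
  have hm := zspan_prime hp
  have hb : (Ideal.span {(p : ℤ)}) ≠ ⊥ := by simp [hp.ne_zero]
  have i1 : IsGaloisGroup Gal(K/ℚ) ℤ (𝓞 K) := IsGaloisGroup.of_isFractionRing _ _ _ ℚ K
  have hi : ∀ i, ((Ideal.span {(p : ℤ)}).primesOver (𝓞 (k i))).ncard *
      ((Ideal.span {(p : ℤ)}).ramificationIdxIn (𝓞 (k i)) * (Ideal.span {(p : ℤ)}).inertiaDegIn (𝓞 (k i))) = 2 := by
    intro i
    have i2 : IsGaloisGroup Gal(k i/ℚ) ℤ (𝓞 (k i)) := IsGaloisGroup.of_isFractionRing _ _ _ ℚ (k i)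
    rw [Ideal.ncard_primesOver_mul_ramificationIdxIn_mul_inertiaDegIn _ _ Gal(k i/ℚ), IsGalois.card_aut_eq_finrank, hk]
  have hKK := Ideal.ncard_primesOver_mul_ramificationIdxIn_mul_inertiaDegIn (Ideal.span {(p : ℤ)}) (𝓞 K) Gal(K/ℚ)
  rw [IsGalois.card_aut_eq_finrank, hK] at hKK
  obtain ⟨⟨P, hP1, hP2⟩⟩ : Nonempty ((Ideal.span {(p : ℤ)}).primesOver (𝓞 K)) := by
    by_contra h
    rw [Set.not_nonempty_iff_eq_empty'.mp h] at hKK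
    simp at hKK
  have cI : Nat.card (P.inertia Gal(K/ℚ)) = _ :=
    Ideal.card_inertia_eq_ramificationIdxIn (G := Gal(K/ℚ)) (Ideal.span {(p : ℤ)}) P
  have cD : Nat.card (MulAction.stabilizer Gal(K/ℚ) P) = _ :=
    Ideal.card_stabilizer_eq (G := Gal(K/ℚ)) (Ideal.span {(p : ℤ)}) P
  have hfK := zinertiaDeg_le K hexp hp P
  rw [← Ideal.inertiaDegIn_eq_inertiaDeg (Ideal.span {(p : ℤ)}) P Gal(K/ℚ)] at hfK
  have sI := zcount (fun i => (k i).fixingSubgroup) hcount (P.inertia Gal(K/ℚ))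
  have sD := zcount (fun i => (k i).fixingSubgroup) hcount (MulAction.stabilizer Gal(K/ℚ) P)
  have hsub := fun i => zcard_sub K (k i) hp P
  set g := ((Ideal.span {(p : ℤ)}).primesOver (𝓞 K)).ncard with hg
  set e := (Ideal.span {(p : ℤ)}).ramificationIdxIn (𝓞 K)
  set f := (Ideal.span {(p : ℤ)}).inertiaDegIn (𝓞 K) with hf
  set gi := fun i => ((Ideal.span {(p : ℤ)}).primesOver (𝓞 (k i))).ncard with hgi
  set ei := fun i => (Ideal.span {(p : ℤ)}).ramificationIdxIn (𝓞 (k i)) with hei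
  set fi := fun i => (Ideal.span {(p : ℤ)}).inertiaDegIn (𝓞 (k i)) with hfi
  set dI := fun i => Nat.card ((P.inertia Gal(K/ℚ)) ⊓ (k i).fixingSubgroup : Subgroup Gal(K/ℚ)) with hdI
  set dD := fun i => Nat.card ((MulAction.stabilizer Gal(K/ℚ) P) ⊓ (k i).fixingSubgroup : Subgroup Gal(K/ℚ)) with hdD
  rw [cI] at sI
  rw [cD] at sD
  rw [cI, cD] at hsub
  have e0 : 0 < e := Nat.pos_of_ne_zero (by rintro h; rw [h] at hKK; simp at hKK)
  have f0 : 0 < f := Nat.pos_of_ne_zero (by rintro h; rw [h] at hKK; simp at hKK)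
  have key1 : ∑ i, gi i = g + 6 := by
    have : ∀ i, e * f * gi i = 2 * dD i := by
      intro i
      have h1 : dD i * (ei i * fi i) = e * f := (hsub i).2
      have h2 : gi i * (ei i * fi i) = 2 := hi i
      rw [← h1]
      linear_combination (dD i) * h2
    have h3 : e * f * ∑ i, gi i = e * f * (g + 6) := by
      rw [Finset.mul_sum, Finset.sum_congr rfl (fun i _ => this i), ← Finset.mul_sum, sD]
      linear_combination -hKK
    exact Nat.eq_of_mul_eq_mul_left (Nat.mul_pos e0 f0) h3
  have key2 : ∑ i, gi i * fi i = g * f + 6 := by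
    have : ∀ i, e * (gi i * fi i) = 2 * dI i := by
      intro i
      have h1 : dI i * ei i = e := (hsub i).1
      have h2 : gi i * (ei i * fi i) = 2 := hi i
      rw [← h1]
      linear_combination (dI i) * h2
    have h3 : e * ∑ i, gi i * fi i = e * (g * f + 6) := by
      rw [Finset.mul_sum, Finset.sum_congr rfl (fun i _ => this i), ← Finset.mul_sum, sI]
      linear_combination -hKK
    exact Nat.eq_of_mul_eq_mul_left e0 h3
  have hfi12 : ∀ i, fi i = 1 ∨ fi i = 2 := by
    intro i
    have h2 : gi i * (ei i * fi i) = 2 := hi i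
    have : fi i ∣ 2 := ⟨gi i * ei i, by linear_combination -h2⟩
    exact (Nat.dvd_prime Nat.prime_two).mp this
  have A := zlocal_form K s hp (by change f = 1 ∨ f = 2; omega) g (g * f) rfl rfl
  have B := fun i => zlocal_form (k i) s hp (hfi12 i) (gi i) (gi i * fi i) rfl rfl
  rw [A.2.2, zlocal_rat s hp, Finset.prod_congr rfl (fun i _ => (B i).2.2), Finset.prod_mul_distrib,
    Finset.prod_pow_eq_pow_sum, Finset.prod_pow_eq_pow_sum, mul_assoc, ← pow_add]
  have E1 : ∑ i, (gi i * fi i - gi i) = g * f - g := by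
    rw [Finset.sum_tsub_distrib _ (fun i _ => (B i).1), key1, key2]; omega
  have E2 : ∑ i, (2 * gi i - gi i * fi i) = 2 * g - g * f + 6 := by
    rw [Finset.sum_tsub_distrib _ (fun i _ => (B i).2.1), ← Finset.mul_sum, key1, key2]
    have := A.2.1
    omega
  rw [E1, E2]

lemma zfun_ne_zero (F : Type*) [Field F] [NumberField F] (s : ℝ) : zfun F s ≠ 0 := by
  intro h
  have := ENNReal.tsum_eq_zero.mp h ⟨1, one_ne_zero⟩
  rw [zw_one] at this
  exact one_ne_zero this

open Filter Topology in
theorem zfun_identity (K : Type*) [Field K] [NumberField K] [IsGalois ℚ K]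
    (hK : Module.finrank ℚ K = 8) (hexp : ∀ σ : Gal(K/ℚ), σ * σ = 1)
    (k : Fin 7 → IntermediateField ℚ K) [∀ i, IsGalois ℚ (k i)]
    (hk : ∀ i, Module.finrank ℚ (k i) = 2)
    (hcount : ∀ σ : Gal(K/ℚ), σ ≠ 1 → Nat.card {i // σ ∈ (k i).fixingSubgroup} = 3)
    (s : ℝ) :
    zfun K s * zfun ℚ s ^ 6 = ∏ i, zfun (k i) s := by
  have h1 : ∀ S : Finset {p : ℕ // p.Prime}, (∏ p ∈ S, zlocal K s p.1) * (∏ p ∈ S, zlocal ℚ s p.1) ^ 6 =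
      ∏ i, ∏ p ∈ S, zlocal (k i) s p.1 := by
    intro S
    rw [← Finset.prod_pow, ← Finset.prod_mul_distrib, Finset.prod_comm]
    exact Finset.prod_congr rfl fun p _ => zlocal_identity K hK hexp k hk hcount p.2 s
  have t1 := ENNReal.Tendsto.mul (zfun_tendsto K s) (Or.inl (zfun_ne_zero K s))
    (ENNReal.Tendsto.pow (n := 6) (zfun_tendsto ℚ s)) (Or.inl (pow_ne_zero _ (zfun_ne_zero ℚ s)))
  have t2 : ∀ A : Finset (Fin 7), Tendsto (fun S : Finset {p : ℕ // p.Prime} =>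
      ∏ i ∈ A, ∏ p ∈ S, zlocal (k i) s p.1) atTop (𝓝 (∏ i ∈ A, zfun (k i) s)) := by
    classical
    intro A
    induction A using Finset.induction_on with
    | empty => simp
    | insert i A hi ih =>
      simp_rw [Finset.prod_insert hi]
      exact ENNReal.Tendsto.mul (zfun_tendsto (k i) s) (Or.inl (zfun_ne_zero _ _)) ih
        (Or.inl (Finset.prod_ne_zero_iff.mpr fun i _ => zfun_ne_zero _ _))
  simp_rw [h1] at t1
  exact tendsto_nhds_unique t1 (t2 Finset.univ)

lemma zeta_eq_zfun (F : Type*) [Field F] [NumberField F] (s : ℝ) :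
    dedekindZeta F s = ((zfun F s).toReal : ℂ) := by
  unfold dedekindZeta LSeries zfun
  have h1 : ∑' I : {I : Ideal (𝓞 F) // I ≠ 0}, zw F s I.1 = 
     ∑' n : ℕ, if n = 0 then (0 : ENNReal) else (Nat.card {I : Ideal (𝓞 F) // Ideal.absNorm I = n} : ENNReal) * (n : ENNReal) ^ (-s) := by
    rw [← (Equiv.sigmaFiberEquiv (fun I : {I : Ideal (𝓞 F) // I ≠ 0} => Ideal.absNorm I.1)).tsum_eq, ENNReal.tsum_sigma']
    refine tsum_congr fun n => ?_
    have : ∀ b : {I : {I : Ideal (𝓞 F) // I ≠ 0} // Ideal.absNorm I.1 = n}, zw F s ((Equiv.sigmaFiberEquiv (fun I : {I : Ideal (𝓞 F) // I ≠ 0} => Ideal.absNorm I.1)) ⟨n, b⟩).1 = (n : ENNReal) ^ (-s) := by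
      intro b
      simp only [Equiv.sigmaFiberEquiv, Equiv.coe_fn_mk, zw, b.2]
    rw [tsum_congr this]
    split_ifs with h0
    · subst h0
      have : IsEmpty {I : {I : Ideal (𝓞 F) // I ≠ 0} // Ideal.absNorm I.1 = 0} := ⟨fun I => I.1.2 (Ideal.absNorm_eq_zero_iff.mp I.2)⟩
      simp
    · let e : {I : {I : Ideal (𝓞 F) // I ≠ 0} // Ideal.absNorm I.1 = n} ≃ {I : Ideal (𝓞 F) // Ideal.absNorm I = n} :=
        ⟨fun x => ⟨x.1.1, x.2⟩, fun x => ⟨⟨x.1, fun h => h0 (by rw [← x.2, h]; simp)⟩, x.2⟩, fun _ => rfl, fun _ => rfl⟩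
      rw [e.tsum_eq (fun _ => (n : ENNReal) ^ (-s)), ENNReal.tsum_const]
      have : Finite {I : Ideal (𝓞 F) // Ideal.absNorm I = n} := Ideal.finite_setOfPred_absNorm_eq n
      rw [ENat.card_eq_coe_natCard]; rfl
  rw [h1, ENNReal.tsum_toReal_eq, Complex.ofReal_tsum]
  · refine tsum_congr fun n => ?_
    rw [LSeries.term_def]
    split_ifs with h0
    · simp
    · rw [ENNReal.toReal_mul, ENNReal.toReal_natCast, ← ENNReal.toReal_rpow, ENNReal.toReal_natCast,
        Real.rpow_neg (by positivity), Complex.ofReal_mul, Complex.ofReal_inv,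
        Complex.ofReal_cpow (by positivity), div_eq_mul_inv]
      simp
  · intro n
    split_ifs with h0
    · simp
    · exact ENNReal.mul_ne_top (by simp) (ENNReal.rpow_ne_top_of_ne_zero (by simpa using h0) (by simp))

open Filter Topology in
theorem residue_identity (K : Type*) [Field K] [NumberField K] [IsGalois ℚ K]
    (hK : Module.finrank ℚ K = 8) (hexp : ∀ σ : Gal(K/ℚ), σ * σ = 1)
    (k : Fin 7 → IntermediateField ℚ K) [∀ i, IsGalois ℚ (k i)]
    (hk : ∀ i, Module.finrank ℚ (k i) = 2)
    (hcount : ∀ σ : Gal(K/ℚ), σ ≠ 1 → Nat.card {i // σ ∈ (k i).fixingSubgroup} = 3) :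
    dedekindZeta_residue K * dedekindZeta_residue ℚ ^ 6 = ∏ i, dedekindZeta_residue (k i) := by
  have h1 : ∀ s : ℝ, ((s - 1) * dedekindZeta K s) * ((s - 1) * dedekindZeta ℚ s) ^ 6 =
      ∏ i, ((s - 1) * dedekindZeta (k i) s) := by
    intro s
    have := congrArg (fun x : ENNReal => (x.toReal : ℂ)) (zfun_identity K hK hexp k hk hcount s)
    simp only [ENNReal.toReal_mul, ENNReal.toReal_pow, ENNReal.toReal_prod, Complex.ofReal_mul, Complex.ofReal_pow, Complex.ofReal_prod, ← zeta_eq_zfun] at this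
    rw [Finset.prod_mul_distrib, ← this]
    simp
    ring
  have t1 := (tendsto_sub_one_mul_dedekindZeta_nhdsGT K).mul ((tendsto_sub_one_mul_dedekindZeta_nhdsGT ℚ).pow 6)
  have t2 := tendsto_finsetProd Finset.univ (fun i _ => tendsto_sub_one_mul_dedekindZeta_nhdsGT (k i))
  simp_rw [h1] at t1
  have := tendsto_nhds_unique t1 t2
  exact_mod_cast this
end

section
open NumberField Module

/-- `k` is a quadratic field generated by a square root `x` of `d`. -/
structure QF (k : Type*) [Field k] [NumberField k] (d : ℤ) (x : k) : Prop where
  sq : x ^ 2 = (d : k)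
  rk : finrank ℚ k = 2
  sf : Squarefree d
  gt : 1 < d

namespace QF

lemma nonsq {d : ℤ} (sf : Squarefree d) (gt : 1 < d) (u : ℚ) : u ^ 2 ≠ d := by
  intro h
  have h2 : IsSquare ((d : ℤ) : ℚ) := ⟨u, by rw [← h]; ring⟩
  rw [Rat.isSquare_intCast_iff] at h2
  obtain ⟨t, ht⟩ := h2
  have hu := sf t ⟨1, by rw [ht]; ring⟩
  rcases Int.isUnit_iff.mp hu with h | h <;> rw [h] at ht <;> norm_num at ht <;> omega

variable {k : Type*} [Field k] [NumberField k] {d : ℤ} {x : k}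

lemma coord_zero (h : QF k d x) {u v : ℚ} (huv : (u : k) + v * x = 0) : u = 0 ∧ v = 0 := by
  have hv : v = 0 := by
    by_contra hv
    have hvk : (v : k) ≠ 0 := by exact_mod_cast hv
    have : x = ((-u / v : ℚ) : k) := by
      push_cast
      field_simp
      linear_combination huv
    have h2 := h.sq
    rw [this] at h2
    exact nonsq h.sf h.gt (-u / v) (by exact_mod_cast h2)
  subst hv
  refine ⟨?_, rfl⟩
  simpa using huv

lemma coord_inj (h : QF k d x) {u v u' v' : ℚ} (huv : (u : k) + v * x = u' + v' * x) :
    u = u' ∧ v = v' := by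
  have := h.coord_zero (u := u - u') (v := v - v') (by push_cast; linear_combination huv)
  exact ⟨sub_eq_zero.mp this.1, sub_eq_zero.mp this.2⟩

lemma linInd (h : QF k d x) : LinearIndependent ℚ ![(1 : k), x] := by
  rw [LinearIndependent.pair_iff]
  intro s t hst
  apply h.coord_zero
  simpa [Algebra.smul_def] using hst

noncomputable def basis (h : QF k d x) : Basis (Fin 2) ℚ k :=
  basisOfLinearIndependentOfCardEqFinrank h.linInd (by simp [h.rk])

lemma basis_coe (h : QF k d x) : (h.basis : Fin 2 → k) = ![(1 : k), x] := by
  simp [basis]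

lemma exists_coord (h : QF k d x) (z : k) : ∃ u v : ℚ, z = u + v * x := by
  refine ⟨h.basis.repr z 0, h.basis.repr z 1, ?_⟩
  conv_lhs => rw [← h.basis.sum_repr z]
  rw [Fin.sum_univ_two, h.basis_coe]
  simp [Algebra.smul_def]

lemma leftMul (h : QF k d x) (u v : ℚ) :
    Algebra.leftMulMatrix h.basis ((u : k) + v * x) = !![u, d * v; v, u] := by
  have h0 : (h.basis.repr (u + v * x)) = Finsupp.equivFunOnFinite.symm ![u, v] := by
    rw [← LinearEquiv.eq_symm_apply, Basis.repr_symm_apply, Finsupp.linearCombination_apply,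
      Finsupp.sum_fintype _ _ (by simp)]
    simp [Fin.sum_univ_two, h.basis_coe, Algebra.smul_def]
  have h1 : (h.basis.repr ((u + v * x) * x)) = Finsupp.equivFunOnFinite.symm ![d * v, u] := by
    rw [← LinearEquiv.eq_symm_apply, Basis.repr_symm_apply, Finsupp.linearCombination_apply,
      Finsupp.sum_fintype _ _ (by simp)]
    simp [Fin.sum_univ_two, h.basis_coe, Algebra.smul_def]
    linear_combination (v : k) * h.sq
  ext i j
  rw [Algebra.leftMulMatrix_eq_repr_mul]
  fin_cases j
  · simp [h.basis_coe, h0]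
    fin_cases i <;> simp
  · simp [h.basis_coe, h1]
    fin_cases i <;> simp

lemma norm_eq (h : QF k d x) (u v : ℚ) : Algebra.norm ℚ ((u : k) + v * x) = u ^ 2 - d * v ^ 2 := by
  rw [Algebra.norm_eq_matrix_det h.basis, h.leftMul, Matrix.det_fin_two]
  simp; ring

lemma trace_eq (h : QF k d x) (u v : ℚ) : Algebra.trace ℚ k ((u : k) + v * x) = 2 * u := by
  rw [Algebra.trace_eq_matrix_trace h.basis, h.leftMul, Matrix.trace_fin_two]
  simp; ring

lemma int_coord (h : QF k d x) (z : 𝓞 k) : ∃ A B n : ℤ, (2 : k) * z = A + B * x ∧ A ^ 2 - d * B ^ 2 = 4 * n := by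
  obtain ⟨u, v, huv⟩ := h.exists_coord (algebraMap (𝓞 k) k z)
  have h1 := Algebra.isIntegral_trace (L := ℚ) (F := k) z.isIntegral_coe
  have h2 := Algebra.isIntegral_norm (R := ℤ) (L := k) (K := ℚ) z.isIntegral_coe
  rw [huv, h.trace_eq] at h1
  rw [huv, h.norm_eq] at h2
  obtain ⟨A, hA⟩ := IsIntegrallyClosed.isIntegral_iff.mp h1
  obtain ⟨n, hn⟩ := IsIntegrallyClosed.isIntegral_iff.mp h2
  simp at hA hn
  -- 2v is an integer since d (2v)^2 is an integer and d squarefree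
  have hv : (d : ℚ) * (2 * v) ^ 2 = ((A ^ 2 - 4 * n : ℤ) : ℚ) := by
    push_cast; rw [hA, hn]; ring
  have hB : ∃ B : ℤ, 2 * v = B := by
    have : IsIntegral ℤ ((d : ℚ) * (2 * v)) := by
      refine IsIntegral.of_pow (n := 2) (by norm_num) ?_
      have : ((d : ℚ) * (2 * v)) ^ 2 = ((d * (A ^ 2 - 4 * n) : ℤ) : ℚ) := by
        rw [mul_pow, pow_two (d : ℚ), mul_assoc, hv]; push_cast; ring
      rw [this]
      exact isIntegral_algebraMap (R := ℤ)
    obtain ⟨C, hC⟩ := IsIntegrallyClosed.isIntegral_iff.mp this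
    simp at hC
    have hd0 : d ≠ 0 := h.sf.ne_zero
    have h3 : d * (A ^ 2 - 4 * n) = C ^ 2 := by
      have : (d : ℚ) * (d * (2 * v) ^ 2) = C ^ 2 := by rw [hC]; ring
      rw [hv] at this
      exact_mod_cast this
    have h4 : d ∣ C := by
      rw [← h.sf.dvd_pow_iff_dvd (n := 2) (by norm_num)]
      exact ⟨_, h3.symm⟩
    obtain ⟨B, rfl⟩ := h4
    refine ⟨B, ?_⟩
    have hd0' : (d : ℚ) ≠ 0 := by exact_mod_cast hd0
    push_cast at hC
    exact (mul_left_cancel₀ hd0' hC).symm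
  obtain ⟨B, hB⟩ := hB
  refine ⟨A, B, n, ?_, ?_⟩
  · change 2 * algebraMap (𝓞 k) k z = _
    rw [huv]
    have e1 : (A : k) = ((2 * u : ℚ) : k) := by rw [← hA]; simp
    have e2 : (B : k) = ((2 * v : ℚ) : k) := by rw [hB]; simp
    rw [e1, e2]; push_cast; ring
  · have : ((A ^ 2 - d * B ^ 2 : ℤ) : ℚ) = (4 * n : ℤ) := by
      push_cast
      rw [← hB, hA, hn]; ring
    exact_mod_cast this

lemma int_coord' (h : QF k d x) (hd : d % 4 = 2 ∨ d % 4 = 3) (z : 𝓞 k) :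
    ∃ a b : ℤ, (z : k) = a + b * x := by
  obtain ⟨A, B, n, hz, hn⟩ := h.int_coord z
  have hAB : A % 2 = 0 ∧ B % 2 = 0 := by
    have h4 : (A ^ 2 - d * B ^ 2) % 4 = 0 := by rw [hn]; omega
    have : ∀ a b c : ℤ, (a = 0 ∨ a = 1 ∨ a = 2 ∨ a = 3) → (b = 0 ∨ b = 1 ∨ b = 2 ∨ b = 3) → (c = 2 ∨ c = 3) → (a ^ 2 - c * b ^ 2) % 4 = 0 → a % 2 = 0 ∧ b % 2 = 0 := by
      rintro a b c (rfl | rfl | rfl | rfl) (rfl | rfl | rfl | rfl) (rfl | rfl) <;> norm_num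
    have := this (A % 4) (B % 4) (d % 4) (by omega) (by omega) hd (by
      rw [← h4]; simp [Int.sub_emod, Int.mul_emod, pow_two])
    omega
  obtain ⟨a, ha⟩ : (2 : ℤ) ∣ A := Int.dvd_of_emod_eq_zero hAB.1
  obtain ⟨b, hb⟩ : (2 : ℤ) ∣ B := Int.dvd_of_emod_eq_zero hAB.2
  refine ⟨a, b, ?_⟩
  have : (2 : k) ≠ 0 := two_ne_zero
  apply mul_left_cancel₀ this
  rw [hz, ha, hb]; push_cast; ring

lemma isIntegral_x (h : QF k d x) : IsIntegral ℤ x := by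
  refine IsIntegral.of_pow (n := 2) (by norm_num) ?_
  rw [h.sq]
  exact isIntegral_algebraMap (R := ℤ)

noncomputable def X (h : QF k d x) : 𝓞 k := ⟨x, h.isIntegral_x⟩

@[simp] lemma coe_X (h : QF k d x) : (h.X : k) = x := rfl

lemma X_sq (h : QF k d x) : h.X ^ 2 = (d : 𝓞 k) := by
  apply RingOfIntegers.coe_injective
  simp [h.sq]

lemma int_coord'' (h : QF k d x) (hd : d % 4 = 2 ∨ d % 4 = 3) (z : 𝓞 k) :
    ∃ a b : ℤ, z = a + b * h.X := by
  obtain ⟨a, b, hab⟩ := h.int_coord' hd z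
  refine ⟨a, b, ?_⟩
  apply RingOfIntegers.coe_injective
  simpa using hab

lemma trace_int (h : QF k d x) (z : 𝓞 k) (u v : ℚ) (hz : (z : k) = u + v * x) :
    ((Algebra.trace ℤ (𝓞 k) z : ℤ) : ℚ) = 2 * u := by
  rw [← h.trace_eq u v, ← hz]
  exact (Algebra.trace_localization ℤ (nonZeroDivisors ℤ) (Rₘ := ℚ) (Sₘ := k) z).symm

lemma discr_23 (h : QF k d x) (hd : d % 4 = 2 ∨ d % 4 = 3) : discr k = 4 * d := by
  have li : LinearIndependent ℤ ![(1 : 𝓞 k), h.X] := by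
    rw [LinearIndependent.pair_iff]
    intro s t hst
    have := h.coord_zero (u := s) (v := t) (by
      have := congrArg (fun z : 𝓞 k => (z : k)) hst
      simpa using this)
    exact_mod_cast this
  have sp : ⊤ ≤ Submodule.span ℤ (Set.range ![(1 : 𝓞 k), h.X]) := by
    intro z _
    obtain ⟨a, b, rfl⟩ := h.int_coord'' hd z
    have e : (a : 𝓞 k) + b * h.X = a • (1 : 𝓞 k) + b • h.X := by simp
    rw [e]
    exact Submodule.add_mem _ (Submodule.smul_mem _ _ (Submodule.subset_span ⟨0, rfl⟩))
      (Submodule.smul_mem _ _ (Submodule.subset_span ⟨1, rfl⟩))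
  rw [← discr_eq_discr k (Basis.mk li sp), Algebra.discr_def, Matrix.det_fin_two]
  simp only [Algebra.traceMatrix_apply, Algebra.traceForm_apply, Basis.coe_mk, Matrix.cons_val_zero, Matrix.cons_val_one]
  have t1 := h.trace_int (1 * 1) 1 0 (by simp)
  have t2 := h.trace_int (1 * h.X) 0 1 (by simp)
  have t3 := h.trace_int (h.X * 1) 0 1 (by simp)
  have t4 := h.trace_int (h.X * h.X) d 0 (by simp [← h.sq]; ring)
  have : ∀ a b c e : ℤ, (a : ℚ) = 2 * 1 → (b : ℚ) = 2 * 0 → (c : ℚ) = 2 * 0 → (e : ℚ) = 2 * d → a * e - b * c = 4 * d := by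
    intro a b c e h1 h2 h3 h4
    have : ((a * e - b * c : ℤ) : ℚ) = (4 * d : ℤ) := by push_cast; rw [h1, h2, h3, h4]; ring
    exact_mod_cast this
  exact this _ _ _ _ t1 t2 t3 t4

lemma discr_1 (h : QF k d x) (hd : d % 4 = 1) : discr k = d := by
  have hy : IsIntegral ℤ ((1 + x) / 2) := by
    refine ⟨Polynomial.X ^ 2 - Polynomial.X - Polynomial.C ((d - 1) / 4), ?_, ?_⟩
    · monicity!
    · simp only [Polynomial.eval₂_sub, Polynomial.eval₂_pow, Polynomial.eval₂_X, Polynomial.eval₂_C]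
      have : (4 : k) * (((d - 1) / 4 : ℤ) : k) = d - 1 := by
        have : 4 * ((d - 1) / 4) = d - 1 := by omega
        exact_mod_cast congrArg (fun z : ℤ => (z : k)) this
      have h2 := h.sq
      simp only [algebraMap_int_eq, eq_intCast]
      field_simp
      linear_combination (1 : k) * h2 - this
  let Y : 𝓞 k := ⟨(1 + x) / 2, hy⟩
  have hY : (Y : k) = (1 / 2 : ℚ) + (1 / 2 : ℚ) * x := by
    change (1 + x) / 2 = _
    push_cast; ring
  have li : LinearIndependent ℤ ![(1 : 𝓞 k), Y] := by
    rw [LinearIndependent.pair_iff]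
    intro s t hst
    have := h.coord_zero (u := s + t / 2) (v := t / 2) (by
      have := congrArg (fun z : 𝓞 k => (z : k)) hst
      simp [hY] at this
      push_cast
      linear_combination this)
    have ht : (t : ℚ) = 0 := by linarith [this.2]
    have hs : (s : ℚ) = 0 := by linarith [this.1, this.2]
    exact_mod_cast And.intro hs ht
  have sp : ⊤ ≤ Submodule.span ℤ (Set.range ![(1 : 𝓞 k), Y]) := by
    intro z _
    obtain ⟨A, B, n, hz, hn⟩ := h.int_coord z
    have hAB : (A - B) % 2 = 0 := by
      have h4 : (A ^ 2 - d * B ^ 2) % 2 = 0 := by rw [hn]; omega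
      have hd2 : d % 2 = 1 := by omega
      rcases Int.emod_two_eq_zero_or_one A with ha | ha <;> rcases Int.emod_two_eq_zero_or_one B with hb | hb <;>
        simp [Int.sub_emod, Int.mul_emod, pow_two, ha, hb, hd2] at h4 ⊢
    have e : z = ((A - B) / 2) • (1 : 𝓞 k) + B • Y := by
      apply RingOfIntegers.coe_injective
      have : (2 : k) * (((A - B) / 2 : ℤ) : k) = A - B := by
        have : 2 * ((A - B) / 2) = A - B := by omega
        exact_mod_cast congrArg (fun z : ℤ => (z : k)) this
      simp [hY]
      have h2 : (2 : k) ≠ 0 := two_ne_zero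
      apply mul_left_cancel₀ h2
      linear_combination hz - this
    rw [e]
    exact Submodule.add_mem _ (Submodule.smul_mem _ _ (Submodule.subset_span ⟨0, rfl⟩))
      (Submodule.smul_mem _ _ (Submodule.subset_span ⟨1, rfl⟩))
  rw [← discr_eq_discr k (Basis.mk li sp), Algebra.discr_def, Matrix.det_fin_two]
  simp only [Algebra.traceMatrix_apply, Algebra.traceForm_apply, Basis.coe_mk, Matrix.cons_val_zero, Matrix.cons_val_one]
  have t1 := h.trace_int (1 * 1) 1 0 (by simp)
  have t2 := h.trace_int (1 * Y) (1/2) (1/2) (by simp [hY])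
  have t3 := h.trace_int (Y * 1) (1/2) (1/2) (by simp [hY])
  have t4 := h.trace_int (Y * Y) ((1 + d)/4) (1/2) (by simp [hY]; linear_combination (1/4 : k) * h.sq)
  have : ∀ a b c e : ℤ, (a : ℚ) = 2 * 1 → (b : ℚ) = 2 * (1/2) → (c : ℚ) = 2 * (1/2) → (e : ℚ) = 2 * ((1 + d)/4) → a * e - b * c = d := by
    intro a b c e h1 h2 h3 h4
    have : ((a * e - b * c : ℤ) : ℚ) = (d : ℤ) := by push_cast; rw [h1, h2, h3, h4]; ring
    exact_mod_cast this
  exact this _ _ _ _ t1 t2 t3 t4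

end QF
end

section
open NumberField Module NumberField.Units NumberField.InfinitePlace

section torsion
variable {K : Type*} [Field K] [NumberField K]

lemma torsion_real (φ : K →+* ℝ) {ζ : (𝓞 K)ˣ} (h : ζ ∈ torsion K) : ζ = 1 ∨ ζ = -1 := by
  rw [torsion, CommGroup.mem_torsion, isOfFinOrder_iff_pow_eq_one] at h
  obtain ⟨n, hn, h⟩ := h
  have h1 : (φ (ζ : 𝓞 K)) ^ n = 1 := by
    rw [← map_pow]
    have := congrArg (fun u : (𝓞 K)ˣ => ((u : 𝓞 K) : K)) h
    simp at this
    rw [this, map_one]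
  have h2 : |φ (ζ : 𝓞 K)| = 1 := by
    rw [← pow_eq_one_iff_of_nonneg (abs_nonneg _) hn.ne', ← abs_pow, h1, abs_one]
  rcases abs_eq (zero_le_one) |>.mp h2 with h3 | h3
  · left
    apply Units.ext
    apply RingOfIntegers.coe_injective
    apply φ.injective
    simpa using h3
  · right
    apply Units.ext
    apply RingOfIntegers.coe_injective
    apply φ.injective
    simpa using h3

lemma torsionOrder_real (φ : K →+* ℝ) : torsionOrder K = 2 := by
  classical
  refine Nat.le_antisymm ?_ (Nat.le_of_dvd (torsionOrder_pos K) (even_iff_two_dvd.mp (even_torsionOrder K)))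
  rw [torsionOrder]
  have hs : ∀ x : torsion K, x = 1 ∨ (x : (𝓞 K)ˣ) = -1 := by
    intro x
    rcases torsion_real φ x.2 with h | h
    · left; exact Subtype.ext h
    · right; exact h
  have : Function.Injective (fun x : torsion K => if x = 1 then (0 : Fin 2) else 1) := by
    intro x y hxy
    dsimp at hxy
    rcases hs x with h | h <;> rcases hs y with h' | h'
    · rw [h, h']
    · by_contra hne
      rw [h] at hxy
      rw [if_pos rfl, if_neg (fun h2 => hne (by rw [h, h2]))] at hxy
      exact absurd hxy (by decide)
    · by_contra hne
      rw [h'] at hxy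
      rw [if_pos rfl, if_neg (fun h2 => hne (by rw [h', h2]))] at hxy
      exact absurd hxy (by decide)
    · exact Subtype.ext (h.trans h'.symm)
  simpa using Nat.card_le_card_of_injective _ this

/-- Place of a real embedding -/
noncomputable def realPlace (φ : K →+* ℝ) : InfinitePlace K := InfinitePlace.mk (Complex.ofRealHom.comp φ)

lemma realPlace_apply (φ : K →+* ℝ) (x : K) : realPlace φ x = |φ x| := by
  rw [realPlace, InfinitePlace.apply]
  simp

end torsion

namespace QF
variable {k : Type*} [Field k] [NumberField k] {d : ℤ} {x : k}

lemma totallyReal (h : QF k d x) : IsTotallyReal k := by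
  constructor
  intro v
  rw [isReal_iff, ComplexEmbedding.isReal_iff]
  have hx : (starRingEnd ℂ) (v.embedding x) = v.embedding x := by
    have h1 : (v.embedding x) ^ 2 = ((d : ℝ) : ℂ) := by rw [← map_pow, h.sq]; simp
    have hd : (0 : ℝ) < d := by exact_mod_cast (zero_lt_one.trans h.gt)
    have h2 : (v.embedding x) ^ 2 = ((Real.sqrt d : ℝ) : ℂ) ^ 2 := by
      rw [h1, ← Complex.ofReal_pow, Real.sq_sqrt hd.le]
    rcases sq_eq_sq_iff_eq_or_eq_neg.mp h2 with h3 | h3 <;> rw [h3] <;> simp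
  ext z
  obtain ⟨u, w, rfl⟩ := h.exists_coord z
  simp [ComplexEmbedding.conjugate_coe_eq, hx]

lemma card_places (h : QF k d x) : Fintype.card (InfinitePlace k) = 2 := by
  have := h.totallyReal
  rw [card_eq_nrRealPlaces_add_nrComplexPlaces, IsTotallyReal.nrComplexPlaces_eq_zero, ← IsTotallyReal.finrank, h.rk]

lemma rank_eq (h : QF k d x) : rank k = 1 := by
  rw [rank, h.card_places]

theorem exists_fund (h : QF k d x) (φ : k →+* ℝ) : ∃ ε : (𝓞 k)ˣ, 1 < φ (ε : 𝓞 k) ∧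
    (∀ u : (𝓞 k)ˣ, ∃ n : ℤ, u = ε ^ n ∨ u = - ε ^ n) ∧ regulator k = Real.log (φ (ε : 𝓞 k)) := by
  classical
  have htr := h.totallyReal
  let i0 : Fin (rank k) := ⟨0, by rw [h.rank_eq]; norm_num⟩
  have hi0 : ∀ i : Fin (rank k), i = i0 := by
    intro i
    apply Fin.ext
    have := i.2
    have h9 := h.rank_eq
    change i.1 = 0
    omega
  set e0 := fundSystem k i0 with he0
  have hu0 : ∀ u : (𝓞 k)ˣ, ∃ n : ℤ, u = e0 ^ n ∨ u = - e0 ^ n := by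
    intro u
    obtain ⟨⟨ζ, e⟩, hu, -⟩ := exist_unique_eq_mul_prod k u
    simp only at hu
    rw [Fintype.prod_eq_single i0 (fun i hi => absurd (hi0 i) hi)] at hu
    refine ⟨e i0, ?_⟩
    rcases torsion_real φ ζ.2 with hz | hz <;> rw [hz] at hu
    · left; simpa using hu
    · right; simpa using hu
  have hreg : regulator k = |Real.log (|φ (e0 : 𝓞 k)|)| := by
    obtain ⟨w', hw'⟩ : ∃ w' : InfinitePlace k, w' ≠ realPlace φ := by
      have : 1 < Fintype.card (InfinitePlace k) := by rw [h.card_places]; norm_num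
      have := Fintype.one_lt_card_iff_nontrivial.mp this
      exact exists_ne _
    have hcard : Fintype.card {w // w ≠ w'} = 1 := by
      rw [Fintype.card_subtype_compl, h.card_places]; simp
    have hun : ∀ w : {w // w ≠ w'}, w = ⟨realPlace φ, hw'.symm⟩ :=
      fun w => (Fintype.card_le_one_iff.mp hcard.le) _ _
    let U : Unique {w // w ≠ w'} := ⟨⟨⟨realPlace φ, hw'.symm⟩⟩, hun⟩
    have e : {w // w ≠ w'} ≃ Fin (rank k) := Fintype.equivOfCardEq (by rw [hcard, h.rank_eq]; simp)
    rw [regulator_eq_det k w' e, Matrix.det_unique]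
    simp only [Matrix.of_apply, IsTotallyReal.mult_eq, Nat.cast_one, one_mul]
    rw [hi0 (e default)]
    change |Real.log (realPlace φ _)| = _
    rw [realPlace_apply]
  have hpos := regulator_pos k
  have hneg : ∀ u : (𝓞 k)ˣ, φ ((-u : (𝓞 k)ˣ) : 𝓞 k) = - φ (u : 𝓞 k) := by intro u; simp
  have hφ0 : φ (e0 : 𝓞 k) ≠ 0 := by
    rw [map_ne_zero]
    exact_mod_cast e0.ne_zero
  have hφ1 : |φ (e0 : 𝓞 k)| ≠ 1 := by
    intro h1; rw [h1] at hreg; simp at hreg; rw [hreg] at hpos; exact lt_irrefl _ hpos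
  have key : ∀ (ε : (𝓞 k)ˣ), (ε = e0 ∨ ε = -e0 ∨ ε = e0⁻¹ ∨ ε = -e0⁻¹) → 1 < φ (ε : 𝓞 k) →
      1 < φ (ε : 𝓞 k) ∧ (∀ u : (𝓞 k)ˣ, ∃ n : ℤ, u = ε ^ n ∨ u = - ε ^ n) ∧ regulator k = Real.log (φ (ε : 𝓞 k)) := by
    intro ε hε h1
    refine ⟨h1, ?_, ?_⟩
    · intro u
      obtain ⟨n, hn⟩ := hu0 u
      rcases hε with rfl | rfl | rfl | rfl
      · exact ⟨n, hn⟩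
      · refine ⟨n, ?_⟩
        rcases Int.even_or_odd n with he | he
        · rw [he.neg_zpow]; exact hn
        · rw [he.neg_zpow, neg_neg]; exact hn.symm
      · refine ⟨-n, ?_⟩
        rw [inv_zpow', neg_neg]; exact hn
      · refine ⟨-n, ?_⟩
        rcases Int.even_or_odd n with he | he
        · rw [he.neg.neg_zpow, inv_zpow', neg_neg]; exact hn
        · rw [he.neg.neg_zpow, neg_neg, inv_zpow', neg_neg]; exact hn.symm
    · rw [hreg]
      have : |Real.log (|φ (e0 : 𝓞 k)|)| = |Real.log (φ (ε : 𝓞 k))| := by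
        have hinv : φ ((e0⁻¹ : (𝓞 k)ˣ) : 𝓞 k) = (φ (e0 : 𝓞 k))⁻¹ := by
          apply eq_inv_of_mul_eq_one_left; rw [← map_mul]
          have : (((e0⁻¹ : (𝓞 k)ˣ) : 𝓞 k) : k) * (e0 : 𝓞 k) = 1 := by
            have := congrArg (fun u : (𝓞 k)ˣ => ((u : 𝓞 k) : k)) (inv_mul_cancel e0)
            simpa using this
          rw [this, map_one]
        rw [Real.log_abs]
        rcases hε with rfl | rfl | rfl | rfl
        · rfl
        · simp
        · rw [hinv, Real.log_inv, abs_neg]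
        · rw [hneg, Real.log_neg_eq_log, hinv, Real.log_inv, abs_neg]
      rw [this, abs_of_pos (Real.log_pos h1)]
  have hinv : φ ((e0⁻¹ : (𝓞 k)ˣ) : 𝓞 k) = (φ (e0 : 𝓞 k))⁻¹ := by
    apply eq_inv_of_mul_eq_one_left; rw [← map_mul]
    have : (((e0⁻¹ : (𝓞 k)ˣ) : 𝓞 k) : k) * (e0 : 𝓞 k) = 1 := by
      have := congrArg (fun u : (𝓞 k)ˣ => ((u : 𝓞 k) : k)) (inv_mul_cancel e0)
      simpa using this
    rw [this, map_one]
  rcases lt_or_gt_of_ne hφ0 with hs | hs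
  · rw [abs_of_neg hs] at hφ1
    rcases lt_or_gt_of_ne hφ1 with hl | hl
    · refine ⟨-e0⁻¹, key _ (by simp) ?_⟩
      rw [hneg, hinv, ← inv_neg]
      exact (one_lt_inv₀ (by linarith)).mpr hl
    · refine ⟨-e0, key _ (by simp) ?_⟩
      rw [hneg]; exact hl
  · rw [abs_of_pos hs] at hφ1
    rcases lt_or_gt_of_ne hφ1 with hl | hl
    · refine ⟨e0⁻¹, key _ (by simp) ?_⟩
      rw [hinv]
      exact (one_lt_inv₀ hs).mpr hl
    · exact ⟨e0, key _ (by simp) hl⟩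

end QF
end

section
open NumberField Module NumberField.Units NumberField.InfinitePlace

lemma sym1 (p : ℕ) [hp : Fact p.Prime] (d m : ℤ) (hd : (p : ℤ) ∣ d) (hd2 : ¬ (p : ℤ) ^ 2 ∣ d)
    (hm : ¬ (p : ℤ) ∣ m) : ∀ (N : ℕ) (n x y : ℤ), n.natAbs ≤ N → n ≠ 0 → x ^ 2 - d * y ^ 2 = m * n ^ 2 → IsSquare (m : ZMod p) := by
  have hpp : Prime (p : ℤ) := Nat.prime_iff_prime_int.mp hp.out
  intro N
  induction N with
  | zero => intro n x y h1 h2; omega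
  | succ N ih =>
    intro n x y h1 h2 h3
    by_cases hn : (p : ℤ) ∣ n
    · have hx : (p : ℤ) ∣ x := by
        apply hpp.dvd_of_dvd_pow (n := 2)
        have : x ^ 2 = d * y ^ 2 + m * n ^ 2 := by linarith
        rw [this]
        exact dvd_add (hd.mul_right _) (Dvd.dvd.mul_left (dvd_pow hn (by norm_num)) _)
      obtain ⟨n', rfl⟩ := hn
      obtain ⟨x', rfl⟩ := hx
      obtain ⟨d', rfl⟩ := hd
      have hp0 : (p : ℤ) ≠ 0 := hpp.ne_zero
      have hy : (p : ℤ) ∣ y := by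
        have h4 : (p : ℤ) ∣ d' * y ^ 2 := by
          have : (p : ℤ) * (d' * y ^ 2) = p * (p * (x' ^ 2 - m * n' ^ 2)) := by linear_combination -h3
          rw [mul_left_cancel₀ hp0 this]
          exact dvd_mul_right _ _
        rcases hpp.dvd_or_dvd h4 with h5 | h5
        · exfalso; apply hd2; rw [pow_two]; exact mul_dvd_mul_left _ h5
        · exact hpp.dvd_of_dvd_pow h5
      obtain ⟨y', rfl⟩ := hy
      refine ih n' x' y' ?_ (by rintro rfl; simp at h2) ?_
      · rw [Int.natAbs_mul, Int.natAbs_natCast] at h1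
        have := hp.out.two_le
        have h6 : 0 < n'.natAbs := Int.natAbs_pos.mpr (by rintro rfl; simp at h2)
        nlinarith
      · have : (p : ℤ) ^ 2 * (x' ^ 2 - p * d' * y' ^ 2) = p ^ 2 * (m * n' ^ 2) := by linear_combination h3
        exact mul_left_cancel₀ (pow_ne_zero 2 hp0) this
    · have hn' : (n : ZMod p) ≠ 0 := by rwa [Ne, ZMod.intCast_zmod_eq_zero_iff_dvd]
      have hd' : (d : ZMod p) = 0 := by rwa [ZMod.intCast_zmod_eq_zero_iff_dvd]
      have h4 := congrArg (fun z : ℤ => (z : ZMod p)) h3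
      push_cast at h4
      rw [hd', zero_mul, sub_zero] at h4
      refine ⟨x / n, ?_⟩
      field_simp
      exact h4.symm

lemma sym_ls (p : ℕ) [hp : Fact p.Prime] (d m n x y : ℤ) (hd : (p : ℤ) ∣ d) (hd2 : ¬ (p : ℤ) ^ 2 ∣ d)
    (hm : ¬ (p : ℤ) ∣ m) (hn : n ≠ 0) (h : x ^ 2 - d * y ^ 2 = m * n ^ 2) : legendreSym p m = 1 := by
  rw [legendreSym.eq_one_iff p (by rwa [Ne, ZMod.intCast_zmod_eq_zero_iff_dvd])]
  exact sym1 p d m hd hd2 hm _ n x y le_rfl hn h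

lemma sym_ls2 (p : ℕ) [hp : Fact p.Prime] (d m n x y : ℤ) (hd : ¬ (p : ℤ) ∣ d)
    (hm : ¬ (p : ℤ) ∣ m) (hn : n ≠ 0) (h : x ^ 2 - p * d * y ^ 2 = p * m * n ^ 2) : legendreSym p (-(d * m)) = 1 := by
  have hpp : Prime (p : ℤ) := Nat.prime_iff_prime_int.mp hp.out
  have hp0 : (p : ℤ) ≠ 0 := hpp.ne_zero
  have hx : (p : ℤ) ∣ x := by
    apply hpp.dvd_of_dvd_pow (n := 2)
    exact ⟨d * y ^ 2 + m * n ^ 2, by linear_combination h⟩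
  obtain ⟨X, rfl⟩ := hx
  refine sym_ls p (p * d) _ n (d * y) X (dvd_mul_right _ _) ?_ ?_ hn ?_
  · rw [pow_two]
    intro h5
    exact hd ((mul_dvd_mul_iff_left hp0).mp h5)
  · rw [dvd_neg]
    intro h5
    rcases hpp.dvd_or_dvd h5 with h6 | h6
    · exact hd h6
    · exact hm h6
  · apply mul_left_cancel₀ hp0
    linear_combination (-d) * h

/-- clearing denominators -/
lemma clear_den (d m : ℤ) (a b : ℚ) (h : a ^ 2 - d * b ^ 2 = m) :
    ∃ n x y : ℤ, n ≠ 0 ∧ x ^ 2 - d * y ^ 2 = m * n ^ 2 := by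
  refine ⟨a.den * b.den, a.num * b.den, b.num * a.den, ?_, ?_⟩
  · have := a.den_nz; have := b.den_nz; positivity
  · have ha : (a.num : ℚ) = a * a.den := (Rat.mul_den_eq_num a).symm
    have hb : (b.num : ℚ) = b * b.den := (Rat.mul_den_eq_num b).symm
    have : (((a.num * b.den) ^ 2 - d * (b.num * a.den) ^ 2 : ℤ) : ℚ) = ((m * (a.den * b.den) ^ 2 : ℤ) : ℚ) := by
      push_cast
      rw [ha, hb]
      linear_combination ((a.den : ℚ) * b.den) ^ 2 * h
    exact_mod_cast this

namespace QF
variable {k : Type*} [Field k] [NumberField k] {d : ℤ} {x : k}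

lemma unit_norm (h : QF k d x) (ε : (𝓞 k)ˣ) (u v : ℚ) (hε : ((ε : 𝓞 k) : k) = u + v * x) :
    u ^ 2 - d * v ^ 2 = 1 ∨ u ^ 2 - d * v ^ 2 = -1 := by
  have h1 := (NumberField.isUnit_iff_norm (x := (ε : 𝓞 k))).mp ε.isUnit
  have h2 : ((RingOfIntegers.norm ℚ (ε : 𝓞 k) : 𝓞 ℚ) : ℚ) = u ^ 2 - d * v ^ 2 := by
    rw [← h.norm_eq, ← hε]; rfl
  rw [h2] at h1
  exact (abs_eq zero_le_one).mp h1

/-- integer coordinates of a unit norm -/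
lemma not_sq_fund (h : QF k d x) (φ : k →+* ℝ) (ε : (𝓞 k)ˣ) (h1 : 1 < φ (ε : 𝓞 k))
    (hu : ∀ u : (𝓞 k)ˣ, ∃ n : ℤ, u = ε ^ n ∨ u = - ε ^ n) (y : k) : y ^ 2 ≠ ((ε : 𝓞 k) : k) := by
  intro hy
  have hyi : IsIntegral ℤ y := by
    refine IsIntegral.of_pow (n := 2) (by norm_num) ?_
    rw [hy]; exact (ε : 𝓞 k).isIntegral_coe
  let Y : 𝓞 k := ⟨y, hyi⟩
  have hY : Y ^ 2 = ε := by apply RingOfIntegers.coe_injective; simp only [map_pow]; exact hy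
  have hYu : IsUnit Y := by
    rw [← isUnit_pow_iff (n := 2) (by norm_num), hY]; exact ε.isUnit
  obtain ⟨U, hU⟩ := hYu
  obtain ⟨n, hn⟩ := hu U
  have h2 : U ^ 2 = ε := by apply Units.ext; rw [Units.val_pow_eq_pow_val, hU, hY]
  have h3 : ε ^ (2 * n - 1) = 1 := by
    have : (ε ^ n) ^ 2 = ε := by
      rcases hn with rfl | rfl
      · exact h2
      · rwa [neg_sq] at h2
    rw [zpow_sub, zpow_one, mul_comm 2 n, zpow_mul]
    rw [mul_inv_eq_one]
    exact_mod_cast this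
  have h4 : (φ (ε : 𝓞 k)) ^ (2 * n - 1) = 1 := by
    rw [← map_zpow₀]
    have := congrArg (fun u : (𝓞 k)ˣ => ((u : 𝓞 k) : k)) h3
    simp only [NumberField.Units.coe_zpow] at this
    rw [this]; simp
  have h5 := (zpow_eq_one_iff_right₀ (by linarith) h1.ne').mp h4
  omega

theorem descent (h : QF k d x) (φ : k →+* ℝ) (ε : (𝓞 k)ˣ) (h1 : 1 < φ (ε : 𝓞 k))
    (hu : ∀ u : (𝓞 k)ˣ, ∃ n : ℤ, u = ε ^ n ∨ u = - ε ^ n)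
    (u v : ℚ) (hε : ((ε : 𝓞 k) : k) = u + v * x) (hN : u ^ 2 - d * v ^ 2 = 1) :
    ∃ m : ℕ, Squarefree m ∧ (m : ℤ) ∣ 2 * d ∧ m ≠ 1 ∧ (m : ℤ) ≠ d ∧ (∃ t : ℤ, t ≠ 0 ∧ 2 + 2 * u = m * t ^ 2) ∧ 
      (∃ y : k, (m : k) * (ε : 𝓞 k) = y ^ 2) ∧ ∃ n X Y : ℤ, n ≠ 0 ∧ X ^ 2 - d * Y ^ 2 = m * n ^ 2 := by
  obtain ⟨A, B, n, hA, hn⟩ := h.int_coord (ε : 𝓞 k)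
  have hAB : (A : ℚ) = 2 * u ∧ (B : ℚ) = 2 * v := by
    apply h.coord_inj
    push_cast
    rw [← hA]
    rw [hε]; ring
  have hAB4 : A ^ 2 - d * B ^ 2 = 4 := by
    have : ((A ^ 2 - d * B ^ 2 : ℤ) : ℚ) = (4 : ℤ) := by
      push_cast; rw [hAB.1, hAB.2]; linear_combination 4 * hN
    exact_mod_cast this
  -- positivity of 2 + A
  have hpos : 0 < 2 + A := by
    have hφ : φ (ε : 𝓞 k) + (φ (ε : 𝓞 k))⁻¹ = A := by
      have hinv : (φ (ε : 𝓞 k))⁻¹ = φ (u - v * x) := by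
        apply inv_eq_of_mul_eq_one_right
        rw [← map_mul, hε]
        have : ((u : k) + v * x) * (u - v * x) = ((1 : ℚ) : k) := by
          rw [← hN]; push_cast; linear_combination (- (v : k) ^ 2) * h.sq
        rw [this]; simp
      rw [hinv, hε, ← map_add]
      have : (u : k) + v * x + (u - v * x) = ((A : ℤ) : k) := by
        have : ((A : ℚ) : k) = ((2 * u : ℚ) : k) := by rw [hAB.1]
        push_cast at this
        rw [this]; ring
      rw [this]; simp
    have h3 : (0 : ℝ) < A := by rw [← hφ]; positivity
    have : 0 < A := by exact_mod_cast h3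
    omega
  obtain ⟨M, hM⟩ : ∃ M : ℕ, (M : ℤ) = 2 + A := ⟨(2 + A).toNat, Int.toNat_of_nonneg hpos.le⟩
  have hM0 : M ≠ 0 := by omega
  obtain ⟨m, t, hmt, hsf⟩ := Nat.sq_mul_squarefree M
  have ht0 : t ≠ 0 := by rintro rfl; simp at hmt; omega
  have hmtZ : (2 : ℤ) + A = m * t ^ 2 := by rw [← hM]; exact_mod_cast (by rw [← hmt]; ring)
  have hmy : (m : k) * (ε : 𝓞 k) = ((1 + (ε : 𝓞 k)) / t) ^ 2 := by
    have ht0' : (t : k) ≠ 0 := by exact_mod_cast ht0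
    have e1 : (2 : k) + 2 * u = m * t ^ 2 := by
      have := congrArg (fun z : ℤ => (z : k)) hmtZ
      push_cast at this
      rw [← this]
      have : ((A : ℚ) : k) = ((2 * u : ℚ) : k) := by rw [hAB.1]
      push_cast at this
      rw [this]
    have e2 : (u : k) ^ 2 - d * v ^ 2 = 1 := by exact_mod_cast congrArg (fun z : ℚ => (z : k)) hN
    field_simp
    rw [hε]
    linear_combination (-1 : k) * (u + v * x) * e1 + e2 - (v : k) ^ 2 * h.sq
  have hd0 : d ≠ 0 := h.sf.ne_zero
  have hx0 : x ≠ 0 := by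
    rintro rfl
    have := h.sq
    rw [zero_pow two_ne_zero] at this
    exact hd0 (by exact_mod_cast this.symm)
  refine ⟨m, hsf, ?_, ?_, ?_, ⟨t, by exact_mod_cast ht0, ?_⟩, ⟨_, hmy⟩, ?_⟩
  · rw [← dvd_abs, ← Int.natCast_natAbs, Int.natCast_dvd_natCast]
    rw [← Nat.prod_primeFactors_of_squarefree hsf]
    apply Finset.prod_primes_dvd
    · intro p hp; exact (Nat.prime_of_mem_primeFactors hp).prime
    · intro p hp
      have hpp := Nat.prime_of_mem_primeFactors hp
      have hpm := Nat.dvd_of_mem_primeFactors hp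
      have hpz : Prime (p : ℤ) := Nat.prime_iff_prime_int.mp hpp
      rw [← Int.natCast_dvd_natCast, Int.natCast_natAbs, dvd_abs]
      by_contra hcon
      have hp2 : ¬ (p : ℤ) ∣ 2 := fun h9 => hcon (h9.mul_right _)
      have hpd : ¬ (p : ℤ) ∣ d := fun h9 => hcon (h9.mul_left _)
      have hpmZ : (p : ℤ) ∣ m := by exact_mod_cast hpm
      have hpA : ¬ (p : ℤ) ∣ A - 2 := by
        intro h9
        have h10 : (p : ℤ) ∣ 2 * 2 := by
          have : (2 : ℤ) * 2 = m * t ^ 2 - (A - 2) := by rw [← hmtZ]; ring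
          rw [this]
          exact dvd_sub (hpmZ.mul_right _) h9
        rcases hpz.dvd_or_dvd h10 with h | h <;> exact hp2 h
      have heq : (m : ℤ) * t ^ 2 * (A - 2) = d * B ^ 2 := by rw [← hmtZ]; linear_combination hAB4
      have heqN : m * t ^ 2 * (A - 2).natAbs = d.natAbs * B.natAbs ^ 2 := by
        have := congrArg Int.natAbs heq
        simpa [Int.natAbs_mul, Int.natAbs_pow] using this
      have hA0 : (A - 2).natAbs ≠ 0 := by
        intro h9; apply hpA; rw [Int.natAbs_eq_zero] at h9; rw [h9]; exact dvd_zero _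
      have hm0 : m ≠ 0 := hsf.ne_zero
      have hB0 : B.natAbs ≠ 0 := by
        intro h9; rw [h9] at heqN
        have : m * t ^ 2 * (A - 2).natAbs ≠ 0 := by positivity
        simp at heqN; tauto
      have hf := congrArg (fun z => z.factorization p) heqN
      rw [Nat.factorization_mul (by positivity) hA0, Nat.factorization_mul hm0 (by positivity),
        Nat.factorization_mul (Int.natAbs_ne_zero.mpr hd0) (by positivity), Nat.factorization_pow, Nat.factorization_pow] at hf
      simp only [Finsupp.add_apply, Finsupp.smul_apply, smul_eq_mul] at hf
      have f1 : (A - 2).natAbs.factorization p = 0 := Nat.factorization_eq_zero_of_not_dvd (by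
        rwa [← Int.natCast_dvd_natCast, Int.natCast_natAbs, dvd_abs])
      have f2 : d.natAbs.factorization p = 0 := Nat.factorization_eq_zero_of_not_dvd (by
        rwa [← Int.natCast_dvd_natCast, Int.natCast_natAbs, dvd_abs])
      have f3 : m.factorization p = 1 := by
        have h9 := hsf.natFactorization_le_one p
        have h10 := (hpp.dvd_iff_one_le_factorization hm0).mp hpm
        omega
      omega
  · rintro rfl
    refine h.not_sq_fund φ ε h1 hu ((1 + (ε : 𝓞 k)) / t) ?_
    rw [← hmy]; simp
  · intro hmd
    refine h.not_sq_fund φ ε h1 hu ((1 + (ε : 𝓞 k)) / t / x) ?_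
    rw [div_pow _ x, ← hmy, h.sq, ← hmd]
    have : ((m : ℕ) : k) ≠ 0 := by exact_mod_cast hsf.ne_zero
    push_cast
    field_simp
  · rw [← hAB.1]; exact_mod_cast hmtZ
  · have hN2 : ((1 + u) / t) ^ 2 - d * (v / t) ^ 2 = ((m : ℤ) : ℚ) := by
      have e1 : (2 : ℚ) + A = m * t ^ 2 := by exact_mod_cast hmtZ
      have ht0' : (t : ℚ) ≠ 0 := by exact_mod_cast ht0
      rw [hAB.1] at e1
      push_cast
      field_simp
      linear_combination hN + e1
    exact clear_den d m _ _ hN2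
end QF
end

section
open NumberField Module NumberField.Units NumberField.InfinitePlace

/-- The arithmetic hypotheses on `q, r, s, Q, Q'`. -/
structure Ar (q r s Q Q' : ℕ) [Fact q.Prime] [Fact r.Prime] [Fact s.Prime] : Prop where
  q4 : q % 4 = 3
  r8 : r % 8 = 5
  s8 : s % 8 = 5
  qr : q ≠ r
  qs : q ≠ s
  rs : r ≠ s
  hQ : (Q = q ∧ Q' = 2 * q) ∨ (Q = 2 * q ∧ Q' = q)
  rQ : legendreSym r Q = 1
  sQ : legendreSym s Q = 1
  rQ' : legendreSym r Q' = -1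
  sQ' : legendreSym s Q' = -1
  r2 : legendreSym r (2 : ℕ) = -1
  s2 : legendreSym s (2 : ℕ) = -1
  r_s : legendreSym r s = 1
  s_r : legendreSym s r = 1
  rn : legendreSym r (-1) = 1
  sn : legendreSym s (-1) = 1
  qn : legendreSym q (-1) = -1
  qrs : legendreSym q (r * s) = 1

lemma ls_neg_one_of_5 (p : ℕ) [Fact p.Prime] (h : p % 8 = 5) : legendreSym p (-1) = 1 := by
  rw [legendreSym.at_neg_one (by omega), ZMod.χ₄_nat_one_mod_four (by omega)]

lemma ls_two_of_5 (p : ℕ) [Fact p.Prime] (h : p % 8 = 5) : legendreSym p (2 : ℕ) = -1 := by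
  have h2 := legendreSym.at_two (p := p) (by omega)
  have : ZMod.χ₈ (p : ZMod 8) = -1 := by
    rw [ZMod.χ₈_nat_eq_if_mod_eight]; simp [h]; omega
  rw [this] at h2
  exact_mod_cast h2

lemma ls_ne_of (p p' : ℕ) [Fact p.Prime] (h : legendreSym p p' ≠ 0) : p ≠ p' := by
  rintro rfl
  apply h
  rw [legendreSym.eq_zero_iff]; simp

lemma ar_of (η q r s : ℕ) [Fact q.Prime] [Fact r.Prime] [Fact s.Prime]
    (hη : η = 1 ∨ η = 2)
    (hq4 : q % 4 = 3) (hr8 : r % 8 = 5) (hs8 : s % 8 = 5)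
    (hqr : legendreSym r q = (-1) ^ (if η = 2 then 1 else 0))
    (hqs : legendreSym s q = (-1) ^ (if η = 2 then 1 else 0))
    (hrs : legendreSym s r = 1) : Ar q r s (η * q) (if η = 1 then 2 * q else q) := by
  have r2 := ls_two_of_5 r hr8
  have s2 := ls_two_of_5 s hs8
  have rs : s ≠ r := ls_ne_of s r (by rw [hrs]; norm_num)
  have hsr : legendreSym r s = 1 := by
    rw [legendreSym.quadratic_reciprocity_one_mod_four (by omega) (by omega), hrs]
  have qr : legendreSym q r = legendreSym r q :=
    legendreSym.quadratic_reciprocity_one_mod_four (by omega) (by omega)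
  have qs : legendreSym q s = legendreSym s q :=
    legendreSym.quadratic_reciprocity_one_mod_four (by omega) (by omega)
  have e2 : ∀ p : ℕ, [Fact p.Prime] → legendreSym p ((2 * q : ℕ) : ℤ) = legendreSym p (2 : ℕ) * legendreSym p q := by
    intro p _; push_cast; rw [legendreSym.mul]
  refine ⟨hq4, hr8, hs8, by rintro rfl; omega, by rintro rfl; omega, rs.symm, ?_, ?_, ?_, ?_, ?_, r2, s2, hsr, hrs,
    ls_neg_one_of_5 r hr8, ls_neg_one_of_5 s hs8, ?_, ?_⟩
  · rcases hη with rfl | rfl <;> simp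
  · rcases hη with rfl | rfl
    · simpa using hqr
    · rw [e2, r2, hqr]; simp
  · rcases hη with rfl | rfl
    · simpa using hqs
    · rw [e2, s2, hqs]; simp
  · rcases hη with rfl | rfl
    · simp only [if_true]; rw [e2, r2, hqr]; simp
    · simpa using hqr
  · rcases hη with rfl | rfl
    · simp only [if_true]; rw [e2, s2, hqs]; simp
    · simpa using hqs
  · rw [legendreSym.at_neg_one (by omega), ZMod.χ₄_nat_three_mod_four (by omega)]
  · rw [legendreSym.mul, qr, qs, hqr, hqs]
    rcases hη with rfl | rfl <;> simp

lemma ls_pow (p : ℕ) [Fact p.Prime] (a : ℤ) (e : ℕ) (h : legendreSym p a = 1) : legendreSym p (a ^ e) = 1 := by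
  have : legendreSym p (a ^ e) = (legendreSym p a) ^ e := map_pow (legendreSym.hom p) a e
  rw [this, h, one_pow]

lemma not_dvd_of_ls (p : ℕ) [Fact p.Prime] (a : ℤ) (h : legendreSym p a ≠ 0) : ¬ (p : ℤ) ∣ a := by
  intro h2; apply h; rw [legendreSym.eq_zero_iff]; rwa [ZMod.intCast_zmod_eq_zero_iff_dvd]

lemma sq_not_dvd (p : ℕ) [Fact p.Prime] (a : ℤ) (h : ¬ (p : ℤ) ∣ a) : ¬ (p : ℤ) ^ 2 ∣ p * a := by
  have hp0 : (p : ℤ) ≠ 0 := by exact_mod_cast (Fact.out : p.Prime).ne_zero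
  rw [pow_two, mul_dvd_mul_iff_left hp0]; exact h

/-- symbol conditions at `p`, `d = D0 * p * p'`. -/
lemma symA (p p' : ℕ) [Fact p.Prime] (hpp : legendreSym p p' = 1) (D0 M0 : ℤ) (hD : legendreSym p D0 ≠ 0)
    (hM : legendreSym p M0 ≠ 0) (e : ℕ) (n X Y : ℤ) (hn : n ≠ 0)
    (h : X ^ 2 - D0 * p * p' * Y ^ 2 = M0 * p' ^ e * n ^ 2) : legendreSym p M0 = 1 := by
  have h1 : legendreSym p (M0 * p' ^ e) = legendreSym p M0 := by
    rw [legendreSym.mul, ls_pow p _ e hpp, mul_one]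
  have h2 : ¬ (p : ℤ) ∣ D0 * p' := not_dvd_of_ls p _ (by rw [legendreSym.mul, hpp, mul_one]; exact hD)
  rw [← h1]
  refine sym_ls p (p * (D0 * p')) _ n X Y (dvd_mul_right _ _) (sq_not_dvd p _ h2)
    (not_dvd_of_ls p _ (by rw [h1]; exact hM)) hn (by rw [← h]; ring)

lemma symB (p p' : ℕ) [Fact p.Prime] (hpp : legendreSym p p' = 1) (hpn : legendreSym p (-1) = 1) (D0 M0 : ℤ) (hD : legendreSym p D0 ≠ 0)
    (hM : legendreSym p M0 ≠ 0) (e : ℕ) (n X Y : ℤ) (hn : n ≠ 0)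
    (h : X ^ 2 - D0 * p * p' * Y ^ 2 = M0 * p * p' ^ e * n ^ 2) : legendreSym p D0 * legendreSym p M0 = 1 := by
  have h1 : legendreSym p (M0 * p' ^ e) = legendreSym p M0 := by
    rw [legendreSym.mul, ls_pow p _ e hpp, mul_one]
  have h2' : legendreSym p (D0 * p') = legendreSym p D0 := by rw [legendreSym.mul, hpp, mul_one]
  have := sym_ls2 p (D0 * p') (M0 * p' ^ e) n X Y (not_dvd_of_ls p _ (by rw [h2']; exact hD))
    (not_dvd_of_ls p _ (by rw [h1]; exact hM)) hn (by linear_combination h)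
  rwa [neg_eq_neg_one_mul, legendreSym.mul, hpn, one_mul, legendreSym.mul, h2', h1] at this

namespace Ar
variable {q r s Q Q' : ℕ} [hqf : Fact q.Prime] [hrf : Fact r.Prime] [hsf : Fact s.Prime]

lemma lsr (h : Ar q r s Q Q') {M0 : ℕ} (hM : M0 = 1 ∨ M0 = Q ∨ M0 = 2 ∨ M0 = Q') :
   ((M0 = 1 ∨ M0 = Q) ∧ legendreSym r M0 = 1 ∧ legendreSym s M0 = 1) ∨ 
   ((M0 = 2 ∨ M0 = Q') ∧ legendreSym r M0 = -1 ∧ legendreSym s M0 = -1) := by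
  rcases hM with rfl | rfl | rfl | rfl
  · left; simp
  · left; exact ⟨Or.inr rfl, h.rQ, h.sQ⟩
  · right; exact ⟨Or.inl rfl, h.r2, h.s2⟩
  · right; exact ⟨Or.inr rfl, h.rQ', h.sQ'⟩

/-- divisors of 2qrs -/
lemma divisors (h : Ar q r s Q Q') {m : ℕ} (hm : m ∣ 2 * q * r * s) :
    ∃ M0 c e : ℕ, (M0 = 1 ∨ M0 = Q ∨ M0 = 2 ∨ M0 = Q') ∧ (c = 0 ∨ c = 1) ∧ (e = 0 ∨ e = 1) ∧ m = M0 * r ^ c * s ^ e := by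
  obtain ⟨m1, m2, h1, h2, rfl⟩ := (Nat.dvd_mul).mp hm
  obtain ⟨m3, m4, h3, h4, rfl⟩ := (Nat.dvd_mul).mp h1
  obtain ⟨m5, m6, h5, h6, rfl⟩ := (Nat.dvd_mul).mp h3
  rw [Nat.dvd_prime hsf.out] at h2
  rw [Nat.dvd_prime hrf.out] at h4
  rw [Nat.dvd_prime hqf.out] at h6
  rw [Nat.dvd_prime Nat.prime_two] at h5
  have hM : (m5 * m6 = 1 ∨ m5 * m6 = Q ∨ m5 * m6 = 2 ∨ m5 * m6 = Q') := by
    rcases h.hQ with ⟨e1, e2⟩ | ⟨e1, e2⟩ <;> rcases h5 with e5 | e5 <;> rcases h6 with e6 | e6 <;> rw [e1, e2, e5, e6] <;> simp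
  have hc : ∃ c : ℕ, (c = 0 ∨ c = 1) ∧ m4 = r ^ c := by
    rcases h4 with e | e
    · exact ⟨0, by simp [e]⟩
    · exact ⟨1, by simp [e]⟩
  have he : ∃ c : ℕ, (c = 0 ∨ c = 1) ∧ m2 = s ^ c := by
    rcases h2 with e | e
    · exact ⟨0, by simp [e]⟩
    · exact ⟨1, by simp [e]⟩
  obtain ⟨c, hc, rfl⟩ := hc
  obtain ⟨e, he, rfl⟩ := he
  exact ⟨m5 * m6, c, e, hM, hc, he, rfl⟩

/-- classification, with allowed sign in front of `m`. -/
lemma classify (h : Ar q r s Q Q') {D0 M0 c e : ℕ} (hD : D0 = 1 ∨ D0 = Q ∨ D0 = 2 ∨ D0 = Q')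
    (hM : M0 = 1 ∨ M0 = Q ∨ M0 = 2 ∨ M0 = Q') (hc : c = 0 ∨ c = 1) (he : e = 0 ∨ e = 1) (δ : ℤ) (hδ : δ = 1 ∨ δ = -1)
    (n X Y : ℤ) (hn : n ≠ 0) (heq : X ^ 2 - D0 * r * s * Y ^ 2 = δ * (M0 * r ^ c * s ^ e : ℕ) * n ^ 2) :
    ((D0 = 1 ∨ D0 = Q) → (M0 = 1 ∨ M0 = Q)) ∧ 
    ((D0 = 2 ∨ D0 = Q') → ((M0 = 1 ∨ M0 = Q) ∧ c = 0 ∧ e = 0) ∨ ((M0 = 2 ∨ M0 = Q') ∧ c = 1 ∧ e = 1)) := by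
  have lδr : legendreSym r (δ * M0) = legendreSym r M0 := by
    rcases hδ with rfl | rfl
    · simp
    · rw [legendreSym.mul, h.rn, one_mul]
  have lδs : legendreSym s (δ * M0) = legendreSym s M0 := by
    rcases hδ with rfl | rfl
    · simp
    · rw [legendreSym.mul, h.sn, one_mul]
  have hDr := h.lsr hD
  have hMr := h.lsr hM
  have D0r : legendreSym r D0 ≠ 0 := by rcases hDr with ⟨-, h1, -⟩ | ⟨-, h1, -⟩ <;> rw [h1] <;> norm_num
  have D0s : legendreSym s D0 ≠ 0 := by rcases hDr with ⟨-, -, h1⟩ | ⟨-, -, h1⟩ <;> rw [h1] <;> norm_num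
  have M0r : legendreSym r (δ * M0) ≠ 0 := by rw [lδr]; rcases hMr with ⟨-, h1, -⟩ | ⟨-, h1, -⟩ <;> rw [h1] <;> norm_num
  have M0s : legendreSym s (δ * M0) ≠ 0 := by rw [lδs]; rcases hMr with ⟨-, -, h1⟩ | ⟨-, -, h1⟩ <;> rw [h1] <;> norm_num
  push_cast at heq
  have r0 : c = 0 → legendreSym r M0 = 1 := by
    rintro rfl
    rw [← lδr]
    exact symA r s h.r_s D0 (δ * M0) D0r M0r e n X Y hn (by rw [heq]; ring)
  have s0 : e = 0 → legendreSym s M0 = 1 := by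
    rintro rfl
    rw [← lδs]
    exact symA s r h.s_r D0 (δ * M0) D0s M0s c n X Y hn (by linear_combination heq)
  have r1 : c = 1 → legendreSym r D0 * legendreSym r M0 = 1 := by
    rintro rfl
    rw [← lδr]
    exact symB r s h.r_s h.rn D0 (δ * M0) D0r M0r e n X Y hn (by rw [heq]; ring)
  have s1 : e = 1 → legendreSym s D0 * legendreSym s M0 = 1 := by
    rintro rfl
    rw [← lδs]
    exact symB s r h.s_r h.sn D0 (δ * M0) D0s M0s c n X Y hn (by linear_combination heq)
  have cross : ∀ D : ℕ, legendreSym r D = 1 → legendreSym r D = -1 → False := by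
    intro D a b; rw [a] at b; norm_num at b
  constructor
  · intro hD1
    have hD1' : legendreSym r D0 = 1 := by
      rcases hD1 with rfl | rfl
      · simp
      · exact h.rQ
    rcases hMr with ⟨h1, -, -⟩ | ⟨h1, h2, -⟩
    · exact h1
    · exfalso
      rcases hc with hc | hc
      · exact cross _ (r0 hc) h2
      · have := r1 hc; rw [hD1', one_mul] at this; exact cross _ this h2
  · intro hD1
    have hD1' : legendreSym r D0 = -1 ∧ legendreSym s D0 = -1 := by
      rcases hD1 with rfl | rfl
      · exact ⟨h.r2, h.s2⟩
      · exact ⟨h.rQ', h.sQ'⟩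
    rcases hMr with ⟨h1, h2, h3⟩ | ⟨h1, h2, h3⟩
    · left
      refine ⟨h1, ?_, ?_⟩
      · rcases hc with hc | hc
        · exact hc
        · have := r1 hc; rw [hD1'.1, h2] at this; norm_num at this
      · rcases he with hc | hc
        · exact hc
        · have := s1 hc; rw [hD1'.2, h3] at this; norm_num at this
    · right
      refine ⟨h1, ?_, ?_⟩
      · rcases hc with hc | hc
        · have := r0 hc; rw [h2] at this; norm_num at this
        · exact hc
      · rcases he with hc | hc
        · have := s0 hc; rw [h3] at this; norm_num at this
        · exact hc
end Ar
end

section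
open NumberField Module NumberField.Units NumberField.InfinitePlace

/-- `ε` is the fundamental unit w.r.t. the real embedding `φ`. -/
structure Fd {k : Type*} [Field k] [NumberField k] (φ : k →+* ℝ) (ε : (𝓞 k)ˣ) : Prop where
  gt : 1 < φ (ε : 𝓞 k)
  gen : ∀ u : (𝓞 k)ˣ, ∃ n : ℤ, u = ε ^ n ∨ u = - ε ^ n

namespace Ar
variable {q r s Q Q' : ℕ} [hqf : Fact q.Prime] [hrf : Fact r.Prime] [hsf : Fact s.Prime]
variable {k : Type*} [Field k] [NumberField k] {x : k}

lemma q_not_dvd_rs (h : Ar q r s Q Q') : ¬ (q : ℤ) ∣ r * s :=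
  not_dvd_of_ls q _ (by rw [h.qrs]; norm_num)

lemma q_not_dvd_2 (h : Ar q r s Q Q') : ¬ (q : ℤ) ∣ 2 := by
  intro h1
  have := Int.le_of_dvd (by norm_num) h1
  have := h.q4
  omega

lemma sw {d : ℤ} (h : QF k d x) (m m' w : ℤ) (hm : m ≠ 0) (hw : m * m' = d * w ^ 2) (ε : k)
   (hy : ∃ y : k, (m : k) * ε = y ^ 2) : ∃ y : k, (m' : k) * ε = y ^ 2 := by
  obtain ⟨y, hy⟩ := hy
  refine ⟨x * w * y / m, ?_⟩
  have hm' : (m : k) ≠ 0 := by exact_mod_cast hm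
  have hw' : (m : k) * m' = d * w ^ 2 := by exact_mod_cast congrArg (fun z : ℤ => (z : k)) hw
  field_simp
  rw [h.sq, ← hy]
  linear_combination m * ε * hw'

lemma norm_one (h : Ar q r s Q Q') {d : ℤ} (hd : (q : ℤ) ∣ d) (hd2 : ¬ (q : ℤ) ^ 2 ∣ d) (hk : QF k d x)
    (ε : (𝓞 k)ˣ) (u v : ℚ) (hε : ((ε : 𝓞 k) : k) = u + v * x) : u ^ 2 - d * v ^ 2 = 1 := by
  rcases hk.unit_norm ε u v hε with h1 | h1
  · exact h1
  · exfalso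
    obtain ⟨n, X, Y, hn, he⟩ := clear_den d (-1) u v (by rw [h1]; simp)
    have := sym_ls q d (-1) n X Y hd hd2 (not_dvd_of_ls q _ (by rw [h.qn]; norm_num)) hn he
    rw [h.qn] at this
    norm_num at this

lemma q_dvd (h : Ar q r s Q Q') {D0 : ℕ} (hD : D0 = Q ∨ D0 = Q') : ((q : ℤ) ∣ D0) ∧ ¬ ((q : ℤ) ^ 2 ∣ D0) ∧ ¬ ((q : ℤ) ^ 2 ∣ D0 * r * s) ∧ (D0 = q ∨ D0 = 2 * q) := by
  have hD' : D0 = q ∨ D0 = 2 * q := by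
    rcases h.hQ with ⟨h1, h2⟩ | ⟨h1, h2⟩ <;> rw [h1, h2] at hD <;> tauto
  have hq : Prime (q : ℤ) := Nat.prime_iff_prime_int.mp hqf.out
  have hn2 := h.q_not_dvd_2
  have hnrs := h.q_not_dvd_rs
  refine ⟨?_, ?_, ?_, hD'⟩
  · rcases hD' with rfl | rfl <;> simp
  · rcases hD' with rfl | rfl
    · have := sq_not_dvd D0 1 (fun h => hq.not_dvd_one h)
      simpa using this
    · have := sq_not_dvd q 2 hn2
      push_cast
      rwa [mul_comm]
  · rcases hD' with rfl | rfl
    · have := sq_not_dvd D0 (r * s) hnrs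
      rwa [← mul_assoc] at this
    · have := sq_not_dvd q (2 * (r * s)) (fun h9 => by
        rcases hq.dvd_or_dvd h9 with h9 | h9
        · exact hn2 h9
        · exact hnrs h9)
      push_cast
      intro h9; apply this
      convert h9 using 1; ring

lemma fund_Q (h : Ar q r s Q Q') {D0 : ℕ} (hD : D0 = Q ∨ D0 = Q') (hk : QF k (D0 : ℤ) x) (φ : k →+* ℝ) (ε : (𝓞 k)ˣ)
    (hf : Fd φ ε) (u v : ℚ) (hε : ((ε : 𝓞 k) : k) = u + v * x) :
    u ^ 2 - (D0 : ℤ) * v ^ 2 = 1 ∧ ∃ y : k, (2 : k) * (ε : 𝓞 k) = y ^ 2 := by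
  obtain ⟨hd1, hd2, -, hD'⟩ := h.q_dvd hD
  have hN := h.norm_one hd1 hd2 hk ε u v hε
  refine ⟨hN, ?_⟩
  obtain ⟨m, msf, hm, m1, md, -, hy, -⟩ := hk.descent φ ε hf.gt hf.gen u v hε hN
  have hm' : m ∣ 2 * D0 := by exact_mod_cast hm
  have hmq : m ∣ 2 * q := by
    rcases hD' with rfl | rfl
    · exact hm'
    · rw [← msf.dvd_pow_iff_dvd two_ne_zero]
      exact hm'.trans ⟨q, by ring⟩
  obtain ⟨m1', m2, h1, h2, rfl⟩ := (Nat.dvd_mul).mp hmq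
  rw [Nat.dvd_prime hqf.out] at h2
  rw [Nat.dvd_prime Nat.prime_two] at h1
  have hq0 : (q : ℤ) ≠ 0 := by exact_mod_cast hqf.out.ne_zero
  rcases h1 with rfl | rfl <;> rcases h2 with rfl | rfl
  · exact absurd rfl m1
  · rcases hD' with rfl | rfl
    · simp at md
    · exact_mod_cast sw hk m2 2 1 hq0 (by push_cast; ring) ((ε : 𝓞 k) : k) (by push_cast at hy ⊢; simpa using hy)
  · simpa using hy
  · rcases hD' with rfl | rfl
    · exact_mod_cast sw hk (2 * D0) 2 2 (by positivity) (by push_cast; ring) ((ε : 𝓞 k) : k) (by push_cast at hy ⊢; simpa using hy)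
    · exact absurd rfl md

lemma fund_rs (h : Ar q r s Q Q') (hk : QF k (((1 : ℕ) : ℤ) * r * s) x) (φ : k →+* ℝ) (ε : (𝓞 k)ˣ)
    (hf : Fd φ ε) (u v : ℚ) (hε : ((ε : 𝓞 k) : k) = u + v * x) (hN : u ^ 2 - (((1 : ℕ) : ℤ) * r * s : ℤ) * v ^ 2 = 1) :
    ∃ y : k, (r : k) * (ε : 𝓞 k) = y ^ 2 := by
  obtain ⟨m, msf, hm, m1, md, -, hy, n, X, Y, hn, he⟩ := hk.descent φ ε hf.gt hf.gen u v hε hN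
  have hm1 : m ∣ 2 * (1 * r * s) := by exact_mod_cast hm
  have hm' : m ∣ 2 * q * r * s := hm1.trans ⟨q, by ring⟩
  obtain ⟨M0, c, e, hM, hc, hE, rfl⟩ := h.divisors hm'
  have hcl := (h.classify (Or.inl rfl) hM hc hE 1 (Or.inl rfl) n X Y hn (by rw [one_mul]; exact he)).1 (Or.inl rfl)
  have hM0 : M0 = 1 := by
    rcases hcl with h1 | rfl
    · exact h1
    · exfalso
      have h2 := (h.q_dvd (Or.inl rfl)).1
      have h3 : (q : ℤ) ∣ 2 * (r * s) := by
        refine h2.trans ?_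
        have : M0 ∣ 2 * (r * s) := (dvd_mul_right M0 _).trans (by rw [one_mul] at hm1; rw [mul_assoc] at hm1; exact hm1)
        exact_mod_cast this
      have hq : Prime (q : ℤ) := Nat.prime_iff_prime_int.mp hqf.out
      rcases hq.dvd_or_dvd h3 with h9 | h9
      · exact h.q_not_dvd_2 h9
      · exact h.q_not_dvd_rs h9
  subst hM0
  have hs0 : (s : ℤ) ≠ 0 := by exact_mod_cast hsf.out.ne_zero
  rcases hc with rfl | rfl <;> rcases hE with rfl | rfl
  · simp at m1
  · exact_mod_cast sw hk s r 1 hs0 (by push_cast; ring) ((ε : 𝓞 k) : k) (by push_cast at hy ⊢; simpa using hy)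
  · simpa using hy
  · simp at md

lemma fund_2rs (h : Ar q r s Q Q') (hk : QF k (((2 : ℕ) : ℤ) * r * s) x) (φ : k →+* ℝ) (ε : (𝓞 k)ˣ)
    (hf : Fd φ ε) (u v : ℚ) (hε : ((ε : 𝓞 k) : k) = u + v * x) : u ^ 2 - (((2 : ℕ) : ℤ) * r * s : ℤ) * v ^ 2 = -1 := by
  rcases hk.unit_norm ε u v hε with hN | hN
  swap
  · exact hN
  exfalso
  obtain ⟨m, msf, hm, m1, md, -, hy, n, X, Y, hn, he⟩ := hk.descent φ ε hf.gt hf.gen u v hε hN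
  have hm1 : m ∣ 2 * (2 * r * s) := by exact_mod_cast hm
  have hm2 : m ∣ 2 * r * s := by
    rw [← msf.dvd_pow_iff_dvd two_ne_zero]
    exact hm1.trans ⟨r * s, by ring⟩
  have hm' : m ∣ 2 * q * r * s := hm2.trans ⟨q, by ring⟩
  obtain ⟨M0, c, e, hM, hc, hE, rfl⟩ := h.divisors hm'
  have hcl := (h.classify (Or.inr (Or.inr (Or.inl rfl))) hM hc hE 1 (Or.inl rfl) n X Y hn (by rw [one_mul]; exact he)).2 (Or.inl rfl)
  have hMq : ¬ (q : ℤ) ∣ M0 := by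
    intro h1
    have h3 : (q : ℤ) ∣ 2 * (r * s) := by
      refine h1.trans ?_
      have : M0 ∣ 2 * (r * s) := (dvd_mul_right M0 _).trans (by rw [mul_assoc, mul_assoc] at hm2; exact hm2)
      exact_mod_cast this
    have hq : Prime (q : ℤ) := Nat.prime_iff_prime_int.mp hqf.out
    rcases hq.dvd_or_dvd h3 with h9 | h9
    · exact h.q_not_dvd_2 h9
    · exact h.q_not_dvd_rs h9
  rcases hcl with ⟨h1, rfl, rfl⟩ | ⟨h1, rfl, rfl⟩
  · rcases h1 with rfl | rfl
    · simp at m1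
    · exact hMq (h.q_dvd (Or.inl rfl)).1
  · rcases h1 with rfl | rfl
    · simp at md
    · exact hMq (h.q_dvd (Or.inr rfl)).1

lemma dvd_2qrs (h : Ar q r s Q Q') {D0 m : ℕ} (hD : D0 = Q ∨ D0 = Q') (msf : Squarefree m)
    (hm : (m : ℤ) ∣ 2 * (D0 * r * s)) : m ∣ 2 * q * r * s := by
  have hm1 : m ∣ 2 * (D0 * r * s) := by exact_mod_cast hm
  rcases (h.q_dvd hD).2.2.2 with rfl | rfl
  · convert hm1 using 1; ring
  · rw [← msf.dvd_pow_iff_dvd two_ne_zero]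
    exact hm1.trans ⟨q * r * s, by ring⟩

lemma fund_Q'rs (h : Ar q r s Q Q') (hk : QF k ((Q' : ℤ) * r * s) x) (φ : k →+* ℝ) (ε : (𝓞 k)ˣ)
    (hf : Fd φ ε) (u v : ℚ) (hε : ((ε : 𝓞 k) : k) = u + v * x) : 
    u ^ 2 - ((Q' : ℤ) * r * s : ℤ) * v ^ 2 = 1 ∧ ∃ y : k, (Q : k) * (ε : 𝓞 k) = y ^ 2 := by
  obtain ⟨hd1, -, hd2, hD'⟩ := h.q_dvd (Or.inr rfl)
  have hN := h.norm_one ((hd1.mul_right r).mul_right s) hd2 hk ε u v hε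
  refine ⟨hN, ?_⟩
  obtain ⟨m, msf, hm, m1, md, -, hy, n, X, Y, hn, he⟩ := hk.descent φ ε hf.gt hf.gen u v hε hN
  have hm' := h.dvd_2qrs (Or.inr rfl) msf hm
  obtain ⟨M0, c, e, hM, hc, hE, rfl⟩ := h.divisors hm'
  have hcl := (h.classify (Or.inr (Or.inr (Or.inr rfl))) hM hc hE 1 (Or.inl rfl) n X Y hn (by rw [one_mul]; exact he)).2 (Or.inr rfl)
  have hs0 : (s : ℤ) ≠ 0 := by exact_mod_cast hsf.out.ne_zero
  have hr0 : (r : ℤ) ≠ 0 := by exact_mod_cast hrf.out.ne_zero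
  rcases hcl with ⟨h1, rfl, rfl⟩ | ⟨h1, rfl, rfl⟩
  · rcases h1 with rfl | rfl
    · simp at m1
    · simpa using hy
  · rcases h1 with rfl | rfl
    · rcases h.hQ with ⟨rfl, rfl⟩ | ⟨rfl, rfl⟩
      · exact_mod_cast sw hk (2 * r * s) Q 1 (by positivity) (by push_cast; ring) ((ε : 𝓞 k) : k) (by push_cast at hy ⊢; simpa using hy)
      · have := sw hk (2 * r * s) (2 * Q') 2 (by positivity) (by push_cast; ring) ((ε : 𝓞 k) : k) (by push_cast at hy ⊢; simpa using hy)
        push_cast at this ⊢; exact this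
    · simp at md

lemma fund_Qrs (h : Ar q r s Q Q') (hk : QF k ((Q : ℤ) * r * s) x) (φ : k →+* ℝ) (ε : (𝓞 k)ˣ)
    (hf : Fd φ ε) (u v : ℚ) (hε : ((ε : 𝓞 k) : k) = u + v * x)
    (hns : ¬ ∃ t : ℤ, t ≠ 0 ∧ 2 + 2 * u = r * s * t ^ 2) : 
    u ^ 2 - ((Q : ℤ) * r * s : ℤ) * v ^ 2 = 1 ∧ 
      ((∃ y : k, (r : k) * (ε : 𝓞 k) = y ^ 2) ∨ (∃ y : k, (s : k) * (ε : 𝓞 k) = y ^ 2)) := by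
  obtain ⟨hd1, -, hd2, hD'⟩ := h.q_dvd (Or.inl rfl)
  have hN := h.norm_one ((hd1.mul_right r).mul_right s) hd2 hk ε u v hε
  refine ⟨hN, ?_⟩
  obtain ⟨m, msf, hm, m1, md, hT, hy, n, X, Y, hn, he⟩ := hk.descent φ ε hf.gt hf.gen u v hε hN
  have hm' := h.dvd_2qrs (Or.inl rfl) msf hm
  obtain ⟨M0, c, e, hM, hc, hE, rfl⟩ := h.divisors hm'
  have hcl := (h.classify (Or.inr (Or.inl rfl)) hM hc hE 1 (Or.inl rfl) n X Y hn (by rw [one_mul]; exact he)).1 (Or.inr rfl)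
  have hs0 : (s : ℤ) ≠ 0 := by exact_mod_cast hsf.out.ne_zero
  have hr0 : (r : ℤ) ≠ 0 := by exact_mod_cast hrf.out.ne_zero
  have hQ0 : (Q : ℤ) ≠ 0 := by
    have := hqf.out.pos
    rcases hD' with h | h <;> rw [h] <;> positivity
  rcases hcl with rfl | rfl <;> rcases hc with rfl | rfl <;> rcases hE with rfl | rfl
  · simp at m1
  · right; simpa using hy
  · left; simpa using hy
  · exfalso; apply hns
    obtain ⟨t, ht, ht2⟩ := hT
    exact ⟨t, ht, by rw [ht2]; push_cast; ring⟩
  · exfalso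
    -- M = Q, contradiction at q
    have hη : ∃ η : ℤ, (M0 : ℤ) = q * η ∧ ¬ (q : ℤ) ∣ η := by
      rcases hD' with h1 | h1
      · exact ⟨1, by rw [h1]; ring, fun h9 => (Nat.prime_iff_prime_int.mp hqf.out).not_dvd_one h9⟩
      · exact ⟨2, by rw [h1]; push_cast; ring, h.q_not_dvd_2⟩
    obtain ⟨η, hη, hη2⟩ := hη
    have hq : Prime (q : ℤ) := Nat.prime_iff_prime_int.mp hqf.out
    have := sym_ls2 q (η * (r * s)) η n X Y (fun h9 => by
      rcases hq.dvd_or_dvd h9 with h9 | h9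
      · exact hη2 h9
      · exact h.q_not_dvd_rs h9) hη2 hn (by push_cast at he; rw [hη] at he; linear_combination he)
    have e1 : -(η * ((r : ℤ) * s) * η) = -1 * (r * s) * (η * η) := by ring
    rw [e1, legendreSym.mul, legendreSym.mul, h.qn, h.qrs, legendreSym.mul] at this
    have h0 : legendreSym q η * legendreSym q η = 1 := by
      rw [← pow_two]
      apply legendreSym.sq_one
      rwa [Ne, ZMod.intCast_zmod_eq_zero_iff_dvd]
    rw [h0] at this
    norm_num at this
  · left; exact_mod_cast sw hk (M0 * s) r 1 (by positivity) (by push_cast; ring) ((ε : 𝓞 k) : k) (by push_cast at hy ⊢; simpa using hy)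
  · right; exact_mod_cast sw hk (M0 * r) s 1 (by positivity) (by push_cast; ring) ((ε : 𝓞 k) : k) (by push_cast at hy ⊢; simpa using hy)
  · simp at md

end Ar
end

section
open NumberField Module
set_option linter.unusedSectionVars false
set_option linter.unusedVariables false

/-- sign attached to an element of `ZMod 2` -/
def sg (z : ZMod 2) : ℤ := if z = 0 then 1 else -1

lemma sg_add (a b : ZMod 2) : sg (a + b) = sg a * sg b := by revert a b; decide
lemma sg_sq (a : ZMod 2) : sg a * sg a = 1 := by revert a; decide
lemma sg_zero : sg 0 = 1 := rfl
lemma sg_one : sg 1 = -1 := rfl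

/-- multiquadratic field -/
structure KF {ι : Type*} [Fintype ι] (K : Type*) [Field K] [NumberField K] (D : ι → ℕ) (g : ι → K) : Prop where
  sq : ∀ i, g i ^ 2 = (D i : K)
  top : IntermediateField.adjoin ℚ (Set.range g) = ⊤
  ns : ∀ t : ι → ZMod 2, t ≠ 0 → ∀ x : ℚ, x ^ 2 ≠ ∏ i, (D i : ℚ) ^ (t i).val

namespace KF
variable {ι : Type*} [Fintype ι] [DecidableEq ι] {K : Type*} [Field K] [NumberField K] {D : ι → ℕ} {g : ι → K}

lemma D_ne (h : KF K D g) (i : ι) : D i ≠ 0 := by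
  intro h0
  refine h.ns (Pi.single i 1) (by simp) 0 ?_
  rw [Finset.prod_eq_zero (Finset.mem_univ i)]
  · norm_num
  · simp [h0]

lemma isInt (h : KF K D g) (i : ι) : IsIntegral ℚ (g i) := IsIntegral.of_finite ℚ (g i)

lemma g_ne (h : KF K D g) (i : ι) : g i ≠ 0 := by
  intro h0
  have := h.sq i
  rw [h0] at this
  have h2 := h.D_ne i
  apply h2
  have : (D i : K) = 0 := by rw [← this]; ring
  exact_mod_cast this

lemma normal (h : KF K D g) : Normal ℚ K := by
  refine ⟨fun x => ?_⟩
  have hx : x ∈ IntermediateField.adjoin ℚ (Set.range g) := by rw [h.top]; trivial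
  refine IntermediateField.splits_of_mem_adjoin ℚ K (S := Set.range g) ?_ hx
  rintro _ ⟨i, rfl⟩
  refine ⟨h.isInt i, ?_⟩
  have hd : minpoly ℚ (g i) ∣ Polynomial.X ^ 2 - Polynomial.C (D i : ℚ) := by
    apply minpoly.dvd
    simp [h.sq]
  have hd2 := Polynomial.map_dvd (algebraMap ℚ K) hd
  have he : (Polynomial.X ^ 2 - Polynomial.C (D i : ℚ)).map (algebraMap ℚ K) =
      (Polynomial.X - Polynomial.C (g i)) * (Polynomial.X + Polynomial.C (g i)) := by
    have : Polynomial.C (g i) ^ 2 = Polynomial.C (D i : K) := by rw [← map_pow, h.sq]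
    simp only [Polynomial.map_sub, Polynomial.map_pow, Polynomial.map_X, Polynomial.map_natCast, map_natCast] at this ⊢
    linear_combination this
  rw [he] at hd2
  refine Polynomial.Splits.of_dvd ?_ ?_ hd2
  · exact (Polynomial.Splits.X_sub_C _).mul (Polynomial.Splits.X_add_C _)
  · exact mul_ne_zero (Polynomial.X_sub_C_ne_zero _) (Polynomial.X_add_C_ne_zero _)

lemma gal (h : KF K D g) : IsGalois ℚ K := by
  have := h.normal
  constructor

lemma map_g (h : KF K D g) (σ : Gal(K/ℚ)) (i : ι) : σ (g i) = g i ∨ σ (g i) = - g i := by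
  apply sq_eq_sq_iff_eq_or_eq_neg.mp
  rw [← map_pow, h.sq, map_natCast]

/-- exponent vector of an automorphism -/
noncomputable def sb (g : ι → K) (σ : Gal(K/ℚ)) : ι → ZMod 2 := fun i => by
  classical exact if σ (g i) = g i then 0 else 1

lemma sb_spec (h : KF K D g) (σ : Gal(K/ℚ)) (i : ι) : σ (g i) = (sg (sb g σ i) : K) * g i := by
  unfold sb
  split_ifs with h1
  · simp [h1, sg]
  · rcases h.map_g σ i with h2 | h2
    · exact absurd h2 h1
    · simp [h2, sg]

lemma sb_unique (h : KF K D g) (σ : Gal(K/ℚ)) (i : ι) (z : ZMod 2) (hz : σ (g i) = (sg z : K) * g i) :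
    sb g σ i = z := by
  rw [h.sb_spec] at hz
  have := mul_right_cancel₀ (h.g_ne i) hz
  have : sg (sb g σ i) = sg z := by exact_mod_cast this
  have sginj : ∀ a b : ZMod 2, sg a = sg b → a = b := by decide
  exact sginj _ _ this

lemma sb_mul (h : KF K D g) (σ τ : Gal(K/ℚ)) : sb g (σ * τ) = sb g σ + sb g τ := by
  funext i
  apply h.sb_unique
  rw [AlgEquiv.mul_apply, h.sb_spec, map_mul, h.sb_spec, map_intCast, Pi.add_apply, sg_add]
  push_cast
  ring

lemma sb_one (h : KF K D g) : sb g (1 : Gal(K/ℚ)) = 0 := by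
  funext i
  apply h.sb_unique
  simp [sg]

lemma sb_inj (h : KF K D g) : Function.Injective (sb g : Gal(K/ℚ) → ι → ZMod 2) := by
  intro σ τ hst
  have hE : ∀ x ∈ IntermediateField.adjoin ℚ (Set.range g), σ x = τ x := by
    intro x hx
    induction hx using IntermediateField.adjoin_induction with
    | mem x hx =>
      obtain ⟨i, rfl⟩ := hx
      rw [h.sb_spec, h.sb_spec, hst]
    | algebraMap x => simp
    | add x y _ _ h1 h2 => simp [h1, h2]
    | inv x _ h1 => simp [h1]
    | mul x y _ _ h1 h2 => simp [h1, h2]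
  ext x
  exact hE x (by rw [h.top]; trivial)

lemma rat_of_fixed (h : KF K D g) {x : K} (hx : ∀ σ : Gal(K/ℚ), σ x = x) : ∃ u : ℚ, x = u := by
  have := h.gal
  have h2 := (IsGalois.mem_bot_iff_fixed x).mpr hx
  obtain ⟨u, hu⟩ := IntermediateField.mem_bot.mp h2
  exact ⟨u, by rw [← hu]; simp⟩

/-- monomials -/
def mono (g : ι → K) (t : ι → ZMod 2) : K := ∏ i, g i ^ (t i).val

lemma sgn_pow_val (a b : ZMod 2) : (sg a) ^ b.val = sg (a * b) := by revert a b; decide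

lemma sg_sum (f : ι → ZMod 2) : sg (∑ i, f i) = ∏ i, sg (f i) := by
  refine Finset.induction_on (Finset.univ : Finset ι) (by simp [sg]) ?_
  intro a s ha ih
  rw [Finset.sum_insert ha, Finset.prod_insert ha, sg_add, ih]

lemma map_mono (h : KF K D g) (σ : Gal(K/ℚ)) (t : ι → ZMod 2) :
    σ (mono g t) = (sg (∑ i, sb g σ i * t i) : K) * mono g t := by
  unfold mono
  rw [map_prod, sg_sum]
  push_cast
  rw [← Finset.prod_mul_distrib]
  refine Finset.prod_congr rfl fun i _ => ?_
  rw [map_pow, h.sb_spec, mul_pow, ← sgn_pow_val]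
  push_cast
  rfl

lemma mono_sq (h : KF K D g) (t : ι → ZMod 2) : mono g t ^ 2 = ((∏ i, (D i : ℚ) ^ (t i).val : ℚ) : K) := by
  unfold mono
  push_cast
  rw [← Finset.prod_pow]
  refine Finset.prod_congr rfl fun i _ => ?_
  rw [← pow_mul, mul_comm, pow_mul, h.sq]

lemma sb_surj (h : KF K D g) : Function.Surjective (sb g : Gal(K/ℚ) → ι → ZMod 2) := by
  have h2 : ∀ v : ι → ZMod 2, v + v = 0 := fun v => by funext i; exact CharTwo.add_self_eq_zero _
  let P : AddSubgroup (ι → ZMod 2) :=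
    { carrier := Set.range (sb g : Gal(K/ℚ) → ι → ZMod 2)
      add_mem' := by
        rintro _ _ ⟨σ, rfl⟩ ⟨τ, rfl⟩
        exact ⟨σ * τ, h.sb_mul σ τ⟩
      zero_mem' := ⟨1, h.sb_one⟩
      neg_mem' := by
        rintro _ ⟨σ, rfl⟩
        refine ⟨σ, ?_⟩
        rw [eq_neg_iff_add_eq_zero, h2] }
  let p := AddSubgroup.toZModSubmodule 2 P
  by_contra hns
  have hp : p < ⊤ := by
    rw [lt_top_iff_ne_top]
    intro hT
    apply hns
    intro v
    have : v ∈ p := by rw [hT]; trivial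
    exact this
  obtain ⟨f, hf, hpf⟩ := Submodule.exists_le_ker_of_lt_top p hp
  let t : ι → ZMod 2 := fun i => f (Pi.single i 1)
  have hft : ∀ v, f v = ∑ i, v i * t i := by
    intro v
    conv_lhs => rw [LinearMap.pi_apply_eq_sum_univ f v]
    simp only [smul_eq_mul, t]
    refine Finset.sum_congr rfl fun i _ => ?_
    congr 2
    funext j
    simp [Pi.single_apply, eq_comm]
  have ht : t ≠ 0 := by
    intro h0
    apply hf
    ext v
    simp [← hft, t] at *
    exact congrFun h0 v
  obtain ⟨u, hu⟩ := h.rat_of_fixed (x := mono g t) (by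
    intro σ
    rw [h.map_mono, ← hft]
    have : sb g σ ∈ LinearMap.ker f := hpf (show sb g σ ∈ P from ⟨σ, rfl⟩)
    rw [LinearMap.mem_ker.mp this]
    simp [sg])
  apply h.ns t ht u
  have := h.mono_sq t
  rw [hu] at this
  exact_mod_cast this

/-- automorphisms ↔ sign vectors -/
noncomputable def aut (h : KF K D g) : Gal(K/ℚ) ≃ (ι → ZMod 2) := Equiv.ofBijective _ ⟨h.sb_inj, h.sb_surj⟩

lemma finrank_eq (h : KF K D g) : finrank ℚ K = 2 ^ Fintype.card ι := by
  have := h.gal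
  rw [← IsGalois.card_aut_eq_finrank, Nat.card_congr h.aut]
  simp

lemma exists_aut (h : KF K D g) (t : ι → ZMod 2) : ∃ σ : Gal(K/ℚ), ∀ i, σ (g i) = (sg (t i) : K) * g i := by
  obtain ⟨σ, hσ⟩ := h.sb_surj t
  exact ⟨σ, fun i => by rw [h.sb_spec, hσ]⟩

lemma sq_one (h : KF K D g) (σ : Gal(K/ℚ)) : σ * σ = 1 := by
  apply h.sb_inj
  rw [h.sb_mul, h.sb_one]
  funext i
  exact CharTwo.add_self_eq_zero _

/-- a rational number which is a square in `K` -/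
lemma rat_sq (h : KF K D g) (n : ℚ) (e : K) (he : e ^ 2 = n) :
    ∃ (t : ι → ZMod 2) (y : ℚ), n * ∏ i, (D i : ℚ) ^ (t i).val = y ^ 2 ∧ e * mono g t = y := by
  classical
  by_cases hn : n = 0
  · refine ⟨0, 0, by simp [hn], ?_⟩
    have : e = 0 := by simpa [hn] using he
    simp [this]
  have he0 : e ≠ 0 := by rintro rfl; apply hn; simp at he; exact_mod_cast he.symm
  have hs : ∀ σ : Gal(K/ℚ), σ e = e ∨ σ e = - e := fun σ => by
    apply sq_eq_sq_iff_eq_or_eq_neg.mp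
    rw [← map_pow, he]
    exact map_ratCast σ n
  let z : Gal(K/ℚ) → ZMod 2 := fun σ => if σ e = e then 0 else 1
  have hz : ∀ σ, σ e = (sg (z σ) : K) * e := by
    intro σ
    simp only [z]
    split_ifs with h1
    · simp [h1, sg]
    · rcases hs σ with h2 | h2
      · exact absurd h2 h1
      · simp [h2, sg]
  have sginj : ∀ a b : ZMod 2, sg a = sg b → a = b := by decide
  have hzm : ∀ σ τ, z (σ * τ) = z σ + z τ := by
    intro σ τ
    apply sginj
    have h1 := hz (σ * τ)
    rw [AlgEquiv.mul_apply, hz τ, map_mul, hz σ, map_intCast, ← mul_assoc] at h1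
    have := mul_right_cancel₀ he0 h1
    rw [sg_add, mul_comm]
    exact_mod_cast this.symm
  let f : (ι → ZMod 2) →+ ZMod 2 :=
    { toFun := fun v => z (h.aut.symm v)
      map_zero' := by
        have : h.aut.symm 0 = 1 := by rw [Equiv.symm_apply_eq]; exact h.sb_one.symm
        rw [this]
        simp [z]
      map_add' := by
        intro v w
        rw [← hzm]
        congr 1
        rw [Equiv.symm_apply_eq]
        change v + w = sb g _
        rw [h.sb_mul]
        change _ = h.aut _ + h.aut _
        simp }
  let t : ι → ZMod 2 := fun i => f (Pi.single i 1)
  have hft : ∀ v, f v = ∑ i, v i * t i := by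
    intro v
    have := LinearMap.pi_apply_eq_sum_univ (f.toZModLinearMap 2) v
    simp only [AddMonoidHom.coe_toZModLinearMap, smul_eq_mul] at this
    rw [this]
    refine Finset.sum_congr rfl fun i _ => ?_
    congr 2
    funext j
    simp [Pi.single_apply, eq_comm]
  obtain ⟨u, hu⟩ := h.rat_of_fixed (x := e * mono g t) (by
    intro σ
    have h3 : z σ = ∑ i, sb g σ i * t i := by
      rw [← hft]
      change _ = z (h.aut.symm (h.aut σ))
      simp
    rw [map_mul, h.map_mono, ← h3, hz]
    have : (sg (z σ) : K) * sg (z σ) = 1 := by exact_mod_cast sg_sq (z σ)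
    linear_combination (e * mono g t) * this)
  refine ⟨t, u, ?_, hu⟩
  have h1 : (e * mono g t) ^ 2 = (u : K) ^ 2 := by rw [hu]
  rw [mul_pow, he, h.mono_sq] at h1
  exact_mod_cast h1

end KF
end

section
open NumberField Module
set_option linter.unusedSectionVars false
set_option linter.unusedVariables false

namespace Ar
variable {q r s Q Q' : ℕ} [hqf : Fact q.Prime] [hrf : Fact r.Prime] [hsf : Fact s.Prime]

lemma sf2qrs (h : Ar q r s Q Q') : Squarefree (2 * q * r * s) := by
  have h1 := h.q4
  have h2 := h.r8
  have h3 := h.s8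
  have c1 : Nat.Coprime 2 q := (Nat.coprime_primes Nat.prime_two hqf.out).mpr (by omega)
  have c2 : Nat.Coprime 2 r := (Nat.coprime_primes Nat.prime_two hrf.out).mpr (by omega)
  have c3 : Nat.Coprime 2 s := (Nat.coprime_primes Nat.prime_two hsf.out).mpr (by omega)
  have c4 : Nat.Coprime q r := (Nat.coprime_primes hqf.out hrf.out).mpr h.qr
  have c5 : Nat.Coprime q s := (Nat.coprime_primes hqf.out hsf.out).mpr h.qs
  have c6 : Nat.Coprime r s := (Nat.coprime_primes hrf.out hsf.out).mpr h.rs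
  rw [Nat.squarefree_mul (Nat.Coprime.mul_left (Nat.Coprime.mul_left c3 c5) c6), Nat.squarefree_mul (Nat.Coprime.mul_left c2 c4),
    Nat.squarefree_mul c1]
  exact ⟨⟨⟨Nat.prime_two.prime.squarefree, hqf.out.prime.squarefree⟩, hrf.out.prime.squarefree⟩, hsf.out.prime.squarefree⟩

/-- the seven discriminant radicands -/
def dN (r s Q Q' : ℕ) : Fin 7 → ℕ := ![2, Q, Q', 1 * r * s, 2 * r * s, Q * r * s, Q' * r * s]

lemma dN_dvd (h : Ar q r s Q Q') (i : Fin 7) : dN r s Q Q' i ∣ 2 * q * r * s := by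
  rcases h.hQ with ⟨rfl, rfl⟩ | ⟨rfl, rfl⟩ <;> fin_cases i <;> simp [dN]
  · exact ⟨Q * r * s, by ring⟩
  · exact ⟨2 * r * s, by ring⟩
  · exact ⟨r * s, by ring⟩
  · exact ⟨2 * Q, by ring⟩
  · exact ⟨Q, by ring⟩
  · exact ⟨2, by ring⟩
  · exact ⟨Q' * r * s, by ring⟩
  · exact ⟨r * s, by ring⟩
  · exact ⟨2 * r * s, by ring⟩
  · exact ⟨2 * Q', by ring⟩
  · exact ⟨Q', by ring⟩
  · exact ⟨2, by ring⟩

lemma dN_gt (h : Ar q r s Q Q') (i : Fin 7) : 1 < dN r s Q Q' i := by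
  have h1 := hqf.out.two_le
  have h2 := hrf.out.two_le
  have h3 := hsf.out.two_le
  have h4 : 2 ≤ r * s := by nlinarith
  rcases h.hQ with ⟨rfl, rfl⟩ | ⟨rfl, rfl⟩ <;> fin_cases i <;> simp [dN, mul_assoc] <;> nlinarith

lemma dN_sf (h : Ar q r s Q Q') (i : Fin 7) : Squarefree (dN r s Q Q' i : ℤ) :=
  Int.squarefree_natCast.mpr (h.sf2qrs.squarefree_of_dvd (h.dN_dvd i))

lemma dN_ns (h : Ar q r s Q Q') (i : Fin 7) (x : ℚ) : x ^ 2 ≠ dN r s Q Q' i := by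
  have := QF.nonsq (h.dN_sf i) (by exact_mod_cast h.dN_gt i) x
  simpa using this

lemma exists_kappa (h : Ar q r s Q Q') : ∃ κ : ℕ, κ ≠ 0 ∧ κ ^ 2 * Q' = 2 * Q := by
  rcases h.hQ with ⟨rfl, rfl⟩ | ⟨rfl, rfl⟩
  · exact ⟨1, by norm_num, by ring⟩
  · exact ⟨2, by norm_num, by ring⟩

lemma ns (h : Ar q r s Q Q') (t : Fin 3 → ZMod 2) (ht : t ≠ 0) (x : ℚ) :
    x ^ 2 ≠ ∏ i, ((![2, Q, r * s] : Fin 3 → ℕ) i : ℚ) ^ (t i).val := by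
  have hz : ∀ z : ZMod 2, z = 0 ∨ z = 1 := by decide
  obtain ⟨κ, hκ, hk⟩ := h.exists_kappa
  have hκ' : (κ : ℚ) ≠ 0 := by exact_mod_cast hκ
  have hk' : (κ : ℚ) ^ 2 * Q' = 2 * Q := by exact_mod_cast hk
  have hv1 : ZMod.val (1 : ZMod 2) = 1 := by decide
  have hv0 : ZMod.val (0 : ZMod 2) = 0 := by decide
  rw [Fin.prod_univ_three]
  intro hx
  rcases hz (t 0) with h0 | h0 <;> rcases hz (t 1) with h1 | h1 <;> rcases hz (t 2) with h2 | h2 <;>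
    simp [h0, h1, h2, hv0, hv1] at hx
  · exact ht (by funext i; fin_cases i <;> simp [h0, h1, h2])
  · exact h.dN_ns 3 x (by simp [dN, hx])
  · exact h.dN_ns 1 x (by simp [dN, hx])
  · exact h.dN_ns 5 x (by simp [dN, hx]; ring)
  · exact h.dN_ns 0 x (by simp [dN, hx])
  · exact h.dN_ns 4 x (by simp [dN, hx]; ring)
  · exact h.dN_ns 2 (x / κ) (by simp [dN]; field_simp; linear_combination hx - hk')
  · exact h.dN_ns 6 (x / κ) (by simp [dN]; field_simp; linear_combination hx - r * s * hk')

end Ar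

/-- The main setting: `K = ℚ(a,b,c)` with `a²=2, b²=Q, c²=rs`, `b'²=Q'`. -/
structure KA (q r s Q Q' : ℕ) [Fact q.Prime] [Fact r.Prime] [Fact s.Prime] {K : Type*} [Field K] [NumberField K] (a b b' c : K) (φ : K →+* ℝ) :
    Prop where
  ar : Ar q r s Q Q'
  kf : KF K (![2, Q, r * s] : Fin 3 → ℕ) ![a, b, c]
  b2 : b' ^ 2 = (Q' : K)
  bb : ∃ κ : ℕ, κ ≠ 0 ∧ κ * b' = a * b
  pa : 0 < φ a
  pb : 0 < φ b
  pb' : 0 < φ b'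
  pc : 0 < φ c

/-- the characters -/
def chi : Fin 7 → Fin 3 → ZMod 2 := ![![1, 0, 0], ![0, 1, 0], ![1, 1, 0], ![0, 0, 1], ![1, 0, 1], ![0, 1, 1], ![1, 1, 1]]

/-- sign of the `i`-th character at a vector -/
def ch (i : Fin 7) (t : Fin 3 → ZMod 2) : ZMod 2 := t 0 * chi i 0 + t 1 * chi i 1 + t 2 * chi i 2

/-- the seven square roots -/
def XX {K : Type*} [Field K] (a b b' c : K) : Fin 7 → K := ![a, b, b', c, a * c, b * c, b' * c]

namespace KA
variable {q r s Q Q' : ℕ} [hqf : Fact q.Prime] [hrf : Fact r.Prime] [hsf : Fact s.Prime]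
variable {K : Type*} [Field K] [NumberField K] {a b b' c : K} {φ : K →+* ℝ}

lemma sqa (h : KA q r s Q Q' a b b' c φ) : a ^ 2 = 2 := by simpa using h.kf.sq 0
lemma sqb (h : KA q r s Q Q' a b b' c φ) : b ^ 2 = Q := by simpa using h.kf.sq 1
lemma sqc (h : KA q r s Q Q' a b b' c φ) : c ^ 2 = r * s := by simpa using h.kf.sq 2

lemma sqX (h : KA q r s Q Q' a b b' c φ) (i : Fin 7) : (XX a b b' c i) ^ 2 = (Ar.dN r s Q Q' i : K) := by
  have h1 := h.sqa
  have h2 := h.sqb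
  have h3 := h.sqc
  have h4 := h.b2
  fin_cases i <;> simp [XX, Ar.dN, mul_pow, *] <;> ring

/-- sign vector -/
noncomputable abbrev sv (a b c : K) (σ : Gal(K/ℚ)) : Fin 3 → ZMod 2 := KF.sb ![a, b, c] σ

lemma map_a (h : KA q r s Q Q' a b b' c φ) (σ : Gal(K/ℚ)) : σ a = (sg (sv a b c σ 0) : K) * a := by simpa using h.kf.sb_spec σ 0
lemma map_b (h : KA q r s Q Q' a b b' c φ) (σ : Gal(K/ℚ)) : σ b = (sg (sv a b c σ 1) : K) * b := by simpa using h.kf.sb_spec σ 1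
lemma map_c (h : KA q r s Q Q' a b b' c φ) (σ : Gal(K/ℚ)) : σ c = (sg (sv a b c σ 2) : K) * c := by simpa using h.kf.sb_spec σ 2
lemma map_b' (h : KA q r s Q Q' a b b' c φ) (σ : Gal(K/ℚ)) : σ b' = (sg (sv a b c σ 0 + sv a b c σ 1) : K) * b' := by
  obtain ⟨κ, hκ, hk⟩ := h.bb
  have hκ' : (κ : K) ≠ 0 := by exact_mod_cast hκ
  apply mul_left_cancel₀ hκ'
  have := congrArg σ hk
  rw [map_mul, map_natCast, map_mul, h.map_a, h.map_b] at this
  rw [this, sg_add]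
  push_cast
  linear_combination -(sg (sv a b c σ 0) : K) * sg (sv a b c σ 1) * hk

lemma map_X (h : KA q r s Q Q' a b b' c φ) (σ : Gal(K/ℚ)) (i : Fin 7) :
    σ (XX a b b' c i) = (sg (ch i (sv a b c σ)) : K) * XX a b b' c i := by
  have h1 := h.map_a σ
  have h2 := h.map_b σ
  have h3 := h.map_c σ
  have h4 := h.map_b' σ
  fin_cases i <;> simp [XX, ch, chi, h1, h2, h3, h4, sg_add] <;> ring

lemma exists_aut (h : KA q r s Q Q' a b b' c φ) (t : Fin 3 → ZMod 2) : ∃ σ : Gal(K/ℚ), sv a b c σ = t := h.kf.sb_surj t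

lemma X_ne (h : KA q r s Q Q' a b b' c φ) (i : Fin 7) : XX a b b' c i ≠ 0 := by
  intro h0
  have := h.sqX i
  rw [h0] at this
  have h2 := h.ar.dN_gt i
  have : Ar.dN r s Q Q' i = 0 := by
    have h3 : (Ar.dN r s Q Q' i : K) = 0 := by rw [← this]; ring
    exact_mod_cast h3
  omega

/-- The quadratic subfields. -/
noncomputable abbrev kk (a b b' c : K) (i : Fin 7) : IntermediateField ℚ K := IntermediateField.adjoin ℚ {XX a b b' c i}

lemma rk_kk (h : KA q r s Q Q' a b b' c φ) (i : Fin 7) : finrank ℚ (kk a b b' c i) = 2 := by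
  rw [IntermediateField.adjoin.finrank (IsIntegral.of_finite ℚ _)]
  have hd : minpoly ℚ (XX a b b' c i) ∣ Polynomial.X ^ 2 - Polynomial.C (Ar.dN r s Q Q' i : ℚ) := by
    apply minpoly.dvd
    simp [h.sqX]
  have hne : (Polynomial.X ^ 2 - Polynomial.C (Ar.dN r s Q Q' i : ℚ)) ≠ 0 := Polynomial.X_pow_sub_C_ne_zero (by norm_num) _
  have hle := Polynomial.natDegree_le_of_dvd hd hne
  rw [Polynomial.natDegree_X_pow_sub_C] at hle
  refine le_antisymm hle ?_
  rw [minpoly.two_le_natDegree_iff (IsIntegral.of_finite ℚ _)]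
  rintro ⟨u, hu⟩
  apply h.ar.dN_ns i u
  have := h.sqX i
  rw [← hu, ← map_pow] at this
  simpa using (algebraMap ℚ K).injective (by rw [this]; simp : (algebraMap ℚ K) (u ^ 2) = algebraMap ℚ K (Ar.dN r s Q Q' i : ℚ))

lemma qf (h : KA q r s Q Q' a b b' c φ) (i : Fin 7) :
    QF (kk a b b' c i) (Ar.dN r s Q Q' i : ℤ) (IntermediateField.AdjoinSimple.gen ℚ (XX a b b' c i)) where
  sq := by
    apply Subtype.ext
    simpa using h.sqX i
  rk := h.rk_kk i
  sf := h.ar.dN_sf i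
  gt := by exact_mod_cast h.ar.dN_gt i

lemma mem_fix (h : KA q r s Q Q' a b b' c φ) (i : Fin 7) (σ : Gal(K/ℚ)) :
    σ ∈ (kk a b b' c i).fixingSubgroup ↔ ch i (sv a b c σ) = 0 := by
  rw [IntermediateField.mem_fixingSubgroup_iff]
  constructor
  · intro h1
    have h2 := h1 _ (IntermediateField.mem_adjoin_simple_self ℚ (XX a b b' c i))
    rw [h.map_X] at h2
    have h3 : (sg (ch i (sv a b c σ)) : K) = 1 := mul_right_cancel₀ (h.X_ne i) (by rw [h2, one_mul])
    have h4 : sg (ch i (sv a b c σ)) = 1 := by exact_mod_cast h3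
    have : ∀ z : ZMod 2, sg z = 1 → z = 0 := by decide
    exact this _ h4
  · intro h1 x hx
    induction hx using IntermediateField.adjoin_induction with
    | mem x hx =>
      rw [Set.mem_singleton_iff.mp hx, h.map_X, h1]; simp [sg]
    | algebraMap x => simp
    | add x y _ _ h1 h2 => simp [h1, h2]
    | inv x _ h1 => simp [h1]
    | mul x y _ _ h1 h2 => simp [h1, h2]

lemma card_ch : ∀ t : Fin 3 → ZMod 2, t ≠ 0 → (Finset.univ.filter fun i => ch i t = 0).card = 3 := by decide

lemma gal_kk (h : KA q r s Q Q' a b b' c φ) (i : Fin 7) : IsGalois ℚ (kk a b b' c i) := by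
  have h2 : Algebra.IsQuadraticExtension ℚ (kk a b b' c i) := { finrank_eq_two' := h.rk_kk i }
  have : Normal ℚ (kk a b b' c i) := inferInstance
  constructor

lemma finrank8 (h : KA q r s Q Q' a b b' c φ) : finrank ℚ K = 8 := by
  rw [h.kf.finrank_eq]; simp

theorem residue (h : KA q r s Q Q' a b b' c φ) :
    dedekindZeta_residue K * dedekindZeta_residue ℚ ^ 6 = ∏ i, dedekindZeta_residue (kk a b b' c i) := by
  have := h.kf.gal
  have := h.gal_kk
  refine residue_identity K h.finrank8 h.kf.sq_one (kk a b b' c) h.rk_kk ?_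
  intro σ hσ
  have ht : sv a b c σ ≠ 0 := by
    intro h0
    apply hσ
    apply h.kf.sb_inj
    rw [h.kf.sb_one]
    exact h0
  rw [← card_ch _ ht, ← Fintype.card_subtype, ← Nat.card_eq_fintype_card]
  exact Nat.card_congr (Equiv.subtypeEquivRight fun i => h.mem_fix i σ)

end KA
end

section
open NumberField Module NumberField.Units NumberField.InfinitePlace
set_option linter.unusedSectionVars false
set_option linter.unusedVariables false

lemma residue_totReal (K : Type*) [Field K] [NumberField K] [IsTotallyReal K] (φ : K →+* ℝ) :
    dedekindZeta_residue K = 2 ^ finrank ℚ K * (regulator K * classNumber K) / (2 * Real.sqrt ((discr K).natAbs : ℝ)) := by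
  rw [dedekindZeta_residue_def, IsTotallyReal.nrComplexPlaces_eq_zero, ← IsTotallyReal.finrank, torsionOrder_real φ,
    Nat.cast_natAbs]
  push_cast
  ring

lemma det_empty_aux {n : Type*} {f : Fintype n} {d : DecidableEq n} (M : Matrix n n ℝ) (h : IsEmpty n) : M.det = 1 :=
  Matrix.det_eq_one_of_card_eq_zero (Fintype.card_eq_zero_iff.mpr h)

lemma regulator_rank0 (K : Type*) [Field K] [NumberField K] (hr : rank K = 0) : regulator K = 1 := by
  have : IsEmpty (Fin (rank K)) := by rw [hr]; infer_instance
  have := (equivFinRank K).symm.isEmpty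
  rw [regulator_eq_det']
  refine (congrArg abs ?_).trans abs_one
  exact det_empty_aux _ this

lemma residue_rat : dedekindZeta_residue ℚ = 1 := by
  have : IsTotallyReal ℚ := inferInstance
  rw [residue_totReal ℚ (algebraMap ℚ ℝ), Rat.classNumber_eq, Rat.numberField_discr]
  have hr : rank ℚ = 0 := by
    rw [rank, card_eq_nrRealPlaces_add_nrComplexPlaces, IsTotallyReal.nrComplexPlaces_eq_zero, ← IsTotallyReal.finrank]
    simp
  have hreg : regulator ℚ = 1 := by
    exact regulator_rank0 ℚ hr
  rw [hreg]
  simp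

namespace KA
variable {q r s Q Q' : ℕ} [hqf : Fact q.Prime] [hrf : Fact r.Prime] [hsf : Fact s.Prime]
variable {K : Type*} [Field K] [NumberField K] {a b b' c : K} {φ : K →+* ℝ}

lemma totReal (h : KA q r s Q Q' a b b' c φ) : IsTotallyReal K := by
  constructor
  intro v
  rw [isReal_iff, ComplexEmbedding.isReal_iff]
  have hx : ∀ i, (starRingEnd ℂ) (v.embedding ((![a, b, c] : Fin 3 → K) i)) = v.embedding ((![a, b, c] : Fin 3 → K) i) := by
    intro i
    have h1 : (v.embedding ((![a, b, c] : Fin 3 → K) i)) ^ 2 = (((![2, Q, r * s] : Fin 3 → ℕ) i : ℝ) : ℂ) := by rw [← map_pow, h.kf.sq]; simp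
    have h2 : (v.embedding ((![a, b, c] : Fin 3 → K) i)) ^ 2 = ((Real.sqrt ((![2, Q, r * s] : Fin 3 → ℕ) i) : ℝ) : ℂ) ^ 2 := by
      rw [h1, ← Complex.ofReal_pow, Real.sq_sqrt (by positivity)]
    rcases sq_eq_sq_iff_eq_or_eq_neg.mp h2 with h3 | h3 <;> rw [h3] <;> simp
  ext z
  have hz : z ∈ IntermediateField.adjoin ℚ (Set.range (![a, b, c] : Fin 3 → K)) := by rw [h.kf.top]; trivial
  rw [ComplexEmbedding.conjugate_coe_eq]
  induction hz using IntermediateField.adjoin_induction with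
  | mem x hx' => obtain ⟨i, rfl⟩ := hx'; exact hx i
  | algebraMap x => simp
  | add x y _ _ h1 h2 => simp only [map_add, h1, h2]
  | inv x _ h1 => simp only [map_inv₀, h1]
  | mul x y _ _ h1 h2 => simp only [map_mul, h1, h2]

/-- the real place attached to an automorphism -/
noncomputable def pl (φ : K →+* ℝ) (σ : Gal(K/ℚ)) : InfinitePlace K := realPlace (φ.comp (σ : K →+* K))

lemma pl_apply (σ : Gal(K/ℚ)) (x : K) : pl φ σ x = |φ (σ x)| := realPlace_apply _ _

lemma pl_inj : Function.Injective (pl φ : Gal(K/ℚ) → InfinitePlace K) := by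
  intro σ τ hst
  have hh : ∀ x, φ (σ x) = φ (τ x) := by
    intro x
    rw [pl, pl, realPlace, realPlace, mk_eq_iff] at hst
    rcases hst with h1 | h1
    · have := RingHom.congr_fun h1 x
      simpa using this
    · have := RingHom.congr_fun h1 x
      simpa [ComplexEmbedding.conjugate_coe_eq] using this
  ext x
  exact φ.injective (hh x)

lemma card_pl (h : KA q r s Q Q' a b b' c φ) : Fintype.card (InfinitePlace K) = 8 := by
  have := h.totReal
  rw [card_eq_nrRealPlaces_add_nrComplexPlaces, IsTotallyReal.nrComplexPlaces_eq_zero, ← IsTotallyReal.finrank, h.finrank8]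

lemma pl_bij (h : KA q r s Q Q' a b b' c φ) : Function.Bijective (pl φ : Gal(K/ℚ) → InfinitePlace K) := by
  have := h.kf.gal
  refine (Nat.bijective_iff_injective_and_card _).mpr ⟨pl_inj, ?_⟩
  rw [IsGalois.card_aut_eq_finrank, h.finrank8, Nat.card_eq_fintype_card, h.card_pl]

lemma rank7 (h : KA q r s Q Q' a b b' c φ) : rank K = 7 := by
  rw [rank, h.card_pl]

/-- the class number formula -/
lemma cnf (h : KA q r s Q Q' a b b' c φ) (hD : (discr K).natAbs = ∏ i, (discr (kk a b b' c i)).natAbs) :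
    regulator K * classNumber K = ∏ i, (regulator (kk a b b' c i) * classNumber (kk a b b' c i)) := by
  have hr := h.residue
  have := h.totReal
  have htr : ∀ i, IsTotallyReal (kk a b b' c i) := fun i => (h.qf i).totallyReal
  have hi : ∀ i, dedekindZeta_residue (kk a b b' c i) = 2 *
      ((regulator (kk a b b' c i) * classNumber (kk a b b' c i)) / Real.sqrt ((discr (kk a b b' c i)).natAbs : ℝ)) := by
    intro i
    rw [residue_totReal (kk a b b' c i) (φ.comp (algebraMap _ K)), h.rk_kk]
    ring
  rw [residue_rat, residue_totReal K φ, h.finrank8, hD] at hr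
  simp_rw [hi] at hr
  rw [Finset.prod_mul_distrib, Finset.prod_div_distrib] at hr
  push_cast at hr
  rw [Real.sqrt_prod _ (fun _ _ => by positivity)] at hr
  have hne : ∏ i, Real.sqrt ((discr (kk a b b' c i)).natAbs : ℝ) ≠ 0 := by
    rw [Finset.prod_ne_zero_iff]
    intro i _
    rw [Real.sqrt_ne_zero']
    have := discr_ne_zero (kk a b b' c i)
    have : 0 < (discr (kk a b b' c i)).natAbs := Int.natAbs_pos.mpr this
    exact_mod_cast this
  simp only [Finset.prod_const, Finset.card_univ, Fintype.card_fin, one_pow, mul_one] at hr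
  field_simp at hr
  linarith
end KA
end

section
open NumberField Module
set_option linter.unusedSectionVars false
set_option linter.unusedVariables false

lemma isInt_congr {F : Type*} [Field F] {x y : F} (h : IsIntegral ℤ x) (e : y = x) : IsIntegral ℤ y := by rw [e]; exact h

lemma int_of_isIntegral {F : Type*} [Field F] [NumberField F] (u : ℚ) (h : IsIntegral ℤ (u : F)) : ∃ n : ℤ, u = n := by
  have h1 : IsIntegral ℤ u := by
    have h2 : (u : F) = algebraMap ℚ F u := by simp
    rw [h2] at h
    exact (isIntegral_algebraMap_iff (algebraMap ℚ F).injective).mp h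
  obtain ⟨n, hn⟩ := IsIntegrallyClosed.isIntegral_iff.mp h1
  exact ⟨n, by rw [← hn]; simp⟩

lemma elem_int (d : ℤ) (sf : Squarefree d) (hd : d % 4 = 2 ∨ d % 4 = 3) (u v : ℚ) (n m : ℤ) (h1 : 2 * u = n)
    (h2 : u ^ 2 - d * v ^ 2 = m) : (∃ a : ℤ, u = a) ∧ ∃ b : ℤ, v = b := by
  have h3 : (d : ℚ) * (2 * v) ^ 2 = ((n ^ 2 - 4 * m : ℤ) : ℚ) := by
    push_cast
    rw [← h1, ← h2]; ring
  obtain ⟨l, hl⟩ : ∃ l : ℤ, 2 * v = l := by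
    set w := 2 * v
    refine ⟨w.num, ?_⟩
    have hden : w.den = 1 := by
      have hx : d * w.num ^ 2 = (n ^ 2 - 4 * m) * (w.den : ℤ) ^ 2 := by
        have : (w.den : ℚ) ≠ 0 := by exact_mod_cast w.den_ne_zero
        have e := w.num_div_den
        have : (d : ℚ) * w.num ^ 2 = ((n ^ 2 - 4 * m : ℤ) : ℚ) * (w.den : ℚ) ^ 2 := by
          rw [← h3]
          nth_rewrite 2 [← e]
          field_simp
        exact_mod_cast this
      have hc : IsCoprime ((w.den : ℤ) ^ 2) (w.num ^ 2) := by
        apply IsCoprime.pow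
        exact (Int.isCoprime_iff_nat_coprime.mpr (by simpa using w.reduced)).symm
      have hdv : (w.den : ℤ) * w.den ∣ d := by
        rw [← pow_two]
        exact hc.dvd_of_dvd_mul_right ⟨n ^ 2 - 4 * m, by rw [hx]; ring⟩
      have := sf _ hdv
      simpa [Int.isUnit_iff_natAbs_eq] using this
    nth_rewrite 1 [← Rat.num_div_den w]
    rw [hden]; simp
  have h4 : n ^ 2 - d * l ^ 2 = 4 * m := by
    have : ((n ^ 2 - d * l ^ 2 : ℤ) : ℚ) = (4 * m : ℤ) := by
      rw [hl] at h3; push_cast at h3 ⊢; linarith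
    exact_mod_cast this
  have hAB : n % 2 = 0 ∧ l % 2 = 0 := by
    have h4 : (n ^ 2 - d * l ^ 2) % 4 = 0 := by rw [h4]; omega
    have : ∀ a b c : ℤ, (a = 0 ∨ a = 1 ∨ a = 2 ∨ a = 3) → (b = 0 ∨ b = 1 ∨ b = 2 ∨ b = 3) → (c = 2 ∨ c = 3) → (a ^ 2 - c * b ^ 2) % 4 = 0 → a % 2 = 0 ∧ b % 2 = 0 := by
      rintro a b c (rfl | rfl | rfl | rfl) (rfl | rfl | rfl | rfl) (rfl | rfl) <;> norm_num
    have := this (n % 4) (l % 4) (d % 4) (by omega) (by omega) hd (by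
      rw [← h4]; simp [Int.sub_emod, Int.mul_emod, pow_two])
    omega
  constructor
  · refine ⟨n / 2, ?_⟩
    have : 2 * (n / 2) = n := by omega
    have : (2 : ℚ) * ((n / 2 : ℤ) : ℚ) = n := by exact_mod_cast this
    linarith
  · refine ⟨l / 2, ?_⟩
    have : 2 * (l / 2) = l := by omega
    have : (2 : ℚ) * ((l / 2 : ℤ) : ℚ) = l := by exact_mod_cast this
    linarith

section biquad
variable {F : Type*} [Field F] [NumberField F] {q : ℕ} {a b : F}

/-- integrality of the coordinates when `y` and its conjugate are integral -/
lemma conj_int (σ : Gal(F/ℚ)) (d : ℤ) (sf : Squarefree d) (hd : d % 4 = 2 ∨ d % 4 = 3) (u v : ℚ) (x : F) (hx : x ^ 2 = d)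
    (hσ : σ x = - x) (hy : IsIntegral ℤ ((u : F) + v * x)) : (∃ a : ℤ, u = a) ∧ ∃ b : ℤ, v = b := by
  have hs : σ ((u : F) + v * x) = u - v * x := by
    rw [map_add, map_mul, hσ]
    simp only [map_ratCast]; ring
  have hy2 : IsIntegral ℤ ((u : F) - v * x) := by
    rw [← hs]
    exact map_isIntegral_int σ hy
  obtain ⟨n, hn⟩ := int_of_isIntegral (F := F) (2 * u) (by
    have := hy.add hy2
    refine isInt_congr (this) ?_; push_cast; ring)
  obtain ⟨m, hm⟩ := int_of_isIntegral (F := F) (u ^ 2 - d * v ^ 2) (by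
    have := hy.mul hy2
    refine isInt_congr (this) ?_; push_cast; rw [← hx]; ring)
  exact elem_int d sf hd u v n m hn hm

structure BF (F : Type*) [Field F] [NumberField F] (q : ℕ) (a b : F) : Prop where
  kf : KF F (![2, q] : Fin 2 → ℕ) ![a, b]
  q4 : q % 4 = 3
  sf : Squarefree (2 * q)

namespace BF
lemma a2 (h : BF F q a b) : a ^ 2 = 2 := by simpa using h.kf.sq 0
lemma b2 (h : BF F q a b) : b ^ 2 = q := by simpa using h.kf.sq 1

lemma auts (h : BF F q a b) : ∃ σ τ : Gal(F/ℚ), σ a = - a ∧ σ b = b ∧ τ a = a ∧ τ b = - b := by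
  obtain ⟨σ, hσ⟩ := h.kf.exists_aut ![1, 0]
  obtain ⟨τ, hτ⟩ := h.kf.exists_aut ![0, 1]
  have h1 := hσ 0
  have h2 := hσ 1
  have h3 := hτ 0
  have h4 := hτ 1
  simp [sg] at h1 h2 h3 h4
  exact ⟨σ, τ, h1, h2, h3, h4⟩

lemma a_ne (h : BF F q a b) : a ≠ 0 := by simpa using h.kf.g_ne 0
lemma b_ne (h : BF F q a b) : b ≠ 0 := by simpa using h.kf.g_ne 1

lemma fixed_rat (h : BF F q a b) {σ τ : Gal(F/ℚ)} (h1 : σ a = - a) (h2 : σ b = b) (h3 : τ a = a) (h4 : τ b = - b) {x : F}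
    (hs : σ x = x) (ht : τ x = x) : ∃ u : ℚ, x = u := by
  apply h.kf.rat_of_fixed
  intro ρ
  have hσ : KF.sb ![a, b] σ = ![1, 0] := by
    funext i
    apply h.kf.sb_unique
    fin_cases i <;> simp [sg, h1, h2]
  have hτ : KF.sb ![a, b] τ = ![0, 1] := by
    funext i
    apply h.kf.sb_unique
    fin_cases i <;> simp [sg, h3, h4]
  have hρ : ρ = 1 ∨ ρ = σ ∨ ρ = τ ∨ ρ = σ * τ := by
    have : ∀ t : Fin 2 → ZMod 2, t = 0 ∨ t = ![1, 0] ∨ t = ![0, 1] ∨ t = ![1, 0] + ![0, 1] := by decide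
    rcases this (KF.sb ![a, b] ρ) with h5 | h5 | h5 | h5
    · left; apply h.kf.sb_inj; rw [h5, h.kf.sb_one]
    · right; left; apply h.kf.sb_inj; rw [h5, hσ]
    · right; right; left; apply h.kf.sb_inj; rw [h5, hτ]
    · right; right; right; apply h.kf.sb_inj; rw [h5, h.kf.sb_mul, hσ, hτ]
  rcases hρ with rfl | rfl | rfl | rfl
  · rfl
  · exact hs
  · exact ht
  · rw [AlgEquiv.mul_apply, ht, hs]

lemma coords (h : BF F q a b) (z : F) : ∃ x0 x1 x2 x3 : ℚ, z = x0 + x1 * a + x2 * b + x3 * (a * b) := by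
  obtain ⟨σ, τ, h1, h2, h3, h4⟩ := h.auts
  have hss : σ (σ z) = z := by have := AlgEquiv.congr_fun (h.kf.sq_one σ) z; simpa using this
  have htt : ∀ z, τ (τ z) = z := fun z => by have := AlgEquiv.congr_fun (h.kf.sq_one τ) z; simpa using this
  have hst : ∀ y, τ (σ y) = σ (τ y) := by
    intro y
    have : τ * σ = σ * τ := by apply h.kf.sb_inj; rw [h.kf.sb_mul, h.kf.sb_mul, add_comm]
    exact AlgEquiv.congr_fun this y
  have hss' : ∀ z, σ (σ z) = z := fun z => by have := AlgEquiv.congr_fun (h.kf.sq_one σ) z; simpa using this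
  have ha := h.a_ne
  have hb := h.b_ne
  obtain ⟨x0, hx0⟩ := h.fixed_rat h1 h2 h3 h4 (x := z + σ z + τ z + σ (τ z)) (by simp only [map_add, hss', hst]; ring) (by simp only [map_add, htt, hst]; ring)
  obtain ⟨x1, hx1⟩ := h.fixed_rat h1 h2 h3 h4 (x := (z - σ z + τ z - σ (τ z)) / a) (by simp only [map_add, map_sub, map_div₀, h1, hss', hst]; field_simp; ring) (by simp only [map_add, map_sub, map_div₀, h3, htt, hst]; field_simp; ring)
  obtain ⟨x2, hx2⟩ := h.fixed_rat h1 h2 h3 h4 (x := (z + σ z - τ z - σ (τ z)) / b) (by simp only [map_add, map_sub, map_div₀, h2, hss', hst]; field_simp; ring) (by simp only [map_add, map_sub, map_div₀, h4, htt, hst]; field_simp; ring)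
  obtain ⟨x3, hx3⟩ := h.fixed_rat h1 h2 h3 h4 (x := (z - σ z - τ z + σ (τ z)) / (a * b)) (by simp only [map_add, map_sub, map_mul, map_div₀, h1, h2, hss', hst]; field_simp; ring) (by simp only [map_add, map_mul, map_sub, map_div₀, h3, h4, htt, hst]; field_simp; ring)
  refine ⟨x0 / 4, x1 / 4, x2 / 4, x3 / 4, ?_⟩
  push_cast
  rw [← hx0, ← hx1, ← hx2, ← hx3]
  field_simp
  ring

lemma isInt_a (h : BF F q a b) : IsIntegral ℤ a := by
  refine IsIntegral.of_pow (n := 2) (by norm_num) ?_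
  rw [h.a2]
  exact isInt_congr (isIntegral_algebraMap (R := ℤ) (A := F) (x := 2)) (by simp)

lemma isInt_b (h : BF F q a b) : IsIntegral ℤ b := by
  refine IsIntegral.of_pow (n := 2) (by norm_num) ?_
  rw [h.b2]
  exact isInt_congr (isIntegral_algebraMap (R := ℤ) (A := F) (x := q)) (by simp)

lemma isInt_w (h : BF F q a b) : IsIntegral ℤ ((a + a * b) / 2) := by
  refine IsIntegral.of_pow (n := 2) (by norm_num) ?_
  have : ((a + a * b) / 2) ^ 2 = (((1 + q) / 2 : ℤ) : F) + b := by
    have h5 : 2 * ((1 + (q : ℤ)) / 2) = 1 + q := by have := h.q4; omega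
    have h6 : (2 : F) * (((1 + q) / 2 : ℤ) : F) = 1 + q := by exact_mod_cast congrArg (fun z : ℤ => (z : F)) h5
    field_simp
    linear_combination (1 + b) ^ 2 * h.a2 - 2 * h6 + 2 * h.b2
  rw [this]
  exact (isIntegral_algebraMap (R := ℤ) (x := (1 + q) / 2)).add h.isInt_b

lemma int_coords (h : BF F q a b) (z : F) (hz : IsIntegral ℤ z) : ∃ n0 n1 n2 n3 : ℤ, z = n0 + n1 * a + n2 * b + n3 * ((a + a * b) / 2) := by
  obtain ⟨x0, x1, x2, x3, rfl⟩ := h.coords z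
  obtain ⟨σ, τ, h1, h2, h3, h4⟩ := h.auts
  have ha2 := h.a2
  have hb2 := h.b2
  have hq4 := h.q4
  have hσz : IsIntegral ℤ ((x0 : F) - x1 * a + x2 * b - x3 * (a * b)) := by
    have := map_isIntegral_int σ hz
    simp only [map_add, map_mul, h1, h2, map_ratCast] at this
    convert this using 1; ring
  have hτz : IsIntegral ℤ ((x0 : F) + x1 * a - x2 * b - x3 * (a * b)) := by
    have := map_isIntegral_int τ hz
    simp only [map_add, map_mul, h3, h4, map_ratCast] at this
    convert this using 1; ring
  have hστz : IsIntegral ℤ ((x0 : F) - x1 * a - x2 * b + x3 * (a * b)) := by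
    have := map_isIntegral_int σ hτz
    simp only [map_add, map_sub, map_mul, h1, h2, map_ratCast] at this
    convert this using 1; ring
  have sf2 : Squarefree (2 : ℤ) := Int.prime_two.squarefree
  have sfq : Squarefree (q : ℤ) := Int.squarefree_natCast.mpr (h.sf.squarefree_of_dvd ⟨2, by ring⟩)
  have sf2q : Squarefree (2 * q : ℤ) := by exact_mod_cast Int.squarefree_natCast.mpr h.sf
  obtain ⟨⟨A, hA⟩, C, hC⟩ := conj_int τ q sfq (by omega) (2 * x0) (2 * x2) b (by simpa using hb2) h4 (by
    refine isInt_congr (hz.add hσz) ?_; push_cast; ring)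
  obtain ⟨-, B, hB⟩ := conj_int σ 2 sf2 (by omega) (2 * x0) (2 * x1) a (by simpa using ha2) h1 (by
    refine isInt_congr (hz.add hτz) ?_; push_cast; ring)
  obtain ⟨-, D, hD⟩ := conj_int σ (2 * q) sf2q (by omega) (2 * x0) (2 * x3) (a * b) (by rw [mul_pow, ha2, hb2]; push_cast; ring) (by rw [map_mul, h1, h2]; ring) (by
    refine isInt_congr (hz.add hστz) ?_; push_cast; ring)
  obtain ⟨⟨E, hE⟩, G, hG⟩ := conj_int σ 2 sf2 (by omega) (x0 ^ 2 + 2 * x1 ^ 2 - q * x2 ^ 2 - 2 * q * x3 ^ 2) (2 * x0 * x1 - 2 * q * x2 * x3) a (by simpa using ha2) h1 (by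
    refine isInt_congr (hz.mul hτz) ?_; push_cast
    linear_combination (- x1 ^ 2 + q * x3 ^ 2) * ha2 + (x2 + x3 * a) ^ 2 * hb2)
  have hE' : A ^ 2 + 2 * B ^ 2 - q * C ^ 2 - 2 * q * D ^ 2 = 4 * E := by
    have : ((A ^ 2 + 2 * B ^ 2 - q * C ^ 2 - 2 * q * D ^ 2 : ℤ) : ℚ) = (4 * E : ℤ) := by
      push_cast; rw [← hA, ← hB, ← hC, ← hD, ← hE]; ring
    exact_mod_cast this
  have hG' : A * B - q * C * D = 2 * G := by
    have : ((A * B - q * C * D : ℤ) : ℚ) = (2 * G : ℤ) := by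
      push_cast; rw [← hA, ← hB, ← hC, ← hD, ← hG]; ring
    exact_mod_cast this
  have key : A % 2 = 0 ∧ C % 2 = 0 ∧ (B - D) % 2 = 0 := by
    have e1 : (A ^ 2 + 2 * B ^ 2 - q * C ^ 2 - 2 * q * D ^ 2) % 4 = 0 := by rw [hE']; omega
    have e2 : (A * B - q * C * D) % 2 = 0 := by rw [hG']; omega
    obtain ⟨k, hk⟩ : ∃ k : ℤ, (q : ℤ) = 4 * k + 3 := ⟨q / 4, by omega⟩
    rw [hk] at e1 e2
    rcases Int.even_or_odd' A with ⟨A', rfl | rfl⟩ <;> rcases Int.even_or_odd' B with ⟨B', rfl | rfl⟩ <;>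
      rcases Int.even_or_odd' C with ⟨C', rfl | rfl⟩ <;> rcases Int.even_or_odd' D with ⟨D', rfl | rfl⟩ <;>
      ring_nf at e1 e2 ⊢ <;> omega
  obtain ⟨k1, k2, k3⟩ := key
  refine ⟨A / 2, (B - D) / 2, C / 2, D, ?_⟩
  have e1 : (2 : F) * ((A / 2 : ℤ) : F) = A := by
    have : 2 * (A / 2) = A := by omega
    exact_mod_cast congrArg (fun z : ℤ => (z : F)) this
  have e2 : (2 : F) * (((B - D) / 2 : ℤ) : F) = B - D := by
    have : 2 * ((B - D) / 2) = B - D := by omega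
    exact_mod_cast congrArg (fun z : ℤ => (z : F)) this
  have e3 : (2 : F) * ((C / 2 : ℤ) : F) = C := by
    have : 2 * (C / 2) = C := by omega
    exact_mod_cast congrArg (fun z : ℤ => (z : F)) this
  have f0 : (2 : F) * x0 = A := by exact_mod_cast congrArg (fun z : ℚ => (z : F)) hA
  have f1 : (2 : F) * x1 = B := by exact_mod_cast congrArg (fun z : ℚ => (z : F)) hB
  have f2 : (2 : F) * x2 = C := by exact_mod_cast congrArg (fun z : ℚ => (z : F)) hC
  have f3 : (2 : F) * x3 = D := by exact_mod_cast congrArg (fun z : ℚ => (z : F)) hD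
  apply mul_left_cancel₀ (two_ne_zero : (2 : F) ≠ 0)
  linear_combination f0 + a * f1 + b * f2 + a * b * f3 - e1 - a * e2 - b * e3

end BF
end biquad
end

section
open NumberField Module
set_option linter.unusedSectionVars false
set_option linter.unusedVariables false

namespace BF
variable {F : Type*} [Field F] [NumberField F] {q : ℕ} {a b : F}

lemma trace_eq (h : BF F q a b) (x0 x1 x2 x3 : ℚ) :
    Algebra.trace ℚ F (x0 + x1 * a + x2 * b + x3 * (a * b)) = 4 * x0 := by
  obtain ⟨σ, τ, h1, h2, h3, h4⟩ := h.auts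
  have e1 := Algebra.trace_eq_of_algEquiv σ ((x0 : F) + x1 * a + x2 * b + x3 * (a * b))
  have e2 := Algebra.trace_eq_of_algEquiv τ ((x0 : F) + x1 * a + x2 * b + x3 * (a * b))
  have e3 := Algebra.trace_eq_of_algEquiv (σ * τ : Gal(F/ℚ)) ((x0 : F) + x1 * a + x2 * b + x3 * (a * b))
  simp only [AlgEquiv.mul_apply, map_add, map_mul, h1, h2, h3, h4, map_neg, map_ratCast] at e1 e2 e3
  have hr : Algebra.trace ℚ F (x0 : F) = 4 * x0 := by
    have := Algebra.trace_algebraMap (R := ℚ) (S := F) x0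
    rw [h.kf.finrank_eq] at this
    simpa using this
  have hneg : ∀ z : F, Algebra.trace ℚ F (-z) = - Algebra.trace ℚ F z := fun z => map_neg _ z
  simp only [mul_neg, neg_mul, neg_neg, hneg] at e1 e2 e3
  rw [map_add, map_add, map_add, hr]
  linarith

lemma trace_int (h : BF F q a b) (z : 𝓞 F) (x0 x1 x2 x3 : ℚ) (n : ℤ) (hz : (z : F) = x0 + x1 * a + x2 * b + x3 * (a * b))
    (hn : 4 * x0 = n) :
    Algebra.trace ℤ (𝓞 F) z = n := by
  have : ((Algebra.trace ℤ (𝓞 F) z : ℤ) : ℚ) = (n : ℤ) := by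
    rw [← hn, ← h.trace_eq x0 x1 x2 x3, ← hz]
    exact (Algebra.trace_localization ℤ (nonZeroDivisors ℤ) (Rₘ := ℚ) (Sₘ := F) z).symm
  exact_mod_cast this

lemma coord_zero (h : BF F q a b) (x0 x1 x2 x3 : ℚ) (hz : (x0 : F) + x1 * a + x2 * b + x3 * (a * b) = 0) :
    x0 = 0 ∧ x1 = 0 ∧ x2 = 0 ∧ x3 = 0 := by
  obtain ⟨σ, τ, h1, h2, h3, h4⟩ := h.auts
  have e1 := congrArg σ hz
  have e2 := congrArg τ hz
  have e3 := congrArg (σ * τ : Gal(F/ℚ)) hz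
  have ha := h.a_ne
  have hb := h.b_ne
  simp only [AlgEquiv.mul_apply, map_add, map_mul, h1, h2, h3, h4, map_neg, map_ratCast, map_zero] at e1 e2 e3
  have f0 : (4 : F) * x0 = 0 := by linear_combination hz + e1 + e2 + e3
  have f1 : (4 : F) * x1 * a = 0 := by linear_combination hz - e1 + e2 - e3
  have f2 : (4 : F) * x2 * b = 0 := by linear_combination hz + e1 - e2 - e3
  have f3 : (4 : F) * x3 * a * b = 0 := by linear_combination hz - e1 - e2 + e3
  simp [ha, hb] at f0 f1 f2 f3
  exact ⟨f0, f1, f2, f3⟩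

lemma discr_eq (h : BF F q a b) : discr F = 256 * q ^ 2 := by
  let A : 𝓞 F := ⟨a, h.isInt_a⟩
  let B : 𝓞 F := ⟨b, h.isInt_b⟩
  let W : 𝓞 F := ⟨(a + a * b) / 2, h.isInt_w⟩
  have hA : (A : F) = a := rfl
  have hB : (B : F) = b := rfl
  have hW : (W : F) = (a + a * b) / 2 := rfl
  have ha2 := h.a2
  have hb2 := h.b2
  have li : LinearIndependent ℤ ![(1 : 𝓞 F), A, B, W] := by
    rw [Fintype.linearIndependent_iff]
    intro g hg
    have hg := congrArg (fun z : 𝓞 F => (z : F)) hg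
    simp [Fin.sum_univ_succ, hA, hB, hW] at hg
    have := h.coord_zero (g 0) (g 1 + g 3 / 2) (g 2) (g 3 / 2) (by
      push_cast
      rw [← hg]; ring)
    obtain ⟨k0, k1, k2, k3⟩ := this
    have k3' : (g 3 : ℚ) = 0 := by linarith
    have k1' : (g 1 : ℚ) = 0 := by rw [k3'] at k1; linarith
    intro i
    fin_cases i
    · exact_mod_cast k0
    · exact_mod_cast k1'
    · exact_mod_cast k2
    · exact_mod_cast k3'
  have sp : ⊤ ≤ Submodule.span ℤ (Set.range ![(1 : 𝓞 F), A, B, W]) := by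
    intro z _
    obtain ⟨n0, n1, n2, n3, hz⟩ := h.int_coords (z : F) z.2
    have e : z = n0 • (1 : 𝓞 F) + n1 • A + n2 • B + n3 • W := by
      apply RingOfIntegers.ext
      rw [hz]
      simp [hA, hB, hW]
    rw [e]
    exact Submodule.add_mem _ (Submodule.add_mem _ (Submodule.add_mem _ (Submodule.smul_mem _ _ (Submodule.subset_span ⟨0, rfl⟩))
      (Submodule.smul_mem _ _ (Submodule.subset_span ⟨1, rfl⟩))) (Submodule.smul_mem _ _ (Submodule.subset_span ⟨2, rfl⟩)))
      (Submodule.smul_mem _ _ (Submodule.subset_span ⟨3, rfl⟩))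
  rw [← discr_eq_discr F (Basis.mk li sp), Algebra.discr_def]
  have hM : Algebra.traceMatrix ℤ (Basis.mk li sp) = !![4, 0, 0, 0; 0, 8, 0, 4; 0, 0, 4 * (q : ℤ), 0; 0, 4, 0, 2 * (1 + (q : ℤ))] := by
    have ab : a * a = 2 := by rw [← ha2]; ring
    have bb : b * b = q := by rw [← hb2]; ring
    have t00 : Algebra.trace ℤ (𝓞 F) (1 * 1) = 4 := h.trace_int _ 1 0 0 0 4 (by simp) (by norm_num)
    have t01 : Algebra.trace ℤ (𝓞 F) (1 * A) = 0 := h.trace_int _ 0 1 0 0 0 (by simp [hA]) (by norm_num)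
    have t02 : Algebra.trace ℤ (𝓞 F) (1 * B) = 0 := h.trace_int _ 0 0 1 0 0 (by simp [hB]) (by norm_num)
    have t03 : Algebra.trace ℤ (𝓞 F) (1 * W) = 0 := h.trace_int _ 0 (1/2) 0 (1/2) 0 (by simp [hW]; ring) (by norm_num)
    have t11 : Algebra.trace ℤ (𝓞 F) (A * A) = 8 := h.trace_int _ 2 0 0 0 8 (by simp [hA, ab]) (by norm_num)
    have t12 : Algebra.trace ℤ (𝓞 F) (A * B) = 0 := h.trace_int _ 0 0 0 1 0 (by simp [hA, hB]) (by norm_num)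
    have t13 : Algebra.trace ℤ (𝓞 F) (A * W) = 4 := h.trace_int _ 1 0 1 0 4 (by simp [hA, hW]; field_simp; linear_combination (1 + b) * ha2) (by norm_num)
    have t22 : Algebra.trace ℤ (𝓞 F) (B * B) = 4 * (q : ℤ) := h.trace_int _ q 0 0 0 _ (by simp [hB, bb]) (by norm_num)
    have t23 : Algebra.trace ℤ (𝓞 F) (B * W) = 0 := h.trace_int _ 0 (q/2) 0 (1/2) _ (by simp [hB, hW]; field_simp; linear_combination a * hb2) (by norm_num)
    have t33 : Algebra.trace ℤ (𝓞 F) (W * W) = 2 * (1 + (q : ℤ)) := h.trace_int _ ((1+q)/2) 0 1 0 _ (by simp [hW]; field_simp; linear_combination (1+b)^2 * ha2 + 2 * hb2) (by push_cast; ring)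
    ext i j
    simp only [Algebra.traceMatrix_apply, Algebra.traceForm_apply, Basis.coe_mk]
    fin_cases i <;> fin_cases j <;> simp <;> first | assumption | (rw [mul_comm]; assumption) | skip
    all_goals first | simpa using t00 | simpa using t01 | simpa using t02 | simpa using t03
  rw [hM]
  simp [Matrix.det_succ_row_zero, Fin.sum_univ_succ, Fin.succAbove]
  ring
end BF
end

section
open NumberField Module
set_option linter.unusedSectionVars false
set_option linter.unusedVariables false

lemma KF.sub {ι : Type*} [Fintype ι] {K : Type*} [Field K] [NumberField K] {D : ι → ℕ} {g : ι → K}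
    (hg : ∀ i, g i ∈ IntermediateField.adjoin ℚ (Set.range g)) (hsq : ∀ i, g i ^ 2 = (D i : K)) (hns : ∀ t : ι → ZMod 2, t ≠ 0 → ∀ x : ℚ, x ^ 2 ≠ ∏ i, (D i : ℚ) ^ (t i).val) :
    KF (IntermediateField.adjoin ℚ (Set.range g)) D (fun i => ⟨g i, hg i⟩) where
  sq := by
    intro i
    apply Subtype.ext
    simpa using hsq i
  top := by
    rw [eq_top_iff]
    rintro ⟨x, hx⟩ -
    induction hx using IntermediateField.adjoin_induction with
    | mem x hx' => obtain ⟨i, rfl⟩ := hx'; exact IntermediateField.subset_adjoin ℚ _ ⟨i, rfl⟩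
    | algebraMap x => exact IntermediateField.algebraMap_mem _ x
    | add x y _ _ h1 h2 => exact IntermediateField.add_mem _ h1 h2
    | inv x _ h1 => exact IntermediateField.inv_mem _ h1
    | mul x y _ _ h1 h2 => exact IntermediateField.mul_mem _ h1 h2
  ns := hns

namespace KA
variable {q r s Q Q' : ℕ} [hqf : Fact q.Prime] [hrf : Fact r.Prime] [hsf : Fact s.Prime]
variable {K : Type*} [Field K] [NumberField K] {a b b' c : K} {φ : K →+* ℝ}

lemma b_mem (h : KA q r s Q Q' a b b' c φ) (L : IntermediateField ℚ K) (ha : a ∈ L) (hb : b' ∈ L) : b ∈ L := by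
  obtain ⟨κ, hκ, hk⟩ := h.bb
  have ha0 : a ≠ 0 := h.kf.g_ne 0
  have : b = κ * b' * a⁻¹ := by rw [hk]; field_simp
  rw [this]
  exact L.mul_mem (L.mul_mem (_root_.natCast_mem L κ) hb) (L.inv_mem ha)

lemma bf_exists (h : KA q r s Q Q' a b b' c φ) : ∃ (F : IntermediateField ℚ K) (A B : F), BF F q A B ∧ a ∈ F ∧ b ∈ F := by
  obtain ⟨x, hx, hL⟩ : ∃ x : K, x ^ 2 = q ∧ ∀ L : IntermediateField ℚ K, a ∈ L → x ∈ L → b ∈ L := by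
    rcases h.ar.hQ with ⟨h1, h2⟩ | ⟨h1, h2⟩
    · exact ⟨b, by rw [h.sqb, h1], fun L _ h => h⟩
    · exact ⟨b', by rw [h.b2, h2], fun L h1 h2 => h.b_mem L h1 h2⟩
  have hq := hqf.out
  have hq2 : q ≠ 2 := by have := h.ar.q4; omega
  have hsf : Squarefree (2 * q) := by
    rw [Nat.squarefree_mul ((Nat.coprime_primes Nat.prime_two hq).mpr hq2.symm)]
    exact ⟨Nat.prime_two.prime.squarefree, hq.prime.squarefree⟩
  have hz : ∀ z : ZMod 2, z = 0 ∨ z = 1 := by decide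
  have hv1 : ZMod.val (1 : ZMod 2) = 1 := by decide
  have hv0 : ZMod.val (0 : ZMod 2) = 0 := by decide
  have key := KF.sub (K := K) (D := ![2, q]) (g := ![a, x]) (fun i => IntermediateField.subset_adjoin ℚ _ ⟨i, rfl⟩) (by
      intro i
      fin_cases i
      · simpa using h.sqa
      · simpa using hx) (by
      intro t ht y
      have nsx : ∀ d : ℕ, d ∣ 2 * q → 1 < d → y ^ 2 ≠ (d : ℚ) := by
        intro d hd h1
        have := QF.nonsq (d := (d : ℤ)) (Int.squarefree_natCast.mpr (hsf.squarefree_of_dvd hd)) (by exact_mod_cast h1) y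
        simpa using this
      rw [Fin.prod_univ_two]
      rcases hz (t 0) with h0 | h0 <;> rcases hz (t 1) with h1 | h1
      · exact absurd (by funext i; fin_cases i <;> assumption) ht
      · have := nsx q ⟨2, by ring⟩ hq.one_lt
        simpa [h0, h1, hv0, hv1] using this
      · have := nsx 2 ⟨q, by ring⟩ (by norm_num)
        simpa [h0, h1, hv0, hv1] using this
      · have := nsx (2 * q) dvd_rfl (by have := hq.one_lt; omega)
        simpa [h0, h1, hv0, hv1] using this)
  have ha : a ∈ IntermediateField.adjoin ℚ (Set.range ![a, x]) := IntermediateField.subset_adjoin ℚ _ ⟨0, rfl⟩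
  have hxm : x ∈ IntermediateField.adjoin ℚ (Set.range ![a, x]) := IntermediateField.subset_adjoin ℚ _ ⟨1, rfl⟩
  refine ⟨_, ⟨a, ha⟩, ⟨x, hxm⟩, ⟨?_, h.ar.q4, hsf⟩, ha, hL _ ha hxm⟩
  convert key using 1
  funext i
  fin_cases i <;> rfl

lemma discr_kk (h : KA q r s Q Q' a b b' c φ) (i : Fin 7) : discr (kk a b b' c i) = (if i = 3 then 1 else 4) * (Ar.dN r s Q Q' i : ℤ) := by
  have hq := h.ar.q4
  have hr : r % 4 = 1 := by have := h.ar.r8; omega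
  have hs : s % 4 = 1 := by have := h.ar.s8; omega
  have h1 : (2 * r * s) % 4 = 2 := by simp [Nat.mul_mod, hr, hs]
  have h2 : (q * r * s) % 4 = 3 := by simp [Nat.mul_mod, hr, hs, hq]
  have h3 : (2 * q * r * s) % 4 = 2 := by simp [Nat.mul_mod, hr, hs, hq]
  have h4 : (1 * r * s) % 4 = 1 := by simp [Nat.mul_mod, hr, hs]
  have h5 : (2 * q) % 4 = 2 := by omega
  have key : ∀ i : Fin 7, i ≠ 3 → Ar.dN r s Q Q' i % 4 = 2 ∨ Ar.dN r s Q Q' i % 4 = 3 := by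
    intro i hi
    rcases h.ar.hQ with ⟨e, e'⟩ | ⟨e, e'⟩ <;> rw [e, e'] <;> fin_cases i <;> simp [Ar.dN] at hi ⊢ <;> omega
  split_ifs with hi
  · rw [one_mul]
    exact (h.qf i).discr_1 (by rw [hi]; simp only [Ar.dN]; norm_cast)
  · exact (h.qf i).discr_23 (by have := key i hi; omega)

lemma discr_K (h : KA q r s Q Q' a b b' c φ) : (discr K).natAbs = ∏ i, (discr (kk a b b' c i)).natAbs := by
  obtain ⟨F, A, B, hF, ha, hb⟩ := h.bf_exists
  have hFd := hF.discr_eq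
  have h3 : discr (kk a b b' c 3) = ((r * s : ℕ) : ℤ) := by rw [h.discr_kk 3]; simp [Ar.dN]
  have hcop : IsCoprime (discr F) (discr (kk a b b' c 3)) := by
    rw [hFd, h3]
    have : Nat.Coprime (256 * q ^ 2) (r * s) := by
      have hq := hqf.out
      have hr := hrf.out
      have hs := hsf.out
      have h1 : Nat.Coprime 2 (r * s) := Nat.Coprime.mul_right
        ((Nat.coprime_primes Nat.prime_two hr).mpr (by have := h.ar.r8; omega))
        ((Nat.coprime_primes Nat.prime_two hs).mpr (by have := h.ar.s8; omega))
      have h2 : Nat.Coprime q (r * s) := Nat.Coprime.mul_right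
        ((Nat.coprime_primes hq hr).mpr h.ar.qr) ((Nat.coprime_primes hq hs).mpr h.ar.qs)
      refine Nat.Coprime.mul_left ?_ (h2.pow_left 2)
      exact Nat.Coprime.pow_left 8 h1
    exact_mod_cast Nat.isCoprime_iff_coprime.mpr this
  have := hF.kf.gal
  have hdis := linearDisjoint_of_isGalois_isCoprime_discr K F (kk a b b' c 3) hcop
  have htop : F ⊔ kk a b b' c 3 = ⊤ := by
    rw [eq_top_iff, ← h.kf.top, IntermediateField.adjoin_le_iff]
    rintro _ ⟨i, rfl⟩
    fin_cases i
    · exact (le_sup_left : F ≤ _) ha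
    · exact (le_sup_left : F ≤ _) hb
    · exact (le_sup_right : kk a b b' c 3 ≤ F ⊔ _) (IntermediateField.mem_adjoin_simple_self ℚ _)
  rw [natAbs_discr_eq_natAbs_discr_pow_mul_natAbs_discr_pow K F _ hdis htop (isCoprime_differentIdeal_of_isCoprime_discr _ hcop),
    hF.kf.finrank_eq, h.rk_kk 3]
  simp_rw [h.discr_kk]
  rw [hFd]
  simp only [Fin.prod_univ_succ, Int.natAbs_mul, Ar.dN]
  rcases h.ar.hQ with ⟨e, e'⟩ | ⟨e, e'⟩ <;> rw [e, e'] <;> simp [Fin.ext_iff, Int.natAbs_mul] <;> ring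

theorem cnf' (h : KA q r s Q Q' a b b' c φ) :
    Units.regulator K * classNumber K = ∏ i, (Units.regulator (kk a b b' c i) * classNumber (kk a b b' c i)) := h.cnf h.discr_K
end KA
end

section
open NumberField Module NumberField.Units
set_option linter.unusedSectionVars false
set_option linter.unusedVariables false

lemma fund_sqrt2 {k : Type*} [Field k] [NumberField k] {x : k} (h : QF k 2 x) (φ : k →+* ℝ) (hx : 0 < φ x) (ε : (𝓞 k)ˣ)
    (hf : Fd φ ε) : ((ε : 𝓞 k) : k) = 1 + x := by
  obtain ⟨u, v, huv⟩ := h.int_coord' (by norm_num) (ε : 𝓞 k)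
  have hN := h.unit_norm ε u v (by rw [huv]; simp)
  have hN' : u ^ 2 - 2 * v ^ 2 = 1 ∨ u ^ 2 - 2 * v ^ 2 = -1 := by exact_mod_cast hN
  have hsq : φ x ^ 2 = 2 := by rw [← map_pow, h.sq, map_intCast]; norm_num
  have h1 : 1 < (u : ℝ) + v * φ x := by
    have := hf.gt
    rw [huv] at this
    simpa using this
  have hprod : ((u : ℝ) + v * φ x) * (u - v * φ x) = 1 ∨ ((u : ℝ) + v * φ x) * (u - v * φ x) = -1 := by
    have e : ((u : ℝ) + v * φ x) * (u - v * φ x) = ((u ^ 2 - 2 * v ^ 2 : ℤ) : ℝ) := by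
      push_cast; linear_combination (-(v:ℝ)^2) * hsq
    rw [e]
    rcases hN' with h2 | h2 <;> rw [h2] <;> simp
  have hsm : |(u : ℝ) - v * φ x| < 1 := by
    have h3 : |(u : ℝ) + v * φ x| * |(u : ℝ) - v * φ x| = 1 := by
      rw [← abs_mul]
      rcases hprod with h2 | h2 <;> rw [h2] <;> simp
    have h4 : 1 < |(u : ℝ) + v * φ x| := lt_of_lt_of_le h1 (le_abs_self _)
    by_contra h5
    push Not at h5
    nlinarith
  rw [abs_lt] at hsm
  have hu : 0 < (u : ℝ) := by linarith [hsm.1]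
  have hv : 0 < (v : ℝ) := by
    have : 0 < (v : ℝ) * φ x := by linarith [hsm.2]
    exact (pos_iff_pos_of_mul_pos this).mpr hx
  have hu1 : (1 : ℤ) ≤ u := by have : (0 : ℤ) < u := by exact_mod_cast hu
                               omega
  have hv1 : (1 : ℤ) ≤ v := by have : (0 : ℤ) < v := by exact_mod_cast hv
                               omega
  have hu1' : (1 : ℝ) ≤ u := by exact_mod_cast hu1
  have hv1' : (1 : ℝ) ≤ v := by exact_mod_cast hv1
  have hge : 1 + φ x ≤ φ (ε : 𝓞 k) := by
    rw [huv]; simp; nlinarith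
  -- the unit 1 + x
  have hX := h.X_sq
  let η : (𝓞 k)ˣ := ⟨1 + h.X, h.X - 1, by linear_combination hX, by linear_combination hX⟩
  have hη : ((η : 𝓞 k) : k) = 1 + x := by
    change ((1 + h.X : 𝓞 k) : k) = 1 + x
    simp
  have hφη : φ (η : 𝓞 k) = 1 + φ x := by
    rw [hη]; simp
  have hg := hf.gt
  obtain ⟨n, hn | hn⟩ := hf.gen η
  · have e : φ (η : 𝓞 k) = φ (ε : 𝓞 k) ^ n := by
      rw [hn]; simp [Units.coe_zpow]
    have hn1 : n = 1 := by
      rcases lt_trichotomy n 1 with h5 | h5 | h5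
      · have : φ (ε : 𝓞 k) ^ n ≤ 1 := zpow_le_one_of_nonpos₀ hg.le (by omega)
        rw [← e, hφη] at this; linarith
      · exact h5
      · have : φ (ε : 𝓞 k) ^ (1 : ℤ) < φ (ε : 𝓞 k) ^ n := zpow_lt_zpow_right₀ hg h5
        rw [← e, hφη, zpow_one] at this; linarith
    rw [hn1, zpow_one] at hn
    rw [← hn]; exact hη
  · exfalso
    have e : φ (η : 𝓞 k) = - φ (ε : 𝓞 k) ^ n := by
      rw [hn]; simp [Units.coe_zpow]
    have : 0 < φ (ε : 𝓞 k) ^ n := zpow_pos (by linarith) n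
    rw [hφη] at e; linarith

/-- the unit data in the big field -/
structure UD (q r s Q Q' : ℕ) [Fact q.Prime] [Fact r.Prime] [Fact s.Prime] {K : Type*} [Field K] [NumberField K] (a b b' c : K) (φ : K →+* ℝ)
    (e : Fin 7 → K) (N : Fin 7 → ℤ) : Prop where
  ka : KA q r s Q Q' a b b' c φ
  int : ∀ i, IsIntegral ℤ (e i)
  gt : ∀ i, 1 < φ (e i)
  reg : ∀ i, regulator (KA.kk a b b' c i) = Real.log (φ (e i))
  coord : ∀ i, ∃ u v : ℚ, e i = u + v * XX a b b' c i ∧ u ^ 2 - (Ar.dN r s Q Q' i) * v ^ 2 = N i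
  e0 : e 0 = 1 + a
  N0 : N 0 = -1
  N1 : N 1 = 1
  N2 : N 2 = 1
  N3 : N 3 = 1 ∨ N 3 = -1
  N4 : N 4 = -1
  N5 : N 5 = 1
  N6 : N 6 = 1
  s1 : ∃ x y : ℚ, ((x : K) + y * b) ^ 2 = 2 * e 1
  s2 : ∃ x y : ℚ, ((x : K) + y * b') ^ 2 = 2 * e 2
  s3 : N 3 = 1 → ∃ x y : ℚ, ((x : K) + y * c) ^ 2 = r * e 3
  s5 : (∃ x y : ℚ, ((x : K) + y * (b * c)) ^ 2 = r * e 5) ∨ (∃ x y : ℚ, ((x : K) + y * (b * c)) ^ 2 = s * e 5)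
  s6 : ∃ x y : ℚ, ((x : K) + y * (b' * c)) ^ 2 = Q * e 6

namespace KA
variable {q r s Q Q' : ℕ} [hqf : Fact q.Prime] [hrf : Fact r.Prime] [hsf : Fact s.Prime]
variable {K : Type*} [Field K] [NumberField K] {a b b' c : K} {φ : K →+* ℝ}

lemma pX (h : KA q r s Q Q' a b b' c φ) (i : Fin 7) : 0 < φ (XX a b b' c i) := by
  have h1 := h.pa
  have h2 := h.pb
  have h3 := h.pb'
  have h4 := h.pc
  fin_cases i <;> simp [XX] <;> positivity

/-- embedding of a quadratic subfield -/
noncomputable abbrev ph (a b b' c : K) (φ : K →+* ℝ) (i : Fin 7) : kk a b b' c i →+* ℝ := φ.comp (algebraMap (kk a b b' c i) K)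

lemma exists_UD (h : KA q r s Q Q' a b b' c φ)
    (H5 : ∀ (ε : (𝓞 (kk a b b' c 5))ˣ) (u v : ℚ), Fd (ph a b b' c φ 5) ε →
      ((ε : 𝓞 (kk a b b' c 5)) : kk a b b' c 5) = u + v * IntermediateField.AdjoinSimple.gen ℚ (XX a b b' c 5) →
      ¬ ∃ t : ℤ, t ≠ 0 ∧ 2 + 2 * u = r * s * t ^ 2) : ∃ e N, UD q r s Q Q' a b b' c φ e N := by
  have h1 := fun i => (h.qf i).exists_fund (ph a b b' c φ i)
  choose ε hgt hgen hreg using h1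
  have hF : ∀ i, Fd (ph a b b' c φ i) (ε i) := fun i => ⟨hgt i, hgen i⟩
  have h2 := fun i => (h.qf i).exists_coord ((ε i : 𝓞 (kk a b b' c i)) : kk a b b' c i)
  choose u v huv using h2
  have h3 := fun i => (h.qf i).unit_norm (ε i) (u i) (v i) (huv i)
  let N : Fin 7 → ℤ := fun i => if u i ^ 2 - (Ar.dN r s Q Q' i : ℤ) * v i ^ 2 = 1 then 1 else -1
  have hN : ∀ i, u i ^ 2 - (Ar.dN r s Q Q' i : ℤ) * v i ^ 2 = N i := by
    intro i
    simp only [N]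
    split_ifs with h4
    · rw [h4]; simp
    · rw [(h3 i).resolve_left h4]; simp
  have lift : ∀ (i : Fin 7) (m : ℕ), (∃ y : kk a b b' c i, (m : kk a b b' c i) * ((ε i : 𝓞 (kk a b b' c i)) : kk a b b' c i) = y ^ 2) →
      ∃ x y : ℚ, ((x : K) + y * XX a b b' c i) ^ 2 = m * (((ε i : 𝓞 (kk a b b' c i)) : kk a b b' c i) : K) := by
    rintro i m ⟨y, hy⟩
    obtain ⟨x', y', hxy⟩ := (h.qf i).exists_coord y
    refine ⟨x', y', ?_⟩
    have := congrArg (fun z : kk a b b' c i => (z : K)) hy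
    rw [hxy] at this
    simpa using this.symm
  have hq0 : QF (kk a b b' c 0) 2 (IntermediateField.AdjoinSimple.gen ℚ (XX a b b' c 0)) := h.qf 0
  have f0 := fund_sqrt2 hq0 (ph a b b' c φ 0) (by simpa using h.pX 0) (ε 0) (hF 0)
  have f1 := h.ar.fund_Q (D0 := Q) (Or.inl rfl) (h.qf 1) _ (ε 1) (hF 1) (u 1) (v 1) (huv 1)
  have f2 := h.ar.fund_Q (D0 := Q') (Or.inr rfl) (h.qf 2) _ (ε 2) (hF 2) (u 2) (v 2) (huv 2)
  have q3 := h.qf 3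
  have q4 := h.qf 4
  have q5 := h.qf 5
  have q6 := h.qf 6
  have d3 : (Ar.dN r s Q Q' 3 : ℤ) = (((1 : ℕ) : ℤ) * r * s) := by simp [Ar.dN]
  have d4 : (Ar.dN r s Q Q' 4 : ℤ) = (((2 : ℕ) : ℤ) * r * s) := by simp [Ar.dN]
  have d5 : (Ar.dN r s Q Q' 5 : ℤ) = ((Q : ℤ) * r * s) := by simp [Ar.dN]
  have d6 : (Ar.dN r s Q Q' 6 : ℤ) = ((Q' : ℤ) * r * s) := by simp [Ar.dN]
  have N3 := hN 3
  have N4 := hN 4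
  have N5 := hN 5
  have N6 := hN 6
  rw [d3] at q3 N3
  rw [d4] at q4 N4
  rw [d5] at q5 N5
  rw [d6] at q6 N6
  have f4 := h.ar.fund_2rs q4 _ (ε 4) (hF 4) (u 4) (v 4) (huv 4)
  have f6 := h.ar.fund_Q'rs q6 _ (ε 6) (hF 6) (u 6) (v 6) (huv 6)
  have f5 := h.ar.fund_Qrs q5 _ (ε 5) (hF 5) (u 5) (v 5) (huv 5) (H5 (ε 5) (u 5) (v 5) (hF 5) (huv 5))
  refine ⟨fun i => (((ε i : 𝓞 (kk a b b' c i)) : kk a b b' c i) : K), N, ⟨h, ?_, hgt, hreg, ?_, ?_, ?_, ?_, ?_, ?_, ?_, ?_, ?_, ?_, ?_, ?_, ?_, ?_⟩⟩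
  · intro i
    exact ((ε i : 𝓞 (kk a b b' c i)).2).map (algebraMap (kk a b b' c i) K).toIntAlgHom
  · intro i
    refine ⟨u i, v i, ?_, by simpa using hN i⟩
    rw [huv i]; simp
  · rw [f0]; rfl
  · have h5 := (hq0.coord_inj (u := u 0) (v := v 0) (u' := 1) (v' := 1) (by rw [← huv 0, f0]; simp))
    have := hN 0
    rw [h5.1, h5.2] at this
    simp [Ar.dN] at this
    have h6 : (N 0 : ℚ) = ((-1 : ℤ) : ℚ) := by rw [← this]; norm_num
    exact_mod_cast h6
  · have := hN 1
    rw [show (Ar.dN r s Q Q' 1 : ℤ) = (Q : ℤ) from rfl, f1.1] at this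
    exact_mod_cast this.symm
  · have := hN 2
    rw [show (Ar.dN r s Q Q' 2 : ℤ) = (Q' : ℤ) from rfl, f2.1] at this
    exact_mod_cast this.symm
  · simp only [N]; split_ifs <;> simp
  · rw [f4] at N4
    have h6 : (N 4 : ℚ) = ((-1 : ℤ) : ℚ) := by rw [← N4]; norm_num
    exact_mod_cast h6
  · rw [f5.1] at N5; exact_mod_cast N5.symm
  · rw [f6.1] at N6; exact_mod_cast N6.symm
  · have := lift 1 2 (by simpa using f1.2)
    simpa [XX] using this
  · have := lift 2 2 (by simpa using f2.2)
    simpa [XX] using this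
  · intro hh
    rw [hh] at N3
    have f3 := h.ar.fund_rs q3 _ (ε 3) (hF 3) (u 3) (v 3) (huv 3) (by rw [N3]; simp)
    exact lift 3 r f3
  · rcases f5.2 with f | f
    · left; exact lift 5 r f
    · right; exact lift 5 s f
  · exact lift 6 Q f6.2
end KA
end

section
open NumberField Module NumberField.Units
set_option linter.unusedSectionVars false
set_option linter.unusedVariables false

namespace UD
variable {q r s Q Q' : ℕ} [hqf : Fact q.Prime] [hrf : Fact r.Prime] [hsf : Fact s.Prime]
variable {K : Type*} [Field K] [NumberField K] {a b b' c : K} {φ : K →+* ℝ} {e : Fin 7 → K} {N : Fin 7 → ℤ}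

lemma e_ne (h : UD q r s Q Q' a b b' c φ e N) (i : Fin 7) : e i ≠ 0 := by
  intro h1
  have := h.gt i
  rw [h1, map_zero] at this
  linarith

lemma N_pm (h : UD q r s Q Q' a b b' c φ e N) (i : Fin 7) : N i = 1 ∨ N i = -1 := by
  have h0 := h.N0
  have h1 := h.N1
  have h2 := h.N2
  have h3 := h.N3
  have h4 := h.N4
  have h5 := h.N5
  have h6 := h.N6
  fin_cases i <;> simp <;> tauto

lemma conj0 (h : UD q r s Q Q' a b b' c φ e N) (i : Fin 7) (σ : Gal(K/ℚ)) (hσ : ch i (KA.sv a b c σ) = 0) : σ (e i) = e i := by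
  obtain ⟨u, v, h1, h2⟩ := h.coord i
  rw [h1, map_add, map_mul, h.ka.map_X, hσ]
  simp [sg]

lemma conj1 (h : UD q r s Q Q' a b b' c φ e N) (i : Fin 7) (σ : Gal(K/ℚ)) (hσ : ch i (KA.sv a b c σ) = 1) : e i * σ (e i) = N i := by
  obtain ⟨u, v, h1, h2⟩ := h.coord i
  rw [h1, map_add, map_mul, h.ka.map_X, hσ]
  have h3 := h.ka.sqX i
  have h4 : (u : K) ^ 2 - (Ar.dN r s Q Q' i) * v ^ 2 = N i := by exact_mod_cast congrArg (fun z : ℚ => (z : K)) h2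
  simp [sg]
  rw [← h4, ← h3]
  ring

/-- the square of a norm from K is positive -/
lemma neg_sq (y z : K) (φ : K →+* ℝ) (hz : z ≠ 0) (h : y ^ 2 = - z ^ 2) : False := by
  have h1 := congrArg φ h
  simp only [map_pow, map_neg] at h1
  have h2 : φ z ≠ 0 := by simpa using hz
  have := sq_nonneg (φ y)
  have := pow_pos (abs_pos.mpr h2) 2
  rw [sq_abs] at this
  linarith

lemma trip (h : UD q r s Q Q' a b b' c φ e N) (h3 : N 3 = -1) : ∃ T tB tC : ℤ, 0 < tB ∧ 0 < tC ∧
    e 3 - (e 3)⁻¹ = tB ∧ e 4 - (e 4)⁻¹ = tC ∧ e 0 - (e 0)⁻¹ = 2 ∧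
    e 0 * e 3 * e 4 + e 0 * (e 3)⁻¹ * (e 4)⁻¹ + (e 0)⁻¹ * e 3 * (e 4)⁻¹ + (e 0)⁻¹ * (e 3)⁻¹ * e 4 = T := by
  have hn := h.e_ne
  obtain ⟨σ, hσ⟩ := h.ka.exists_aut ![1, 0, 0]
  obtain ⟨τ, hτ⟩ := h.ka.exists_aut ![0, 0, 1]
  have inv1 : ∀ (i : Fin 7) (σ : Gal(K/ℚ)), N i = -1 → ch i (KA.sv a b c σ) = 1 → σ (e i) = - (e i)⁻¹ := by
    intro i σ h1 h2
    have := h.conj1 i σ h2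
    rw [h1] at this
    have hi := hn i
    field_simp
    push_cast at this
    linear_combination this
  have σ0 := inv1 0 σ h.N0 (by rw [hσ]; decide)
  have σ3 := h.conj0 3 σ (by rw [hσ]; decide)
  have σ4 := inv1 4 σ h.N4 (by rw [hσ]; decide)
  have τ0 := h.conj0 0 τ (by rw [hτ]; decide)
  have τ3 := inv1 3 τ h3 (by rw [hτ]; decide)
  have τ4 := inv1 4 τ h.N4 (by rw [hτ]; decide)
  have hst : ∀ x : K, σ x = x → τ x = x → (∃ η : Gal(K/ℚ), True) → (∀ ρ : Gal(K/ℚ), KA.sv a b c ρ = ![0, 1, 0] → ρ x = x) → IsIntegral ℤ x → ∃ n : ℤ, x = n := by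
    intro x hs ht _ hr hi
    obtain ⟨ρ, hρ⟩ := h.ka.exists_aut ![0, 1, 0]
    have hρx := hr ρ hρ
    obtain ⟨u, hu⟩ := h.ka.kf.rat_of_fixed (x := x) (by
      intro g
      have hz : ∀ t : Fin 3 → ZMod 2, t = 0 ∨ t = ![1, 0, 0] ∨ t = ![0, 1, 0] ∨ t = ![0, 0, 1] ∨ t = ![1, 0, 0] + ![0, 1, 0] ∨ t = ![1, 0, 0] + ![0, 0, 1]
        ∨ t = ![0, 1, 0] + ![0, 0, 1] ∨ t = ![1, 0, 0] + (![0, 1, 0] + ![0, 0, 1]) := by decide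
      have hinj := h.ka.kf.sb_inj
      have hmul := h.ka.kf.sb_mul
      rcases hz (KA.sv a b c g) with h1 | h1 | h1 | h1 | h1 | h1 | h1 | h1
      · have : g = 1 := hinj (by rw [h.ka.kf.sb_one]; exact h1)
        rw [this]; rfl
      · have : g = σ := hinj (h1.trans hσ.symm)
        rw [this, hs]
      · have : g = ρ := hinj (h1.trans hρ.symm)
        rw [this, hρx]
      · have : g = τ := hinj (h1.trans hτ.symm)
        rw [this, ht]
      · have : g = σ * ρ := hinj (by rw [hmul]; exact h1.trans (by rw [← hσ, ← hρ]))
        rw [this, AlgEquiv.mul_apply, hρx, hs]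
      · have : g = σ * τ := hinj (by rw [hmul]; exact h1.trans (by rw [← hσ, ← hτ]))
        rw [this, AlgEquiv.mul_apply, ht, hs]
      · have : g = ρ * τ := hinj (by rw [hmul]; exact h1.trans (by rw [← hρ, ← hτ]))
        rw [this, AlgEquiv.mul_apply, ht, hρx]
      · have : g = σ * (ρ * τ) := hinj (by rw [hmul, hmul]; exact h1.trans (by rw [← hσ, ← hρ, ← hτ]))
        rw [this, AlgEquiv.mul_apply, AlgEquiv.mul_apply, ht, hρx, hs])
    obtain ⟨n, hn⟩ := int_of_isIntegral (F := K) u (by rw [← hu]; exact hi)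
    exact ⟨n, by rw [hu, hn]; simp⟩
  have iinv : ∀ (i : Fin 7) (σ : Gal(K/ℚ)), σ (e i) = - (e i)⁻¹ → IsIntegral ℤ (e i)⁻¹ := by
    intro i σ h1
    have := (map_isIntegral_int σ (h.int i)).neg
    rw [h1, neg_neg] at this
    exact this
  have i0 := iinv 0 σ σ0
  have i3 := iinv 3 τ τ3
  have i4 := iinv 4 τ τ4
  have ρ0 : ∀ ρ : Gal(K/ℚ), KA.sv a b c ρ = ![0, 1, 0] → ρ (e 0) = e 0 := fun ρ hρ => h.conj0 0 ρ (by rw [hρ]; decide)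
  have ρ3 : ∀ ρ : Gal(K/ℚ), KA.sv a b c ρ = ![0, 1, 0] → ρ (e 3) = e 3 := fun ρ hρ => h.conj0 3 ρ (by rw [hρ]; decide)
  have ρ4 : ∀ ρ : Gal(K/ℚ), KA.sv a b c ρ = ![0, 1, 0] → ρ (e 4) = e 4 := fun ρ hρ => h.conj0 4 ρ (by rw [hρ]; decide)
  obtain ⟨tB, hB⟩ := hst (e 3 - (e 3)⁻¹) (by simp only [map_sub, map_inv₀, σ3]) (by simp only [map_sub, map_inv₀, τ3, inv_neg, inv_inv]; ring) ⟨σ, trivial⟩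
    (by intro ρ hρ; simp only [map_sub, map_inv₀, ρ3 ρ hρ]) ((h.int 3).sub i3)
  obtain ⟨tC, hC⟩ := hst (e 4 - (e 4)⁻¹) (by simp only [map_sub, map_inv₀, σ4, inv_neg, inv_inv]; ring) (by simp only [map_sub, map_inv₀, τ4, inv_neg, inv_inv]; ring) ⟨σ, trivial⟩
    (by intro ρ hρ; simp only [map_sub, map_inv₀, ρ4 ρ hρ]) ((h.int 4).sub i4)
  obtain ⟨T, hT⟩ := hst (e 0 * e 3 * e 4 + e 0 * (e 3)⁻¹ * (e 4)⁻¹ + (e 0)⁻¹ * e 3 * (e 4)⁻¹ + (e 0)⁻¹ * (e 3)⁻¹ * e 4)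
    (by simp only [map_add, map_mul, map_inv₀, σ0, σ3, σ4, inv_neg, inv_inv]; ring)
    (by simp only [map_add, map_mul, map_inv₀, τ0, τ3, τ4, inv_neg, inv_inv]; ring) ⟨σ, trivial⟩
    (by intro ρ hρ; simp only [map_add, map_mul, map_inv₀, ρ0 ρ hρ, ρ3 ρ hρ, ρ4 ρ hρ])
    ((((((h.int 0).mul (h.int 3)).mul (h.int 4)).add (((h.int 0).mul i3).mul i4)).add ((i0.mul (h.int 3)).mul i4)).add ((i0.mul i3).mul (h.int 4)))
  have tpos : ∀ (i : Fin 7) (t : ℤ), e i - (e i)⁻¹ = t → 0 < t := by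
    intro i t ht
    have h1 := congrArg φ ht
    have h2 := h.gt i
    simp only [map_sub, map_inv₀, map_intCast] at h1
    have h3 : (φ (e i))⁻¹ < 1 := inv_lt_one_of_one_lt₀ h2
    have : (0 : ℝ) < t := by rw [← h1]; linarith
    exact_mod_cast this
  refine ⟨T, tB, tC, tpos 3 tB hB, tpos 4 tC hC, hB, hC, ?_, hT⟩
  have h0 := hn 0
  have ha := h.ka.sqa
  field_simp
  rw [h.e0]
  linear_combination ha
end UD
end

section
open NumberField Module NumberField.Units
set_option linter.unusedSectionVars false
set_option linter.unusedVariables false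

namespace KA
variable {q r s Q Q' : ℕ} [hqf : Fact q.Prime] [hrf : Fact r.Prime] [hsf : Fact s.Prime]
variable {K : Type*} [Field K] [NumberField K] {a b b' c : K} {φ : K →+* ℝ}

lemma par (h : KA q r s Q Q' a b b' c φ) (n : ℕ) (hn : n ≠ 0) (x : K) (hx : x ^ 2 = n) (p : ℕ) (hp : p.Prime) (hpd : ¬ p ∣ 2 * q * r * s) :
    Even (n.factorization p) := by
  obtain ⟨t, y, h1, -⟩ := h.kf.rat_sq (n : ℚ) x (by rw [hx]; simp)
  set M : ℕ := ∏ i, (![2, Q, r * s] : Fin 3 → ℕ) i ^ (t i).val with hM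
  have hQ : Q ∣ 2 * q * r * s := by
    have := h.ar.dN_dvd 1
    simpa [Ar.dN] using this
  have hrs : r * s ∣ 2 * q * r * s := ⟨2 * q, by ring⟩
  have h2 : ¬ p ∣ M := by
    intro hd
    rw [hM, hp.prime.dvd_finset_prod_iff] at hd
    obtain ⟨i, -, hi⟩ := hd
    have := hp.dvd_of_dvd_pow hi
    apply hpd
    fin_cases i
    · exact dvd_trans this ⟨q * r * s, by simp; ring⟩
    · exact dvd_trans this hQ
    · exact dvd_trans this hrs
  have hM0 : M ≠ 0 := fun h0 => h2 (by rw [h0]; exact dvd_zero p)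
  have h3 : IsSquare (((n * M : ℕ) : ℚ)) := ⟨y, by rw [← sq, ← h1, hM]; push_cast; rfl⟩
  rw [Rat.isSquare_natCast_iff] at h3
  obtain ⟨z, hz⟩ := h3
  have hz0 : z ≠ 0 := by
    rintro rfl
    exact mul_ne_zero hn hM0 (by simpa using hz)
  have h4 := congrArg (fun n => n.factorization p) hz
  simp only [Nat.factorization_mul hn hM0, Nat.factorization_mul hz0 hz0, Finsupp.add_apply, Nat.factorization_eq_zero_of_not_dvd h2] at h4
  exact ⟨_, by simpa using h4⟩

lemma sq_div (h : KA q r s Q Q' a b b' c φ) (m : ℕ) (hm : m ∣ 2 * q * r * s) (w z : K) (hz : z ^ 2 = m * w) : ∃ z' : K, z' ^ 2 = w ∨ z' ^ 2 = r * w := by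
  obtain ⟨M0, c0, e0, h1, h2, h3, h4⟩ := h.ar.divisors hm
  have hr : (r : K) ≠ 0 := by exact_mod_cast hrf.out.ne_zero
  have hs : (s : K) ≠ 0 := by exact_mod_cast hsf.out.ne_zero
  have hM : ∃ μ : K, μ ≠ 0 ∧ μ ^ 2 = M0 := by
    rcases h1 with h1 | h1 | h1 | h1
    · exact ⟨1, one_ne_zero, by rw [h1]; simp⟩
    · exact ⟨b, h.X_ne 1, by rw [h1, h.sqb]⟩
    · exact ⟨a, h.X_ne 0, by rw [h1, h.sqa]; simp⟩
    · exact ⟨b', h.X_ne 2, by rw [h1, h.b2]⟩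
  obtain ⟨μ, hμ, hμ2⟩ := hM
  have hc : c ≠ 0 := h.X_ne 3
  have hc2 := h.sqc
  have hz2 : (z / μ) ^ 2 = r ^ c0 * s ^ e0 * w := by
    rw [div_pow, hz, h4]
    push_cast
    rw [← hμ2]
    field_simp
  rcases h2 with rfl | rfl <;> rcases h3 with rfl | rfl
  · exact ⟨z / μ, Or.inl (by rw [hz2]; ring)⟩
  · exact ⟨z / μ * c / s, Or.inr (by rw [div_pow, mul_pow, hz2, hc2]; field_simp)⟩
  · exact ⟨z / μ, Or.inr (by rw [hz2]; ring)⟩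
  · exact ⟨z / μ / c, Or.inl (by rw [div_pow, hz2, hc2]; field_simp)⟩
end KA

namespace UD
variable {q r s Q Q' : ℕ} [hqf : Fact q.Prime] [hrf : Fact r.Prime] [hsf : Fact s.Prime]
variable {K : Type*} [Field K] [NumberField K] {a b b' c : K} {φ : K →+* ℝ} {e : Fin 7 → K} {N : Fin 7 → ℤ}

/-- the square root of `r e₅` -/
lemma s5' (h : UD q r s Q Q' a b b' c φ e N) : ∃ x : K, x ^ 2 = r * e 5 := by
  have hs : (s : K) ≠ 0 := by exact_mod_cast hsf.out.ne_zero
  rcases h.s5 with ⟨x, y, h1⟩ | ⟨x, y, h1⟩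
  · exact ⟨_, h1⟩
  · exact ⟨((x : K) + y * (b * c)) * c / s, by rw [div_pow, mul_pow, h1, h.ka.sqc]; field_simp⟩

lemma theta (h : UD q r s Q Q' a b b' c φ e N) (h3 : N 3 = -1) : ∃ (θ : K) (J : ℕ), (J = 0 ∨ J = 1) ∧ θ ^ 2 = e 0 * e 3 * e 4 * e 5 ^ J := by
  obtain ⟨T, tB, tC, hB0, hC0, hB, hC, hA, hT⟩ := h.trip h3
  have nA := h.e_ne 0
  have nB := h.e_ne 3
  have nC := h.e_ne 4
  have hr : (r : K) ≠ 0 := by exact_mod_cast hrf.out.ne_zero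
  have gA := h.gt 0
  have gB := h.gt 3
  have gC := h.gt 4
  have fA := congrArg φ hA
  have fB := congrArg φ hB
  have fC := congrArg φ hC
  simp only [map_sub, map_inv₀, map_intCast, map_ofNat] at fA fB fC
  have key : ∀ α β γ : ℤ, α * β = -γ → β * γ = -α → α * γ = -β → α * α = 1 → β * β = 1 → γ * γ = 1 → (e 0 * e 3 * e 4 + α * e 0 + β * e 3 + γ * e 4) ^ 2
      = ((T + 4 * α + 2 * β * tB + 2 * γ * tC : ℤ) : K) * (e 0 * e 3 * e 4) := by
    intro α β γ h1 h2 h3 h4 h5 h6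
    push_cast
    rw [← hT, ← hB, ← hC]
    have e2 : (4 : K) * α = 2 * α * (e 0 - (e 0)⁻¹) := by rw [hA]; ring
    rw [e2]
    have h1' : (α : K) * β = -γ := by exact_mod_cast h1
    have h2' : (β : K) * γ = -α := by exact_mod_cast h2
    have h3' : (α : K) * γ = -β := by exact_mod_cast h3
    have h4' : (α : K) * α = 1 := by exact_mod_cast h4
    have h5' : (β : K) * β = 1 := by exact_mod_cast h5
    have h6' : (γ : K) * γ = 1 := by exact_mod_cast h6
    field_simp
    linear_combination 2 * e 0 * e 3 * h1' + 2 * e 3 * e 4 * h2' + 2 * e 0 * e 4 * h3' + (e 0) ^ 2 * h4' + (e 3) ^ 2 * h5' + (e 4) ^ 2 * h6'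
  generalize hxA : φ (e 0) = A at *
  generalize hxB : φ (e 3) = B at *
  generalize hxC : φ (e 4) = C at *
  have big : ∀ (x : ℝ) (t : ℤ), 0 < t → 1 < x → x - x⁻¹ = t → 8 / 5 < x := by
    intro x t ht hx hxt
    have h1 : (1 : ℝ) ≤ t := by exact_mod_cast ht
    have h2 : x * x⁻¹ = 1 := mul_inv_cancel₀ (by linarith)
    nlinarith
  have bA : 12 / 5 < A := by
    have h2 : A * A⁻¹ = 1 := mul_inv_cancel₀ (by linarith)
    nlinarith
  have bB := big B tB hB0 gB fB
  have bC := big C tC hC0 gC fC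
  have hBC : 0 < (B - 8 / 5) * (C - 8 / 5) := mul_pos (by linarith) (by linarith)
  have hBC1 : 1 < B * C := by nlinarith
  have hABC : 12 / 5 * (B * C) < A * (B * C) := by nlinarith
  have hAB : 1 < A * B := by nlinarith
  have hABC2 : C < A * B * C := by nlinarith
  have hAC : 1 < A * C := by nlinarith
  have hABC3 : B < A * B * C := by nlinarith
  have hABC4 : A < A * B * C := by nlinarith
  have pos : ∀ (α β γ : ℤ) (n : ℤ), 0 < A * B * C + α * A + β * B + γ * C → (e 0 * e 3 * e 4 + α * e 0 + β * e 3 + γ * e 4) ^ 2 = (n : K) * (e 0 * e 3 * e 4) → 0 < n := by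
    intro α β γ n h1 h2
    have h5 := congrArg φ h2
    simp only [map_pow, map_mul, map_add, map_intCast, hxA, hxB, hxC] at h5
    have h6 := pow_pos h1 2
    rw [h5] at h6
    have h7 : 0 < A * B * C := by positivity
    have := pos_of_mul_pos_left h6 h7.le
    exact_mod_cast this
  have k1 := key (-1) (-1) (-1) (by norm_num) (by norm_num) (by norm_num) (by norm_num) (by norm_num) (by norm_num)
  have k2 := key (-1) 1 1 (by norm_num) (by norm_num) (by norm_num) (by norm_num) (by norm_num) (by norm_num)
  have k3 := key 1 (-1) 1 (by norm_num) (by norm_num) (by norm_num) (by norm_num) (by norm_num) (by norm_num)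
  have k4 := key 1 1 (-1) (by norm_num) (by norm_num) (by norm_num) (by norm_num) (by norm_num) (by norm_num)
  have p1 := pos (-1) (-1) (-1) _ (by push_cast; nlinarith) k1
  have p2 := pos (-1) 1 1 _ (by push_cast; nlinarith) k2
  have p3 := pos 1 (-1) 1 _ (by push_cast; nlinarith) k3
  have p4 := pos 1 1 (-1) _ (by push_cast; nlinarith) k4
  have hsum : (T + 4 * (-1) + 2 * (-1) * tB + 2 * (-1) * tC) + (T + 4 * (-1) + 2 * 1 * tB + 2 * 1 * tC) - (T + 4 * 1 + 2 * (-1) * tB + 2 * 1 * tC)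
    - (T + 4 * 1 + 2 * 1 * tB + 2 * (-1) * tC) = -16 := by ring
  generalize T + 4 * (-1) + 2 * (-1) * tB + 2 * (-1) * tC = n1 at *
  generalize T + 4 * (-1) + 2 * 1 * tB + 2 * 1 * tC = n2 at *
  generalize T + 4 * 1 + 2 * (-1) * tB + 2 * 1 * tC = n3 at *
  generalize T + 4 * 1 + 2 * 1 * tB + 2 * (-1) * tC = n4 at *
  generalize e 0 * e 3 * e 4 + ((-1 : ℤ) : K) * e 0 + ((-1 : ℤ) : K) * e 3 + ((-1 : ℤ) : K) * e 4 = S1 at *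
  generalize e 0 * e 3 * e 4 + ((-1 : ℤ) : K) * e 0 + ((1 : ℤ) : K) * e 3 + ((1 : ℤ) : K) * e 4 = S2 at *
  generalize e 0 * e 3 * e 4 + ((1 : ℤ) : K) * e 0 + ((-1 : ℤ) : K) * e 3 + ((1 : ℤ) : K) * e 4 = S3 at *
  generalize e 0 * e 3 * e 4 + ((1 : ℤ) : K) * e 0 + ((1 : ℤ) : K) * e 3 + ((-1 : ℤ) : K) * e 4 = S4 at *
  have hw : e 0 * e 3 * e 4 ≠ 0 := mul_ne_zero (mul_ne_zero nA nB) nC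
  generalize hwd : e 0 * e 3 * e 4 = w at *
  lift n1 to ℕ using p1.le
  lift n2 to ℕ using p2.le
  lift n3 to ℕ using p3.le
  lift n4 to ℕ using p4.le
  obtain ⟨m, k, hmk, hsf⟩ := Nat.sq_mul_squarefree n2
  have hn2 : n2 ≠ 0 := by rintro rfl; simp at p2
  have hm0 : m ≠ 0 := hsf.ne_zero
  have hk0 : k ≠ 0 := by rintro rfl; simp at hmk; exact hn2 hmk.symm
  have hdv : ∀ p : ℕ, p.Prime → p ∣ m → ¬ p ∣ 2 * q * r * s → ∀ (n : ℕ) (S : K), n ≠ 0 → S ^ 2 = ((n : ℤ) : K) * w → p ∣ n := by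
    intro p hp hpm hpd n S hn hS
    have h1 := h.ka.par (n2 * n) (mul_ne_zero hn2 hn) (S2 * S / w) (by
      rw [div_pow, mul_pow, hS, k2]
      push_cast
      field_simp) p hp hpd
    rw [← hmk, Nat.factorization_mul (by rw [hmk]; exact hn2) hn, Nat.factorization_mul (by positivity) hm0, Nat.factorization_pow] at h1
    simp only [Finsupp.add_apply, Finsupp.smul_apply, smul_eq_mul] at h1
    have h2 : m.factorization p = 1 := by
      have h3 := (Nat.squarefree_iff_factorization_le_one hm0).mp hsf p
      have h4 := (hp.dvd_iff_one_le_factorization hm0).mp hpm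
      omega
    rw [h2] at h1
    rw [hp.dvd_iff_one_le_factorization hn]
    obtain ⟨j, hj⟩ := h1
    omega
  have hmd : m ∣ 2 * q * r * s := by
    rw [← Nat.prod_primeFactors_of_squarefree hsf, ← Nat.prod_primeFactors_of_squarefree h.ka.ar.sf2qrs]
    apply Finset.prod_dvd_prod_of_subset
    intro p hp
    have hp1 := Nat.prime_of_mem_primeFactors hp
    have hp2 := Nat.dvd_of_mem_primeFactors hp
    rw [Nat.mem_primeFactors]
    refine ⟨hp1, ?_, h.ka.ar.sf2qrs.ne_zero⟩
    by_contra hpd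
    have d1 := hdv p hp1 hp2 hpd n1 S1 (by rintro rfl; simp at p1) k1
    have d2 : p ∣ n2 := by rw [← hmk]; exact dvd_mul_of_dvd_right hp2 _
    have d3 := hdv p hp1 hp2 hpd n3 S3 (by rintro rfl; simp at p3) k3
    have d4 := hdv p hp1 hp2 hpd n4 S4 (by rintro rfl; simp at p4) k4
    have d5 : (p : ℤ) ∣ -16 := by
      rw [← hsum]
      exact dvd_sub (dvd_sub (dvd_add (by exact_mod_cast d1) (by exact_mod_cast d2)) (by exact_mod_cast d3)) (by exact_mod_cast d4)
    have d6 : p ∣ 2 ^ 4 := by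
      rw [dvd_neg] at d5
      exact_mod_cast d5
    have d7 := hp1.dvd_of_dvd_pow d6
    exact hpd (dvd_trans d7 ⟨q * r * s, by ring⟩)
  have hkK : (k : K) ≠ 0 := by exact_mod_cast hk0
  obtain ⟨z, hz⟩ := h.ka.sq_div m hmd w (S2 / k) (by
    rw [div_pow, k2, ← hmk]
    push_cast
    field_simp)
  rcases hz with hz | hz
  · exact ⟨z, 0, Or.inl rfl, by rw [hz]; simp⟩
  · obtain ⟨x, hx⟩ := h.s5'
    exact ⟨z * x / r, 1, Or.inr rfl, by rw [div_pow, mul_pow, hz, hx]; field_simp⟩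
end UD
end

section
open NumberField Module NumberField.Units
set_option linter.unusedSectionVars false
set_option linter.unusedVariables false

namespace KA
variable {q r s Q Q' : ℕ} [hqf : Fact q.Prime] [hrf : Fact r.Prime] [hsf : Fact s.Prime]
variable {K : Type*} [Field K] [NumberField K] {a b b' c : K} {φ : K →+* ℝ}

lemma r_ns (h : KA q r s Q Q' a b b' c φ) (x : K) (hx : x ^ 2 = r) : False := by
  obtain ⟨t, y, h1, -⟩ := h.kf.rat_sq (r : ℚ) x (by rw [hx]; simp)
  have hr := hrf.out
  have hs := hsf.out
  have hq := hqf.out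
  have r8 := h.ar.r8
  have s8 := h.ar.s8
  have hQ0 : Q ≠ 0 := by
    have := h.ar.dN_gt 1
    simp [Ar.dN] at this
    omega
  rw [Fin.prod_univ_three] at h1
  generalize (t 0).val = i at h1
  generalize (t 1).val = j at h1
  generalize (t 2).val = k at h1
  have h3 : IsSquare (((r * (2 ^ i * Q ^ j * (r * s) ^ k) : ℕ) : ℚ)) := ⟨y, by rw [← sq, ← h1]; simp⟩
  rw [Rat.isSquare_natCast_iff] at h3
  obtain ⟨z, hz⟩ := h3
  have hz0 : z ≠ 0 := by
    rintro rfl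
    have : r * (2 ^ i * Q ^ j * (r * s) ^ k) ≠ 0 := by
      have := hr.ne_zero
      have := hs.ne_zero
      positivity
    exact this (by simpa using hz)
  have key : ∀ p : ℕ, p.Prime → p % 8 = 5 → p ≠ q → r.factorization p + k * (r.factorization p + s.factorization p) = 2 * z.factorization p := by
    intro p hp hp8 hpq
    have h4 := congrArg (fun n => n.factorization p) hz
    have n1 : (2 : ℕ).factorization p = 0 := Nat.factorization_eq_zero_of_not_dvd (by
      intro hd
      have := (Nat.prime_dvd_prime_iff_eq hp Nat.prime_two).mp hd
      omega)
    have n2 : Q.factorization p = 0 := Nat.factorization_eq_zero_of_not_dvd (by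
      intro hd
      have : p ∣ 2 * q := by
        rcases h.ar.hQ with ⟨h, -⟩ | ⟨h, -⟩ <;> rw [h] at hd
        · exact dvd_mul_of_dvd_right hd 2
        · exact hd
      rcases hp.dvd_mul.mp this with h | h
      · have := (Nat.prime_dvd_prime_iff_eq hp Nat.prime_two).mp h
        omega
      · exact hpq ((Nat.prime_dvd_prime_iff_eq hp hq).mp h))
    have hr0 := hr.ne_zero
    have hs0 := hs.ne_zero
    have m1 : 2 ^ i * Q ^ j ≠ 0 := by positivity
    have m2 : 2 ^ i * Q ^ j * (r * s) ^ k ≠ 0 := by positivity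
    simp only [Nat.factorization_mul hr0 m2, Nat.factorization_mul m1 (pow_ne_zero k (mul_ne_zero hr0 hs0)), Nat.factorization_mul (pow_ne_zero i two_ne_zero) (pow_ne_zero j hQ0),
      Nat.factorization_pow, Nat.factorization_mul hr0 hs0, Nat.factorization_mul hz0 hz0, Finsupp.add_apply, Finsupp.smul_apply, n1, n2, smul_eq_mul] at h4
    linarith
  have k1 := key r hr r8 (Ne.symm h.ar.qr)
  have k2 := key s hs s8 (Ne.symm h.ar.qs)
  have f1 : r.factorization s = 0 := Nat.factorization_eq_zero_of_not_dvd (fun hd => h.ar.rs ((Nat.prime_dvd_prime_iff_eq hs hr).mp hd).symm)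
  have f2 : s.factorization r = 0 := Nat.factorization_eq_zero_of_not_dvd (fun hd => h.ar.rs ((Nat.prime_dvd_prime_iff_eq hr hs).mp hd))
  rw [hr.factorization_self, f2] at k1
  rw [hs.factorization_self, f1] at k2
  omega
end KA

/-- the improved system of units -/
structure UB (q r s Q Q' : ℕ) [Fact q.Prime] [Fact r.Prime] [Fact s.Prime] {K : Type*} [Field K] [NumberField K] (a b b' c : K) (φ : K →+* ℝ)
    (e : Fin 7 → K) (N : Fin 7 → ℤ) (α β θ ζ : K) (I J : ℕ) : Prop where
  ud : UD q r s Q Q' a b b' c φ e N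
  a2 : α ^ 2 = e 1
  b2 : β ^ 2 = e 2
  z2 : ζ ^ 2 = e 6
  t2 : θ ^ 2 = e 3 * (e 0 * e 4) ^ I * e 5 ^ J
  a1 : ∀ σ : Gal(K/ℚ), KA.sv a b c σ = ![1, 0, 0] → σ α = - α
  b1 : ∀ σ : Gal(K/ℚ), KA.sv a b c σ = ![1, 1, 0] → σ β = - β
  z1 : ∀ σ : Gal(K/ℚ), KA.sv a b c σ = ![1, 1, 0] → σ ζ = - ζ
  z1' : ∀ σ : Gal(K/ℚ), KA.sv a b c σ = ![0, 1, 1] → σ ζ = - ζ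
  cs : (N 3 = 1 ∧ I = 0 ∧ J = 1 ∧ ∀ σ : Gal(K/ℚ), KA.sv a b c σ = ![1, 0, 0] → σ θ = θ) ∨ (N 3 = -1 ∧ I = 1)

namespace UD
variable {q r s Q Q' : ℕ} [hqf : Fact q.Prime] [hrf : Fact r.Prime] [hsf : Fact s.Prime]
variable {K : Type*} [Field K] [NumberField K] {a b b' c : K} {φ : K →+* ℝ} {e : Fin 7 → K} {N : Fin 7 → ℤ}

lemma exists_UB (h : UD q r s Q Q' a b b' c φ e N) : ∃ α β θ ζ I J, UB q r s Q Q' a b b' c φ e N α β θ ζ I J := by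
  obtain ⟨x1, y1, h1⟩ := h.s1
  obtain ⟨x2, y2, h2⟩ := h.s2
  obtain ⟨x6, y6, h6⟩ := h.s6
  have ka := h.ka
  have sa := ka.sqa
  have sb := ka.sqb
  have na : a ≠ 0 := ka.X_ne 0
  have nb : b ≠ 0 := ka.X_ne 1
  have nc : c ≠ 0 := ka.X_ne 3
  have hr : (r : K) ≠ 0 := by exact_mod_cast hrf.out.ne_zero
  have hs : (s : K) ≠ 0 := by exact_mod_cast hsf.out.ne_zero
  have sg2 : sg ((![1, 1, 0] : Fin 3 → ZMod 2) 0 + (![1, 1, 0] : Fin 3 → ZMod 2) 1) = 1 := by decide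
  have main : ∀ θ I J, θ ^ 2 = e 3 * (e 0 * e 4) ^ I * e 5 ^ J → ((N 3 = 1 ∧ I = 0 ∧ J = 1 ∧ ∀ σ : Gal(K/ℚ), KA.sv a b c σ = ![1, 0, 0] → σ θ = θ) ∨ (N 3 = -1 ∧ I = 1)) →
      ∃ α β θ ζ I J, UB q r s Q Q' a b b' c φ e N α β θ ζ I J := by
    intro θ I J ht hc
    refine ⟨(x1 + y1 * b) / a, (x2 + y2 * b') / a, θ, (x6 + y6 * (b' * c)) / b, I, J, h, ?_, ?_, ?_, ht, ?_, ?_, ?_, ?_, hc⟩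
    · rw [div_pow, h1, sa]; field_simp
    · rw [div_pow, h2, sa]; field_simp
    · rw [div_pow, h6, sb]
      have : (Q : K) ≠ 0 := by rw [← sb]; positivity
      field_simp
    · intro σ hσ
      simp only [map_div₀, map_add, map_mul, map_ratCast, ka.map_a, ka.map_b, hσ]
      simp [sg]; ring
    · intro σ hσ
      simp only [map_div₀, map_add, map_mul, map_ratCast, ka.map_a, ka.map_b', hσ]
      rw [sg2]
      simp [sg]; ring
    · intro σ hσ
      simp only [map_div₀, map_add, map_mul, map_ratCast, ka.map_c, ka.map_b', ka.map_b, hσ]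
      rw [sg2]
      simp [sg]; ring
    · intro σ hσ
      simp only [map_div₀, map_add, map_mul, map_ratCast, ka.map_c, ka.map_b', ka.map_b, hσ]
      simp [sg]; ring
  rcases h.N3 with h3 | h3
  · obtain ⟨x3, y3, h3'⟩ := h.s3 h3
    have h5 : ∃ x : K, x ^ 2 = r * e 5 ∧ ∀ σ : Gal(K/ℚ), KA.sv a b c σ = ![1, 0, 0] → σ x = x := by
      rcases h.s5 with ⟨x, y, h1⟩ | ⟨x, y, h1⟩
      · refine ⟨_, h1, ?_⟩
        intro σ hσ
        simp only [map_add, map_mul, map_ratCast, ka.map_c, ka.map_b, hσ]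
        simp [sg]
      · refine ⟨((x : K) + y * (b * c)) * c / s, by rw [div_pow, mul_pow, h1, h.ka.sqc]; field_simp, ?_⟩
        intro σ hσ
        simp only [map_div₀, map_add, map_mul, map_ratCast, map_natCast, ka.map_c, ka.map_b, hσ]
        simp [sg]
    obtain ⟨x, hx, hx'⟩ := h5
    refine main ((x3 + y3 * c) * x / r) 0 1 ?_ (Or.inl ⟨h3, rfl, rfl, ?_⟩)
    · rw [div_pow, mul_pow, h3', hx]; field_simp
    · intro σ hσ
      simp only [map_div₀, map_add, map_mul, map_ratCast, map_natCast, ka.map_c, hx' σ hσ, hσ]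
      simp [sg]
  · obtain ⟨θ, J, hJ, ht⟩ := h.theta h3
    exact main θ 1 J (by rw [ht]; ring) (Or.inr ⟨h3, rfl⟩)
end UD

/-- being plus or minus one -/
def PM {K : Type*} [Field K] (x : K) : Prop := x = 1 ∨ x = -1

namespace PM
variable {K : Type*} [Field K]
lemma one : PM (1 : K) := Or.inl rfl
lemma mul {x y : K} (hx : PM x) (hy : PM y) : PM (x * y) := by
  rcases hx with rfl | rfl <;> rcases hy with rfl | rfl <;> simp [PM]
lemma pow {x : K} (hx : PM x) (n : ℕ) : PM (x ^ n) := by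
  induction n with
  | zero => simp [PM]
  | succ n ih => rw [pow_succ]; exact ih.mul hx
lemma of_sq {x y : K} (hy : y ≠ 0) (h : x ^ 2 = y ^ 2) : PM (x / y) := by
  rcases sq_eq_sq_iff_eq_or_eq_neg.mp h with h | h
  · left; rw [h, div_self hy]
  · right; rw [h, neg_div, div_self hy]
lemma of_sq_one {x : K} (h : x ^ 2 = 1) : PM x := by
  have := of_sq (y := (1 : K)) one_ne_zero (by simpa using h)
  simpa using this
lemma ne {x : K} (h : PM x) : x ≠ 0 := by rcases h with rfl | rfl <;> simp
lemma sq {x : K} (h : PM x) : x * x = 1 := by rcases h with rfl | rfl <;> simp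
lemma ofZ {n : ℤ} (h : n = 1 ∨ n = -1) : PM (n : K) := by rcases h with rfl | rfl <;> simp [PM]
lemma pos [NumberField K] {p y z : K} (hp : PM p) (φ : K →+* ℝ) (hz : z ≠ 0) (h : y ^ 2 = p * z ^ 2) : p = 1 ∧ (y = z ∨ y = - z) := by
  rcases hp with rfl | rfl
  · refine ⟨rfl, sq_eq_sq_iff_eq_or_eq_neg.mp (by rw [h, one_mul])⟩
  · exact (UD.neg_sq y z φ hz (by rw [h]; ring)).elim
end PM
end

section
open NumberField Module NumberField.Units
set_option linter.unusedSectionVars false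
set_option linter.unusedVariables false

lemma PM.neg1 {K : Type*} [Field K] : PM (-1 : K) := Or.inr rfl

namespace UB
variable {q r s Q Q' : ℕ} [hqf : Fact q.Prime] [hrf : Fact r.Prime] [hsf : Fact s.Prime]
variable {K : Type*} [Field K] [NumberField K] {a b b' c : K} {φ : K →+* ℝ} {e : Fin 7 → K} {N : Fin 7 → ℤ} {α β θ ζ : K} {I J : ℕ}

lemma core (h : UB q r s Q Q' a b b' c φ e N α β θ ζ I J) (x δ : K) (hδ : PM δ) (n0 n1 n2 n3 n4 n5 n6 : ℕ)
    (hn0 : n0 ≤ 1) (hn1 : n1 ≤ 1) (hn2 : n2 ≤ 1) (hn3 : n3 ≤ 1) (hn4 : n4 ≤ 1) (hn5 : n5 ≤ 1) (hn6 : n6 ≤ 1)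
    (hx : x ^ 2 = δ * (e 0 ^ n0 * α ^ n1 * β ^ n2 * θ ^ n3 * e 4 ^ n4 * e 5 ^ n5 * ζ ^ n6)) :
    n0 = 0 ∧ n1 = 0 ∧ n2 = 0 ∧ n3 = 0 ∧ n4 = 0 ∧ n5 = 0 ∧ n6 = 0 := by
  have ud := h.ud
  have ka := ud.ka
  have ne := ud.e_ne
  have nα : α ≠ 0 := by rintro rfl; exact ne 1 (by rw [← h.a2]; simp)
  have nβ : β ≠ 0 := by rintro rfl; exact ne 2 (by rw [← h.b2]; simp)
  have nζ : ζ ≠ 0 := by rintro rfl; exact ne 6 (by rw [← h.z2]; simp)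
  have nθ : θ ≠ 0 := by
    rintro rfl
    have h1 := h.t2
    have := ne 0
    have := ne 3
    have := ne 4
    have := ne 5
    have : e 3 * (e 0 * e 4) ^ I * e 5 ^ J ≠ 0 := by positivity
    exact this (by rw [← h1]; simp)
  obtain ⟨g1, hg1⟩ := ka.exists_aut ![1, 0, 0]
  obtain ⟨g2, hg2⟩ := ka.exists_aut ![1, 1, 0]
  obtain ⟨g3, hg3⟩ := ka.exists_aut ![0, 1, 1]
  obtain ⟨τ, hτ⟩ := ka.exists_aut ![0, 0, 1]
  have inv : ∀ (g : Gal(K/ℚ)) (z : K), g (z * g z) = z * g z := by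
    intro g z
    have h1 : g (g z) = z := by
      have := congrArg (fun σ : Gal(K/ℚ) => σ z) (ka.kf.sq_one g)
      simpa using this
    rw [map_mul, h1, mul_comm]
  have pmσ : ∀ (g : Gal(K/ℚ)), g δ = δ := by
    intro g
    rcases hδ with h | h <;> rw [h] <;> simp
  -- generic expansion
  have ex : ∀ g : Gal(K/ℚ), (x * g x) ^ 2 = (e 0 * g (e 0)) ^ n0 * (α * g α) ^ n1 * (β * g β) ^ n2 * (θ * g θ) ^ n3 * (e 4 * g (e 4)) ^ n4
      * (e 5 * g (e 5)) ^ n5 * (ζ * g ζ) ^ n6 := by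
    intro g
    rw [mul_pow, ← map_pow, hx]
    simp only [map_mul, map_pow, pmσ, mul_pow]
    linear_combination (e 0 ^ n0 * α ^ n1 * β ^ n2 * θ ^ n3 * e 4 ^ n4 * e 5 ^ n5 * ζ ^ n6) * ((g (e 0)) ^ n0 * (g α) ^ n1 * (g β) ^ n2 * (g θ) ^ n3 * (g (e 4)) ^ n4 * (g (e 5)) ^ n5 * (g ζ) ^ n6) * hδ.sq
  have mv : ∀ (i : Fin 7) (g : Gal(K/ℚ)), ch i (KA.sv a b c g) = 1 → PM (e i * g (e i)) := by
    intro i g hg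
    rw [ud.conj1 i g hg]
    exact PM.ofZ (ud.N_pm i)
  have mvr : ∀ (i : Fin 7) (g : Gal(K/ℚ)) (z : K), z ^ 2 = e i → N i = 1 → ch i (KA.sv a b c g) = 1 → PM (z * g z) := by
    intro i g z hz hN hg
    apply PM.of_sq_one
    rw [mul_pow, ← map_pow, hz, ud.conj1 i g hg, hN]
    simp
  have fx := ud.conj0
  -- step 1
  have c10 : ch 0 (KA.sv a b c g1) = 1 := by rw [hg1]; decide
  have c11 : ch 1 (KA.sv a b c g1) = 0 := by rw [hg1]; decide
  have c12 : ch 2 (KA.sv a b c g1) = 1 := by rw [hg1]; decide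
  have c13 : ch 3 (KA.sv a b c g1) = 0 := by rw [hg1]; decide
  have c14 : ch 4 (KA.sv a b c g1) = 1 := by rw [hg1]; decide
  have c15 : ch 5 (KA.sv a b c g1) = 0 := by rw [hg1]; decide
  have c16 : ch 6 (KA.sv a b c g1) = 1 := by rw [hg1]; decide
  have e1 := ex g1
  rw [h.a1 g1 hg1, fx 5 g1 c15] at e1
  have hα : α * -α = (-1) * e 1 := by rw [← h.a2]; ring
  rw [hα] at e1
  have red1 : ∀ z p : K, PM p → g1 z = z → z ^ 2 = p * e 1 ^ n1 → n1 = 0 := by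
    intro z p hp hz h1
    by_contra hn
    have hn : n1 = 1 := by omega
    rw [hn, pow_one, ← h.a2] at h1
    obtain ⟨-, h2⟩ := hp.pos φ nα h1
    have ha := h.a1 g1 hg1
    have : α = - α := by
      rcases h2 with h2 | h2
      · rw [h2, ha] at hz; exact hz.symm
      · rw [h2, map_neg, ha] at hz
        rw [neg_neg] at hz
        exact hz
    have h3 : 2 * α = 0 := by linear_combination this
    simp at h3
    exact nα h3
  have P1 : PM ((e 0 * g1 (e 0)) ^ n0 * (-1) ^ n1 * (β * g1 β) ^ n2 * (e 4 * g1 (e 4)) ^ n4 * (ζ * g1 ζ) ^ n6) :=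
    (((((mv 0 g1 c10).pow n0).mul (PM.neg1.pow n1)).mul ((mvr 2 g1 β h.b2 ud.N2 c12).pow n2)).mul ((mv 4 g1 c14).pow n4)).mul
      ((mvr 6 g1 ζ h.z2 ud.N6 c16).pow n6)
  have hθn : N 3 = -1 → n3 = 0 := by
    intro hN
    have hI : I = 1 := by
      rcases h.cs with ⟨h1, -⟩ | ⟨-, h1⟩
      · rw [hN] at h1; norm_num at h1
      · exact h1
    by_contra hn
    have hn : n3 = 1 := by omega
    have hp : PM ((θ * g1 θ) / (e 3 * e 5 ^ J)) := by
      apply PM.of_sq (by have := ne 3; have := ne 5; positivity)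
      rw [mul_pow, ← map_pow, h.t2, hI]
      simp only [map_mul, map_pow, fx 3 g1 c13, fx 5 g1 c15, pow_one]
      have k0 := ud.conj1 0 g1 c10
      have k4 := ud.conj1 4 g1 c14
      rw [ud.N0] at k0
      rw [ud.N4] at k4
      push_cast at k0 k4
      linear_combination (e 3 * e 5 ^ J) ^ 2 * (e 4 * g1 (e 4) * k0 - k4)
    have hθ' : θ * g1 θ = ((θ * g1 θ) / (e 3 * e 5 ^ J)) * (e 3 * e 5 ^ J) := by
      have := ne 3
      have := ne 5
      field_simp
    generalize (θ * g1 θ) / (e 3 * e 5 ^ J) = p at hp hθ'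
    rw [hθ', hn] at e1
    generalize x * g1 x = y at e1
    have e1' : y ^ 2 = ((e 0 * g1 (e 0)) ^ n0 * (-1) ^ n1 * (β * g1 β) ^ n2 * (e 4 * g1 (e 4)) ^ n4 * (ζ * g1 ζ) ^ n6 * p) * (e 1 ^ n1 * e 3 * (e 5 ^ (n5 + J) * e 5 ^ n5)) := by
      rw [e1]; ring
    have P2 := P1.mul hp
    generalize (e 0 * g1 (e 0)) ^ n0 * (-1) ^ n1 * (β * g1 β) ^ n2 * (e 4 * g1 (e 4)) ^ n4 * (ζ * g1 ζ) ^ n6 * p = P at e1' P2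
    have Pτ : τ P = P := by rcases P2 with h | h <;> rw [h] <;> simp
    apply UD.neg_sq (y * τ y) (e 1 ^ n1) φ (pow_ne_zero _ (ne 1))
    rw [mul_pow, ← map_pow, e1']
    simp only [map_mul, map_pow, Pτ]
    rw [fx 1 τ (by rw [hτ]; decide)]
    have k3 := ud.conj1 3 τ (by rw [hτ]; decide)
    have k5 := ud.conj1 5 τ (by rw [hτ]; decide)
    rw [hN] at k3
    rw [ud.N5] at k5
    push_cast at k3 k5
    have k5' : (e 5 * τ (e 5)) ^ (n5 + J) * (e 5 * τ (e 5)) ^ n5 = 1 := by rw [k5]; simp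
    simp only [mul_pow] at k5'
    have hP := P2.sq
    linear_combination (e 1 ^ n1) ^ 2 * (e 3 * τ (e 3)) * (e 5 ^ (n5 + J) * (τ (e 5)) ^ (n5 + J) * (e 5 ^ n5 * (τ (e 5)) ^ n5)) * hP
      + (e 1 ^ n1) ^ 2 * (e 3 * τ (e 3)) * k5' + (e 1 ^ n1) ^ 2 * k3
  have hn1' : n1 = 0 := by
    have i1 := inv g1 x
    generalize x * g1 x = y at e1 i1
    rcases h.cs with ⟨hN, hI, hJ, hfix⟩ | ⟨hN, hI⟩
    · refine red1 (y / (θ ^ n3 * e 5 ^ n5)) _ P1 ?_ ?_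
      · simp only [map_div₀, map_mul, map_pow, i1, hfix g1 hg1, fx 5 g1 c15]
      · rw [div_pow, e1, hfix g1 hg1]
        have := ne 5
        field_simp
        ring
    · have := hθn hN
      rw [this] at e1
      refine red1 (y / e 5 ^ n5) _ P1 ?_ ?_
      · simp only [map_div₀, map_pow, i1, fx 5 g1 c15]
      · rw [div_pow, e1]
        have := ne 5
        field_simp
        ring
  subst hn1'
  -- step 2
  have c20 : ch 0 (KA.sv a b c g2) = 1 := by rw [hg2]; decide
  have c23 : ch 3 (KA.sv a b c g2) = 0 := by rw [hg2]; decide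
  have c24 : ch 4 (KA.sv a b c g2) = 1 := by rw [hg2]; decide
  have c25 : ch 5 (KA.sv a b c g2) = 1 := by rw [hg2]; decide
  have e2 := ex g2
  rw [h.b1 g2 hg2, h.z1 g2 hg2] at e2
  have P2 : PM ((e 0 * g2 (e 0)) ^ n0 * (-1) ^ n2 * (e 4 * g2 (e 4)) ^ n4 * (e 5 * g2 (e 5)) ^ n5 * (-1) ^ n6) :=
    (((((mv 0 g2 c20).pow n0).mul (PM.neg1.pow n2)).mul ((mv 4 g2 c24).pow n4)).mul ((mv 5 g2 c25).pow n5)).mul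
      (PM.neg1.pow n6)
  have hn3' : n3 = 0 := by
    rcases h.cs with ⟨hN, hI, hJ, hfix⟩ | ⟨hN, hI⟩
    · by_contra hn
      have hn : n3 = 1 := by omega
      have hp : PM ((θ * g2 θ) / e 3) := by
        apply PM.of_sq (ne 3)
        rw [mul_pow, ← map_pow, h.t2, hI, hJ]
        simp only [map_mul, map_pow, fx 3 g2 c23, pow_one, pow_zero, map_one]
        have k5 := ud.conj1 5 g2 c25
        rw [ud.N5] at k5
        push_cast at k5
        linear_combination (e 3) ^ 2 * k5
      have hθ' : θ * g2 θ = ((θ * g2 θ) / e 3) * e 3 := by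
        have := ne 3
        field_simp
      generalize (θ * g2 θ) / e 3 = p at hp hθ'
      rw [hθ', hn] at e2
      obtain ⟨u, v, huv⟩ := ud.s3 hN
      have hz : (x * g2 x) ^ 2 * r * e 3 = ((e 0 * g2 (e 0)) ^ n0 * (-1) ^ n2 * (e 4 * g2 (e 4)) ^ n4 * (e 5 * g2 (e 5)) ^ n5 * (-1) ^ n6 * p) * (β ^ n2 * ζ ^ n6 * e 3) ^ 2 * r := by
        rw [e2]; ring
      have P3 := P2.mul hp
      generalize (e 0 * g2 (e 0)) ^ n0 * (-1) ^ n2 * (e 4 * g2 (e 4)) ^ n4 * (e 5 * g2 (e 5)) ^ n5 * (-1) ^ n6 * p = P at hz P3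
      have ny : (β ^ n2 * ζ ^ n6 * e 3) ≠ 0 := by have := ne 3; positivity
      have hz2 : (x * g2 x * (u + v * c) / (β ^ n2 * ζ ^ n6 * e 3)) ^ 2 = P * r := by
        rw [div_pow, mul_pow, huv]
        rw [div_eq_iff (pow_ne_zero 2 ny)]
        linear_combination hz
      rcases P3 with h1 | h1
      · exact ka.r_ns _ (by rw [hz2, h1, one_mul])
      · have h2 := congrArg φ hz2
        rw [h1] at h2
        simp only [map_pow, map_mul, map_neg, map_one, map_natCast] at h2
        have h4 := hrf.out.pos
        have h3 : (0 : ℝ) < r := by exact_mod_cast h4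
        nlinarith [sq_nonneg (φ (x * g2 x * (u + v * c) / (β ^ n2 * ζ ^ n6 * e 3)))]
    · exact hθn hN
  subst hn3'
  have hn26 : n2 = n6 := by
    have i2 := inv g2 x
    generalize x * g2 x = y at e2 i2
    have ny : β ^ n2 * ζ ^ n6 ≠ 0 := by positivity
    obtain ⟨-, h2⟩ := P2.pos φ (y := y) (z := β ^ n2 * ζ ^ n6) ny (by rw [e2]; ring)
    have hb := h.b1 g2 hg2
    have hz := h.z1 g2 hg2
    have h3 : g2 (β ^ n2 * ζ ^ n6) = β ^ n2 * ζ ^ n6 := by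
      rcases h2 with h2 | h2
      · rw [← h2]; exact i2
      · have : β ^ n2 * ζ ^ n6 = - y := by rw [h2, neg_neg]
        rw [this, map_neg, i2]
    rw [map_mul, map_pow, map_pow, hb, hz] at h3
    have h4 : ((-1 : K) ^ (n2 + n6) - 1) * (β ^ n2 * ζ ^ n6) = 0 := by
      rw [neg_pow, neg_pow ζ] at h3
      rw [pow_add]
      linear_combination h3
    have h5 : (-1 : K) ^ (n2 + n6) - 1 = 0 := (mul_eq_zero.mp h4).resolve_right ny
    interval_cases n2 <;> interval_cases n6
    · rfl
    · norm_num at h5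
    · norm_num at h5
    · rfl
  subst hn26
  -- step 3
  have e3 := ex g3
  have c30 : ch 0 (KA.sv a b c g3) = 0 := by rw [hg3]; decide
  have c32 : ch 2 (KA.sv a b c g3) = 1 := by rw [hg3]; decide
  have c34 : ch 4 (KA.sv a b c g3) = 1 := by rw [hg3]; decide
  have c35 : ch 5 (KA.sv a b c g3) = 0 := by rw [hg3]; decide
  have hn2' : n2 = 0 := by
    have i3 := inv g3 x
    rw [h.z1' g3 hg3, fx 0 g3 c30, fx 5 g3 c35] at e3
    have P3 : PM ((-1) ^ n2 * (β * g3 β) ^ n2 * (e 4 * g3 (e 4)) ^ n4) :=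
      ((PM.neg1.pow n2).mul ((mvr 2 g3 β h.b2 ud.N2 c32).pow n2)).mul ((mv 4 g3 c34).pow n4)
    generalize x * g3 x = y at e3 i3
    have ny : e 0 ^ n0 * e 5 ^ n5 * ζ ^ n2 ≠ 0 := by have := ne 0; have := ne 5; positivity
    obtain ⟨-, h2⟩ := P3.pos φ (y := y) (z := e 0 ^ n0 * e 5 ^ n5 * ζ ^ n2) ny (by rw [e3]; ring)
    have hz := h.z1' g3 hg3
    have h3 : g3 (e 0 ^ n0 * e 5 ^ n5 * ζ ^ n2) = e 0 ^ n0 * e 5 ^ n5 * ζ ^ n2 := by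
      rcases h2 with h2 | h2
      · rw [← h2]; exact i3
      · have : e 0 ^ n0 * e 5 ^ n5 * ζ ^ n2 = - y := by rw [h2, neg_neg]
        rw [this, map_neg, i3]
    rw [map_mul, map_mul, map_pow, map_pow, map_pow, hz, fx 0 g3 c30, fx 5 g3 c35] at h3
    have h4 : ((-1 : K) ^ n2 - 1) * (e 0 ^ n0 * e 5 ^ n5 * ζ ^ n2) = 0 := by
      rw [neg_pow ζ] at h3
      linear_combination h3
    have h5 : (-1 : K) ^ n2 - 1 = 0 := (mul_eq_zero.mp h4).resolve_right ny
    interval_cases n2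
    · rfl
    · norm_num at h5
  subst hn2'
  -- step 4
  have e4 := ex τ
  have t0 : ch 0 (KA.sv a b c τ) = 0 := by rw [hτ]; decide
  have t4 : ch 4 (KA.sv a b c τ) = 1 := by rw [hτ]; decide
  have t5 : ch 5 (KA.sv a b c τ) = 1 := by rw [hτ]; decide
  rw [fx 0 τ t0, ud.conj1 4 τ t4, ud.conj1 5 τ t5, ud.N4, ud.N5] at e4
  have hn4' : n4 = 0 := by
    by_contra hn
    have hn : n4 = 1 := by omega
    apply UD.neg_sq (x * τ x) (e 0 ^ n0) φ (pow_ne_zero _ (ne 0))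
    rw [e4, hn]
    push_cast
    ring
  subst hn4'
  have hn0' : n0 = 0 := by
    by_contra hn
    have hn : n0 = 1 := by omega
    apply UD.neg_sq (x * g1 x) (e 5 ^ n5) φ (pow_ne_zero _ (ne 5))
    rw [e1, hn, ud.conj1 0 g1 c10, ud.N0]
    push_cast
    ring
  subst hn0'
  have hn5' : n5 = 0 := by
    by_contra hn
    have hn : n5 = 1 := by omega
    rw [hn] at hx
    obtain ⟨z, hz⟩ := ud.s5'
    have h5 : (x * z / e 5) ^ 2 = δ * r := by
      have := ne 5
      rw [div_pow, mul_pow, hx, hz]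
      field_simp
    rcases hδ with h1 | h1
    · exact ka.r_ns _ (by rw [h5, h1, one_mul])
    · have h2 := congrArg φ h5
      rw [h1] at h2
      simp only [map_pow, map_mul, map_neg, map_one, map_natCast] at h2
      have h4 := hrf.out.pos
      have h3 : (0 : ℝ) < r := by exact_mod_cast h4
      nlinarith [sq_nonneg (φ (x * z / e 5))]
  exact ⟨rfl, rfl, rfl, rfl, rfl, hn5', rfl⟩
end UB
end

section
open NumberField Module NumberField.Units NumberField.InfinitePlace
set_option linter.unusedSectionVars false
set_option linter.unusedVariables false

/-- diagonal part -/
noncomputable def dd : Option (Fin 7) → ℝ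
  | none => 1
  | some i => (![1, 1/2, 1/2, 1/2, 1, 1, 1/2] : Fin 7 → ℝ) i
/-- correction row -/
noncomputable def cc (I J : ℕ) : Option (Fin 7) → ℝ
  | none => 0
  | some i => (![I, 0, 0, 0, I, J, 0] : Fin 7 → ℝ) i
/-- transition matrix -/
noncomputable def Pm (I J : ℕ) : Matrix (Option (Fin 7)) (Option (Fin 7)) ℝ :=
  Matrix.of fun i j => Matrix.diagonal dd i j + cc I J j * Matrix.diagonal dd i (some 3)

lemma det_Pm (I J : ℕ) : (Pm I J).det = 1 / 16 := by
  rw [← Matrix.det_transpose, Matrix.det_eq_of_forall_row_eq_smul_add_const (A := (Pm I J).transpose) (B := (Matrix.diagonal dd).transpose) (cc I J) (some 3) (by simp [cc])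
    (fun i j => by simp [Pm, Matrix.transpose_apply])]
  rw [Matrix.det_transpose, Matrix.det_diagonal, Fintype.prod_option, Fin.prod_univ_seven]
  simp [dd]
  norm_num

/-- the character table -/
noncomputable def Hm (f : Option (Fin 7) ≃ (Fin 3 → ZMod 2)) : Matrix (Option (Fin 7)) (Option (Fin 7)) ℝ :=
  Matrix.of fun i j => match i with
    | none => 1
    | some i => ((sg (ch i (f j)) : ℤ) : ℝ)

lemma Hm_orth1 : ∀ i j : Fin 7, ∑ t : Fin 3 → ZMod 2, sg (ch i t) * sg (ch j t) = if i = j then 8 else 0 := by decide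
lemma Hm_orth2 : ∀ i : Fin 7, ∑ t : Fin 3 → ZMod 2, sg (ch i t) = 0 := by decide

lemma det_Hm (f : Option (Fin 7) ≃ (Fin 3 → ZMod 2)) : |(Hm f).det| = 4096 := by
  have h1 : Hm f * (Hm f).transpose = (8 : ℝ) • (1 : Matrix (Option (Fin 7)) (Option (Fin 7)) ℝ) := by
    ext i j
    rw [Matrix.mul_apply, Matrix.smul_apply]
    have key : ∀ F : (Fin 3 → ZMod 2) → ℤ, ∑ k, ((F (f k) : ℤ) : ℝ) = ((∑ t, F t : ℤ) : ℝ) := by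
      intro F
      push_cast
      exact f.sum_comp (fun t => ((F t : ℤ) : ℝ))
    rcases i with _ | i <;> rcases j with _ | j
    · simp [Hm]
    · have := key (fun t => sg (ch j t))
      rw [Hm_orth2] at this
      simpa [Hm] using this
    · have := key (fun t => sg (ch i t))
      rw [Hm_orth2] at this
      simpa [Hm] using this
    · have := key (fun t => sg (ch i t) * sg (ch j t))
      rw [Hm_orth1] at this
      simp only [Hm, Matrix.of_apply, Matrix.transpose_apply, Matrix.one_apply, Option.some_inj]
      push_cast at this
      rw [this]
      split_ifs <;> simp
  have h2 := congrArg Matrix.det h1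
  rw [Matrix.det_mul, Matrix.det_transpose, Matrix.det_smul, Matrix.det_one] at h2
  simp only [Fintype.card_option, Fintype.card_fin] at h2
  have h3 : |(Hm f).det| ^ 2 = 4096 ^ 2 := by rw [sq_abs, sq, h2]; norm_num
  exact (pow_left_inj₀ (abs_nonneg _) (by norm_num) (by norm_num)).mp h3

namespace KA
variable {q r s Q Q' : ℕ} [hqf : Fact q.Prime] [hrf : Fact r.Prime] [hsf : Fact s.Prime]
variable {K : Type*} [Field K] [NumberField K] {a b b' c : K} {φ : K →+* ℝ}

/-- matrix of logarithms -/
noncomputable def LM (φ : K →+* ℝ) (v : Fin 7 → K) (g : Option (Fin 7) → Gal(K/ℚ)) : Matrix (Option (Fin 7)) (Option (Fin 7)) ℝ :=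
  Matrix.of fun i j => match i with
    | none => 1
    | some i => Real.log |φ (g j (v i))|

lemma reg_det (h : KA q r s Q Q' a b b' c φ) (u : Fin 7 → (𝓞 K)ˣ) (g : Option (Fin 7) ≃ Gal(K/ℚ)) :
    8 * regOfFamily (fun i => u (finCongr h.rank7 i)) = |(LM φ (fun i => ((u i : 𝓞 K) : K)) g).det| := by
  classical
  have := h.totReal
  let w' : InfinitePlace K := pl φ 1
  have hcard : Fintype.card {w : InfinitePlace K // w ≠ w'} = 7 := by
    rw [Fintype.card_subtype_compl, Fintype.card_subtype_eq, h.card_pl]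
  let ε : Fin 7 ≃ {w : InfinitePlace K // w ≠ w'} := (Fintype.equivFinOfCardEq hcard).symm
  let e : {w : InfinitePlace K // w ≠ w'} ≃ Fin (rank K) := ε.symm.trans (finCongr h.rank7.symm)
  let ER : Option (Fin 7) ≃ InfinitePlace K := ((Equiv.optionSubtype w').symm ε).1
  have ER0 : ER none = w' := ((Equiv.optionSubtype w').symm ε).2
  have ERs : ∀ i, ER (some i) = (ε i).1 := fun i => Equiv.optionSubtype_symm_apply_apply_coe w' ε i
  let EC : Option (Fin 7) ≃ InfinitePlace K := g.trans (Equiv.ofBijective _ h.pl_bij)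
  have h1 := finrank_mul_regOfFamily_eq_det (fun i => u (finCongr h.rank7 i)) w' e
  rw [h.finrank8, ← Matrix.abs_det_submatrix_equiv_equiv ER EC] at h1
  rw [show ((8 : ℕ) : ℝ) = 8 by norm_num] at h1
  rw [h1]
  congr 2
  ext i j
  rw [Matrix.submatrix_apply, Matrix.of_apply]
  have hm : mult (EC j) = 1 := by
    have := IsTotallyReal.isReal (EC j)
    exact mult_isReal ⟨_, this⟩
  rcases i with _ | i
  · rw [dif_pos ER0, hm]
    simp [LM]
  · have hne : ER (some i) ≠ w' := by rw [ERs]; exact (ε i).2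
    rw [dif_neg hne, hm]
    have he : finCongr h.rank7 (e ⟨ER (some i), hne⟩) = i := by
      have : (⟨ER (some i), hne⟩ : {w : InfinitePlace K // w ≠ w'}) = ε i := Subtype.ext (ERs i)
      rw [this]
      simp [e]
    rw [he]
    simp only [LM, Matrix.of_apply, Nat.cast_one, one_mul]
    congr 1
    exact pl_apply (g j) _
end KA
end

section
open NumberField Module NumberField.Units NumberField.InfinitePlace
set_option linter.unusedSectionVars false
set_option linter.unusedVariables false

lemma exists_unit_of_int {K : Type*} [Field K] [NumberField K] (x : K) (hx : x ≠ 0) (h1 : IsIntegral ℤ x) (h2 : IsIntegral ℤ x⁻¹) :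
    ∃ u : (𝓞 K)ˣ, ((u : 𝓞 K) : K) = x := by
  refine ⟨⟨⟨x, h1⟩, ⟨x⁻¹, h2⟩, ?_, ?_⟩, rfl⟩
  · ext; exact mul_inv_cancel₀ hx
  · ext; exact inv_mul_cancel₀ hx

namespace UB
variable {q r s Q Q' : ℕ} [hqf : Fact q.Prime] [hrf : Fact r.Prime] [hsf : Fact s.Prime]
variable {K : Type*} [Field K] [NumberField K] {a b b' c : K} {φ : K →+* ℝ} {e : Fin 7 → K} {N : Fin 7 → ℤ} {α β θ ζ : K} {I J : ℕ}

lemma exists_units (h : UB q r s Q Q' a b b' c φ e N α β θ ζ I J) :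
    ∃ u : Fin 7 → (𝓞 K)ˣ, ∀ i, ((u i : 𝓞 K) : K) = (![e 0, α, β, θ, e 4, e 5, ζ] : Fin 7 → K) i := by
  have ud := h.ud
  have ne := ud.e_ne
  have hi : ∀ i, IsIntegral ℤ (e i)⁻¹ := by
    intro i
    have hc : ∀ i : Fin 7, ∃ t : Fin 3 → ZMod 2, ch i t = 1 := by decide
    obtain ⟨t, ht⟩ := hc i
    obtain ⟨σ, hσ⟩ := ud.ka.exists_aut t
    have h1 := ud.conj1 i σ (by rw [hσ]; exact ht)
    have h2 := map_isIntegral_int σ (ud.int i)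
    have h3 : (e i)⁻¹ = N i * σ (e i) := by
      have := ne i
      field_simp
      have h4 : ((N i : ℤ) : K) * N i = 1 := (PM.ofZ (ud.N_pm i)).sq
      rw [← h4, ← h1]; ring
    rw [h3]
    exact (isIntegral_algebraMap (R := ℤ) (A := K) (x := N i)).mul h2
  have root : ∀ x y : K, y ≠ 0 → IsIntegral ℤ y → IsIntegral ℤ y⁻¹ → x ^ 2 = y → ∃ u : (𝓞 K)ˣ, ((u : 𝓞 K) : K) = x := by
    intro x y hy h1 h2 hxy
    have hx : x ≠ 0 := by rintro rfl; exact hy (by rw [← hxy]; simp)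
    refine exists_unit_of_int x hx (IsIntegral.of_pow two_pos (by rw [hxy]; exact h1)) (IsIntegral.of_pow two_pos (by rw [inv_pow, hxy]; exact h2))
  have hb : ∀ i, ∃ u : (𝓞 K)ˣ, ((u : 𝓞 K) : K) = (![e 0, α, β, θ, e 4, e 5, ζ] : Fin 7 → K) i := by
    have t2 := h.t2
    intro i
    fin_cases i
    · exact exists_unit_of_int _ (ne 0) (ud.int 0) (hi 0)
    · exact root _ _ (ne 1) (ud.int 1) (hi 1) h.a2
    · exact root _ _ (ne 2) (ud.int 2) (hi 2) h.b2
    · refine root _ _ ?_ ?_ ?_ t2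
      · have := ne 0; have := ne 3; have := ne 4; have := ne 5; positivity
      · exact ((ud.int 3).mul (((ud.int 0).mul (ud.int 4)).pow I)).mul ((ud.int 5).pow J)
      · rw [mul_inv, mul_inv, ← inv_pow, ← inv_pow, mul_inv]
        exact ((hi 3).mul (((hi 0).mul (hi 4)).pow I)).mul ((hi 5).pow J)
    · exact exists_unit_of_int _ (ne 4) (ud.int 4) (hi 4)
    · exact exists_unit_of_int _ (ne 5) (ud.int 5) (hi 5)
    · exact root _ _ (ne 6) (ud.int 6) (hi 6) h.z2
  choose u hu using hb
  exact ⟨u, hu⟩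

/-- the diagonal matrix of logarithms -/
noncomputable def LL (φ : K →+* ℝ) (e : Fin 7 → K) : Option (Fin 7) → ℝ
  | none => 1
  | some i => Real.log (φ (e i))

lemma LM_eq (h : UB q r s Q Q' a b b' c φ e N α β θ ζ I J) (g : Option (Fin 7) ≃ Gal(K/ℚ)) :
    KA.LM φ ![e 0, α, β, θ, e 4, e 5, ζ] g = Pm I J * (Matrix.diagonal (LL φ e) * Hm (g.trans (Equiv.ofBijective _ ⟨h.ud.ka.kf.sb_inj, h.ud.ka.kf.sb_surj⟩))) := by
  have ud := h.ud
  have ne := ud.e_ne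
  ext i j
  have hP : ∀ (X : Matrix (Option (Fin 7)) (Option (Fin 7)) ℝ), (Pm I J * X) i j = dd i * X i j + (if i = some 3 then dd (some 3) * ∑ k, cc I J k * X k j else 0) := by
    intro X
    rw [Matrix.mul_apply]
    simp only [Pm, Matrix.of_apply, add_mul, Finset.sum_add_distrib]
    congr 1
    · rw [← Matrix.mul_apply, Matrix.diagonal_mul]
    · split_ifs with hi
      · rw [hi, Finset.mul_sum]
        simp only [Matrix.diagonal_apply_eq]
        exact Finset.sum_congr rfl fun k _ => by ring
      · simp only [Matrix.diagonal_apply_ne _ hi, mul_zero, zero_mul, Finset.sum_const_zero]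
  rw [hP]
  simp only [Matrix.diagonal_mul]
  set f := g.trans (Equiv.ofBijective _ ⟨h.ud.ka.kf.sb_inj, h.ud.ka.kf.sb_surj⟩) with hf
  have hfj : f j = KA.sv a b c (g j) := rfl
  set σ := g j with hσ
  have le : ∀ i, Real.log |φ (σ (e i))| = Real.log (φ (e i)) * ((sg (ch i (f j)) : ℤ) : ℝ) := by
    intro i
    rw [hfj]
    have hp : 0 < φ (e i) := by linarith [ud.gt i]
    have hz : ∀ z : ZMod 2, z = 0 ∨ z = 1 := by decide
    rcases hz (ch i (KA.sv a b c σ)) with h1 | h1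
    · rw [ud.conj0 i σ h1, h1, sg_zero, abs_of_pos hp]; simp
    · rw [h1, sg_one]
      have h2 := congrArg φ (ud.conj1 i σ h1)
      rw [map_mul, map_intCast] at h2
      have h3 := congrArg abs h2
      rw [abs_mul, abs_of_pos hp] at h3
      have h4 : |((N i : ℤ) : ℝ)| = 1 := by rcases ud.N_pm i with h | h <;> rw [h] <;> simp
      rw [h4] at h3
      have h5 : |φ (σ (e i))| = (φ (e i))⁻¹ := by
        exact eq_inv_of_mul_eq_one_right h3
      rw [h5, Real.log_inv]; simp
  have rt : ∀ x y : K, x ^ 2 = y → Real.log |φ (σ x)| = 1 / 2 * Real.log |φ (σ y)| := by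
    intro x y hxy
    rw [← hxy, map_pow, map_pow, abs_pow, Real.log_pow]
    push_cast
    ring
  have nz : ∀ i, |φ (σ (e i))| ≠ 0 := by
    intro i
    have := ne i
    simpa using this
  have tt : Real.log |φ (σ (e 3 * (e 0 * e 4) ^ I * e 5 ^ J))| = Real.log |φ (σ (e 3))| + I * (Real.log |φ (σ (e 0))| + Real.log |φ (σ (e 4))|) + J * Real.log |φ (σ (e 5))| := by
    simp only [map_mul, map_pow, abs_mul, abs_pow]
    have n0 := nz 0
    have n3 := nz 3
    have n4 := nz 4
    have n5 := nz 5
    rw [Real.log_mul (by positivity) (by positivity), Real.log_mul (by positivity) (by positivity), Real.log_pow, Real.log_pow, Real.log_mul n0 n4]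
  rcases i with _ | i
  · simp [KA.LM, dd, LL, Hm]
  · simp only [KA.LM, Matrix.of_apply, ← hσ]
    fin_cases i
    · simp [le, dd, LL, Hm]
    · simp [rt _ _ h.a2, le, dd, LL, Hm]
    · simp [rt _ _ h.b2, le, dd, LL, Hm]
    · have h9 := rt _ _ h.t2
      rw [tt, le, le, le, le] at h9
      simp [h9, dd, LL, Hm, cc, Fintype.sum_option, Fin.sum_univ_seven]
      ring
    · simp [le, dd, LL, Hm]
    · simp [le, dd, LL, Hm]
    · simp [rt _ _ h.z2, le, dd, LL, Hm]

lemma reg_u (h : UB q r s Q Q' a b b' c φ e N α β θ ζ I J) (u : Fin 7 → (𝓞 K)ˣ)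
    (hu : ∀ i, ((u i : 𝓞 K) : K) = (![e 0, α, β, θ, e 4, e 5, ζ] : Fin 7 → K) i) :
    regOfFamily (fun i => u (finCongr h.ud.ka.rank7 i)) = 32 * ∏ i, regulator (KA.kk a b b' c i) := by
  have hc : Fintype.card (Option (Fin 7)) = Fintype.card Gal(K/ℚ) := by
    have := h.ud.ka.kf.gal
    have h1 := IsGalois.card_aut_eq_finrank ℚ K
    rw [h.ud.ka.finrank8, Nat.card_eq_fintype_card] at h1
    rw [h1]; rfl
  let g : Option (Fin 7) ≃ Gal(K/ℚ) := Fintype.equivOfCardEq hc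
  have h1 := h.ud.ka.reg_det u g
  rw [funext hu, h.LM_eq, Matrix.det_mul, Matrix.det_mul, abs_mul, abs_mul, det_Hm, det_Pm, Matrix.det_diagonal, Fintype.prod_option] at h1
  have h2 : ∏ i, LL φ e (some i) = ∏ i, regulator (KA.kk a b b' c i) := Finset.prod_congr rfl fun i _ => (h.ud.reg i).symm
  rw [h2] at h1
  have h3 : 0 ≤ ∏ i, regulator (KA.kk a b b' c i) := Finset.prod_nonneg fun i _ => (regulator_pos _).le
  rw [show LL φ e none = 1 from rfl, one_mul, abs_of_nonneg h3] at h1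
  rw [abs_of_pos (by norm_num)] at h1
  linarith
end UB
end

section
open NumberField Module NumberField.Units NumberField.InfinitePlace
set_option linter.unusedSectionVars false
set_option linter.unusedVariables false

lemma closure_range_prod {G : Type*} [CommGroup G] {n : ℕ} (u : Fin n → G) (x : G) (hx : x ∈ Subgroup.closure (Set.range u)) :
    ∃ k : Fin n → ℤ, x = ∏ i, u i ^ k i := by
  induction hx using Subgroup.closure_induction with
  | mem x hx =>
    obtain ⟨i, rfl⟩ := hx
    refine ⟨Pi.single i 1, ?_⟩
    rw [Finset.prod_eq_single i]
    · simp
    · intro b _ hb; simp [hb]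
    · simp
  | one => exact ⟨0, by simp⟩
  | mul x y _ _ h1 h2 =>
    obtain ⟨k, rfl⟩ := h1
    obtain ⟨l, rfl⟩ := h2
    exact ⟨k + l, by simp [zpow_add, Finset.prod_mul_distrib]⟩
  | inv x _ h1 =>
    obtain ⟨k, rfl⟩ := h1
    exact ⟨-k, by simp⟩

namespace UB
variable {q r s Q Q' : ℕ} [hqf : Fact q.Prime] [hrf : Fact r.Prime] [hsf : Fact s.Prime]
variable {K : Type*} [Field K] [NumberField K] {a b b' c : K} {φ : K →+* ℝ} {e : Fin 7 → K} {N : Fin 7 → ℤ} {α β θ ζ : K} {I J : ℕ}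

lemma sat (h : UB q r s Q Q' a b b' c φ e N α β θ ζ I J) (u : Fin 7 → (𝓞 K)ˣ)
    (hu : ∀ i, ((u i : 𝓞 K) : K) = (![e 0, α, β, θ, e 4, e 5, ζ] : Fin 7 → K) i) (x : (𝓞 K)ˣ)
    (hx : x ^ 2 ∈ Subgroup.closure (Set.range u) ⊔ torsion K) : x ∈ Subgroup.closure (Set.range u) ⊔ torsion K := by
  obtain ⟨y, hy, z, hz, hyz⟩ := Subgroup.mem_sup.1 hx
  obtain ⟨k, hk⟩ := closure_range_prod u y hy
  have hz' := torsion_real φ hz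
  let w := ∏ i, u i ^ (k i / 2)
  have hw : w ∈ Subgroup.closure (Set.range u) := 
    Subgroup.prod_mem _ fun i _ => Subgroup.zpow_mem _ (Subgroup.subset_closure (Set.mem_range_self i)) _
  let n : Fin 7 → ℕ := fun i => (k i % 2).toNat
  have hn : ∀ i, n i ≤ 1 := fun i => by simp only [n]; omega
  have hkn : ∀ i, k i = k i / 2 * 2 + n i := fun i => by simp only [n]; omega
  have hyw : y = w ^ 2 * ∏ i, u i ^ n i := by
    rw [hk, ← Finset.prod_pow, ← Finset.prod_mul_distrib]
    refine Finset.prod_congr rfl fun i _ => ?_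
    conv_lhs => rw [hkn i]
    rw [zpow_add, zpow_mul, zpow_natCast]; rfl
  have h1 : (x * w⁻¹) ^ 2 = z * ∏ i, u i ^ n i := by
    rw [mul_pow, ← hyz, hyw, inv_pow]
    rw [mul_comm (w ^ 2), mul_assoc, mul_assoc, mul_comm z]
    simp [mul_assoc, mul_comm z]
  have h2 : (((x * w⁻¹ : (𝓞 K)ˣ) : 𝓞 K) : K) ^ 2 = ((z : 𝓞 K) : K) * (e 0 ^ n 0 * α ^ n 1 * β ^ n 2 * θ ^ n 3 * e 4 ^ n 4 * e 5 ^ n 5 * ζ ^ n 6) := by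
    have h3 := congrArg (fun t : (𝓞 K)ˣ => ((t : 𝓞 K) : K)) h1
    simp only [Units.val_pow_eq_pow_val, Units.val_mul, map_pow, map_mul, Fin.prod_univ_seven, hu] at h3
    simpa using h3
  have h3 : PM ((z : 𝓞 K) : K) := by
    rcases hz' with h | h <;> rw [h]
    · left; simp
    · right; simp
  obtain ⟨a0, a1, a2, a3, a4, a5, a6⟩ := h.core _ _ h3 _ _ _ _ _ _ _ (hn 0) (hn 1) (hn 2) (hn 3) (hn 4) (hn 5) (hn 6) h2
  rw [Fin.prod_univ_seven, a0, a1, a2, a3, a4, a5, a6] at h1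
  simp only [pow_zero, mul_one] at h1
  have h4 : x * w⁻¹ ∈ torsion K := by
    change IsOfFinOrder _
    replace hz : IsOfFinOrder z := hz
    rw [← h1] at hz
    exact (isOfFinOrder_pow.1 hz).resolve_right (by norm_num)
  rw [show x = w * (x * w⁻¹) by rw [mul_comm x, mul_inv_cancel_left]]
  exact Subgroup.mul_mem_sup hw h4

lemma odd_index {G : Type*} [CommGroup G] (H : Subgroup G) (h0 : H.index ≠ 0) (hs : ∀ x, x ^ 2 ∈ H → x ∈ H) : ¬ 2 ∣ H.index := by
  intro h2
  have : Finite (G ⧸ H) := Nat.finite_of_card_ne_zero h0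
  haveI : Fact (Nat.Prime 2) := ⟨Nat.prime_two⟩
  obtain ⟨y, hy⟩ := exists_prime_orderOf_dvd_card' (G := G ⧸ H) 2 h2
  obtain ⟨x, rfl⟩ := QuotientGroup.mk_surjective y
  have h1 := pow_orderOf_eq_one (x : G ⧸ H)
  rw [hy, ← QuotientGroup.mk_pow, QuotientGroup.eq_one_iff] at h1
  have := hs x h1
  rw [(QuotientGroup.eq_one_iff x).2 this, orderOf_one] at hy
  omega

lemma class_eq (h : UB q r s Q Q' a b b' c φ e N α β θ ζ I J) :
    ∃ n : ℕ, ¬ 2 ∣ n ∧ 32 * classNumber K = n * ∏ i, classNumber (KA.kk a b b' c i) := by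
  obtain ⟨u, hu⟩ := h.exists_units
  have h1 := h.reg_u u hu
  have h2 := regOfFamily_div_regulator (fun i => u (finCongr h.ud.ka.rank7 i))
  have hr : Set.range (fun i => u (finCongr h.ud.ka.rank7 i)) = Set.range u := by
    exact (finCongr h.ud.ka.rank7).surjective.range_comp u
  rw [hr, h1] at h2
  have h3 := h.ud.ka.cnf'
  have hp : 0 < ∏ i, regulator (KA.kk a b b' c i) := Finset.prod_pos fun i _ => regulator_pos _
  have hR := regulator_pos K
  refine ⟨_, odd_index (Subgroup.closure (Set.range u) ⊔ torsion K) ?_ (h.sat u hu), ?_⟩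
  · intro h0
    rw [h0] at h2
    have : 0 < 32 * (∏ i, regulator (KA.kk a b b' c i)) / regulator K := by positivity
    rw [h2] at this
    simp at this
  · rw [Finset.prod_mul_distrib] at h3
    rw [div_eq_iff hR.ne'] at h2
    have h4 : ((32 * classNumber K : ℕ) : ℝ) = ((Subgroup.closure (Set.range u) ⊔ torsion K).index * ∏ i, classNumber (KA.kk a b b' c i) : ℕ) := by
      push_cast
      have h5 : regulator K * (32 * classNumber K) = regulator K * ((Subgroup.closure (Set.range u) ⊔ torsion K).index * ∏ i, (classNumber (KA.kk a b b' c i) : ℝ)) := by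
        linear_combination 32 * h3 + (∏ i, (classNumber (KA.kk a b b' c i) : ℝ)) * h2
      exact mul_left_cancel₀ hR.ne' h5
    exact_mod_cast h4
end UB
end

section
open NumberField Module nonZeroDivisors
set_option linter.unusedSectionVars false
set_option linter.unusedVariables false

section
variable {k : Type*} [Field k] [NumberField k]

/-- the class of the square root of the ideal `(m)` lies in `A` -/
def TrA (A : Subgroup (ClassGroup (𝓞 k))) (m : ℕ) : Prop :=
  ∃ J : (Ideal (𝓞 k))⁰, (J : Ideal (𝓞 k)) ^ 2 = Ideal.span {((m : ℕ) : 𝓞 k)} ∧ ClassGroup.mk0 J ∈ A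

lemma TrA.mul {A : Subgroup (ClassGroup (𝓞 k))} {m n : ℕ} (h1 : TrA A m) (h2 : TrA A n) : TrA A (m * n) := by
  obtain ⟨J, hJ, hJA⟩ := h1
  obtain ⟨L, hL, hLA⟩ := h2
  refine ⟨J * L, ?_, ?_⟩
  · rw [Submonoid.coe_mul, mul_pow, hJ, hL, Ideal.span_singleton_mul_span_singleton]; push_cast; rfl
  · rw [map_mul]; exact mul_mem hJA hLA

lemma TrA.one {A : Subgroup (ClassGroup (𝓞 k))} : TrA A 1 :=
  ⟨1, by simp [Ideal.one_eq_top], by rw [map_one]; exact one_mem _⟩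

lemma mk0_span {y : 𝓞 k} {J : (Ideal (𝓞 k))⁰} (h : (J : Ideal (𝓞 k)) = Ideal.span {y}) : ClassGroup.mk0 J = 1 := by
  rw [ClassGroup.mk0_eq_one_iff, h]; exact ⟨y, rfl⟩

lemma nzd {I : Ideal (𝓞 k)} (h : I ≠ 0) : I ∈ (Ideal (𝓞 k))⁰ := mem_nonZeroDivisors_of_ne_zero h

lemma span_ne {y : 𝓞 k} (h : y ≠ 0) : Ideal.span {y} ≠ 0 := by
  simpa [Ideal.zero_eq_bot] using h

lemma TrA.of_sq {A : Subgroup (ClassGroup (𝓞 k))} {m : ℕ} (hm : m ≠ 0) (ε : (𝓞 k)ˣ) (hy : ∃ y : k, ((m : ℕ) : k) * (ε : 𝓞 k) = y ^ 2) :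
    TrA A m := by
  obtain ⟨y, hy⟩ := hy
  have hi : IsIntegral ℤ y := by
    refine IsIntegral.of_pow two_pos ?_
    rw [← hy]
    have h1 := (isIntegral_algebraMap (R := ℤ) (A := k) (x := m)).mul (ε : 𝓞 k).2
    exact isInt_congr h1 (by rw [eq_intCast, Int.cast_natCast]; rfl)
  let Y : 𝓞 k := ⟨y, hi⟩
  have hY : Y ^ 2 = (m : 𝓞 k) * ε := by ext; exact hy.symm
  have hY0 : Y ≠ 0 := by
    intro h0
    rw [h0] at hY
    have : (m : 𝓞 k) * ε = 0 := by rw [← hY]; simp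
    rcases mul_eq_zero.1 this with h | h
    · exact hm (by exact_mod_cast h)
    · exact ε.ne_zero h
  refine ⟨⟨Ideal.span {Y}, nzd (span_ne hY0)⟩, ?_, ?_⟩
  · change Ideal.span {Y} ^ 2 = _
    rw [Ideal.span_singleton_pow, hY, Ideal.span_singleton_mul_right_unit ε.isUnit]
  · rw [mk0_span (y := Y) rfl]; exact one_mem _

lemma ideal_sq_inj {I J : Ideal (𝓞 k)} (h : I ^ 2 = J ^ 2) : I = J := by
  have h1 : I ∣ J := (UniqueFactorizationMonoid.pow_dvd_pow_iff_dvd two_ne_zero).1 (dvd_of_eq h)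
  have h2 : J ∣ I := (UniqueFactorizationMonoid.pow_dvd_pow_iff_dvd two_ne_zero).1 (dvd_of_eq h.symm)
  exact associated_iff_eq.1 (associated_of_dvd_dvd h1 h2)

lemma TrA.cls {A : Subgroup (ClassGroup (𝓞 k))} {m t w : ℕ} (h : TrA A m) (hw : t * m = w ^ 2) (J : (Ideal (𝓞 k))⁰)
    (hJ : (J : Ideal (𝓞 k)) ^ 2 = Ideal.span {((t : ℕ) : 𝓞 k)}) : ClassGroup.mk0 J ∈ A := by
  obtain ⟨L, hL, hLA⟩ := h
  have h1 : ((J * L : (Ideal (𝓞 k))⁰) : Ideal (𝓞 k)) = Ideal.span {((w : ℕ) : 𝓞 k)} := by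
    apply ideal_sq_inj
    rw [Submonoid.coe_mul, mul_pow, hJ, hL, Ideal.span_singleton_mul_span_singleton, Ideal.span_singleton_pow, ← Nat.cast_mul, hw, Nat.cast_pow]
  have h2 := mk0_span h1
  rw [map_mul] at h2
  rw [eq_inv_of_mul_eq_one_left h2]
  exact inv_mem hLA

end

namespace QF
variable {k : Type*} [Field k] [NumberField k] {d : ℤ} {x : k}

lemma X_coord_inj (h : QF k d x) {u v u' v' : ℤ} (huv : (u : 𝓞 k) + v * h.X = u' + v' * h.X) : u = u' ∧ v = v' := by
  have h1 := congrArg (fun z : 𝓞 k => (z : k)) huv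
  simp only [map_add, map_mul, map_intCast, coe_X] at h1
  have h2 := h.coord_inj (u := u) (v := v) (u' := u') (v' := v') (by push_cast; exact h1)
  exact ⟨by exact_mod_cast h2.1, by exact_mod_cast h2.2⟩

lemma norm_X (h : QF k d x) (u v : ℤ) : Algebra.norm ℤ ((u : 𝓞 k) + v * h.X) = u ^ 2 - d * v ^ 2 := by
  have h1 := Algebra.coe_norm_int ((u : 𝓞 k) + (v : 𝓞 k) * h.X)
  have h2 := h.norm_eq u v
  have h3 : (((u : 𝓞 k) + (v : 𝓞 k) * h.X : 𝓞 k) : k) = ((u : ℚ) : k) + ((v : ℚ) : k) * x := by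
    simp only [map_add, map_mul, map_intCast, coe_X]; push_cast; rfl
  rw [h3, h2] at h1
  exact_mod_cast h1

lemma dvd_coord (h : QF k d x) (hd : d % 4 = 2 ∨ d % 4 = 3) {p u v : ℤ} (hp : (p : 𝓞 k) ∣ u + v * h.X) : p ∣ u ∧ p ∣ v := by
  obtain ⟨z, hz⟩ := hp
  obtain ⟨a, b, rfl⟩ := h.int_coord'' hd z
  have := h.X_coord_inj (u := u) (v := v) (u' := p * a) (v' := p * b) (by rw [hz]; push_cast; ring)
  exact ⟨⟨a, this.1⟩, ⟨b, this.2⟩⟩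

lemma red (h : QF k d x) (hd : d % 4 = 2 ∨ d % 4 = 3) {p : ℤ} (hp : Prime p) (hpd : ¬ p ∣ 2 * d) {z : 𝓞 k} (hz : (p : 𝓞 k) ∣ z ^ 2) :
    (p : 𝓞 k) ∣ z := by
  obtain ⟨u, v, rfl⟩ := h.int_coord'' hd z
  have h1 : ((u : 𝓞 k) + v * h.X) ^ 2 = ((u ^ 2 + d * v ^ 2 : ℤ) : 𝓞 k) + ((2 * u * v : ℤ) : 𝓞 k) * h.X := by
    push_cast
    linear_combination (v : 𝓞 k) ^ 2 * h.X_sq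
  rw [h1] at hz
  obtain ⟨h2, h3⟩ := h.dvd_coord hd hz
  have p2 : ¬ p ∣ 2 := fun h => hpd (h.mul_right _)
  have pd : ¬ p ∣ d := fun h => hpd (h.mul_left _)
  have h4 : p ∣ u * v := by
    rw [mul_assoc] at h3
    exact (hp.dvd_or_dvd h3).resolve_left p2
  have h5 : p ∣ u ∧ p ∣ v := by
    rcases hp.dvd_or_dvd h4 with hu | hv
    · refine ⟨hu, ?_⟩
      have := (Int.dvd_iff_dvd_of_dvd_add h2).1 (dvd_pow hu two_ne_zero)
      exact hp.dvd_of_dvd_pow ((hp.dvd_or_dvd this).resolve_left pd)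
    · refine ⟨?_, hv⟩
      have := (Int.dvd_iff_dvd_of_dvd_add h2).2 ((dvd_pow hv two_ne_zero).mul_left d)
      exact hp.dvd_of_dvd_pow this
  obtain ⟨⟨a, rfl⟩, ⟨b, rfl⟩⟩ := h5
  exact ⟨a + b * h.X, by push_cast; ring⟩

lemma sqf_dvd (h : QF k d x) (hd : d % 4 = 2 ∨ d % 4 = 3) {m : ℕ} (hm : Squarefree m) {J : Ideal (𝓞 k)}
    (hJ : J ^ 2 = Ideal.span {((m : ℕ) : 𝓞 k)}) : m ∣ (2 * d).natAbs := by
  rw [← Nat.prod_primeFactors_of_squarefree hm]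
  refine Finset.prod_primes_dvd _ (fun p hp => (Nat.prime_of_mem_primeFactors hp).prime) fun p hp => ?_
  have hpp := Nat.prime_of_mem_primeFactors hp
  by_contra hnd
  have hpm := Nat.dvd_of_mem_primeFactors hp
  have h1 : Ideal.span {((p : ℕ) : 𝓞 k)} ∣ J := by
    rw [Ideal.dvd_iff_le]
    intro z hz
    rw [Ideal.mem_span_singleton]
    have h2 : z ^ 2 ∈ J ^ 2 := Ideal.pow_mem_pow hz 2
    rw [hJ, Ideal.mem_span_singleton] at h2
    have h3 : ((p : ℤ) : 𝓞 k) ∣ z ^ 2 := by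
      refine dvd_trans ?_ h2
      push_cast
      exact_mod_cast Nat.cast_dvd_cast (α := 𝓞 k) hpm
    have := h.red hd (Nat.prime_iff_prime_int.1 hpp) (by rwa [← Int.natCast_dvd] at hnd) h3
    exact_mod_cast this
  have h2 := pow_dvd_pow_of_dvd h1 2
  rw [hJ, Ideal.span_singleton_pow, Ideal.dvd_span_singleton, Ideal.mem_span_singleton] at h2
  have h3 : (((p ^ 2 : ℕ) : ℤ) : 𝓞 k) ∣ ((m : ℤ) : 𝓞 k) + ((0 : ℤ) : 𝓞 k) * h.X := by
    push_cast; rw [zero_mul, add_zero]; exact h2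
  have h4 := (h.dvd_coord hd h3).1
  have h5 : p ^ 2 ∣ m := by exact_mod_cast h4
  rw [pow_two] at h5
  exact hpp.not_isUnit (hm p h5)

/-- squares roots of rational ideals -/
lemma rat_root (h : QF k d x) (hd : d % 4 = 2 ∨ d % 4 = 3) {A : Subgroup (ClassGroup (𝓞 k))}
    (HT : ∀ m : ℕ, Squarefree m → m ∣ (2 * d).natAbs → ∃ m' w, TrA A m' ∧ m * m' = w ^ 2)
    (J : (Ideal (𝓞 k))⁰) (t : ℕ) (ht : t ≠ 0) (hJ : (J : Ideal (𝓞 k)) ^ 2 = Ideal.span {((t : ℕ) : 𝓞 k)}) : ClassGroup.mk0 J ∈ A := by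
  obtain ⟨m, w, hmw, hm⟩ := Nat.sq_mul_squarefree t
  have h1 : Ideal.span {((w : ℕ) : 𝓞 k)} ∣ (J : Ideal (𝓞 k)) := by
    rw [← UniqueFactorizationMonoid.pow_dvd_pow_iff_dvd two_ne_zero, hJ, Ideal.span_singleton_pow, ← hmw, Ideal.dvd_span_singleton, Ideal.mem_span_singleton]
    push_cast
    exact dvd_mul_right _ _
  obtain ⟨L, hL⟩ := h1
  have hw : w ≠ 0 := by rintro rfl; apply ht; rw [← hmw]; simp
  have hL2 : L ^ 2 = Ideal.span {((m : ℕ) : 𝓞 k)} := by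
    rw [hL, mul_pow, ← hmw, Ideal.span_singleton_pow] at hJ
    push_cast at hJ
    rw [← Ideal.span_singleton_mul_span_singleton] at hJ
    refine mul_left_cancel₀ (span_ne ?_) hJ
    exact_mod_cast pow_ne_zero 2 hw
  obtain ⟨m', w', h1, h2⟩ := HT m hm (h.sqf_dvd hd hm hL2)
  refine h1.cls (t := t) (w := w * w') ?_ J hJ
  rw [← hmw, mul_assoc, h2]; ring

lemma two_tors (h : QF k d x) (hd : d % 4 = 2 ∨ d % 4 = 3) {A : Subgroup (ClassGroup (𝓞 k))}
    (HT : ∀ m : ℕ, Squarefree m → m ∣ (2 * d).natAbs → ∃ m' w, TrA A m' ∧ m * m' = w ^ 2)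
    (HN : (∃ u v : ℤ, u ^ 2 - d * v ^ 2 = -1) ∨ (∀ u v n : ℤ, n ≠ 0 → u ^ 2 - d * v ^ 2 ≠ - n ^ 2))
    (c : ClassGroup (𝓞 k)) (hc : c ^ 2 = 1) : c ∈ A := by
  obtain ⟨I, rfl⟩ := ClassGroup.mk0_surjective c
  rw [← map_pow, ClassGroup.mk0_eq_one_iff] at hc
  obtain ⟨ρ, hρ⟩ := hc
  rw [Ideal.submodule_span_eq, SubmonoidClass.coe_pow] at hρ
  have hI0 : (I : Ideal (𝓞 k)) ≠ 0 := nonZeroDivisors.ne_zero I.2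
  set n : ℤ := ((Ideal.absNorm (I : Ideal (𝓞 k)) : ℕ) : ℤ) with hn
  have hn0 : n ≠ 0 := by
    rw [hn]; simp only [ne_eq, Nat.cast_eq_zero, Ideal.absNorm_eq_zero_iff]; exact hI0
  have h1 : ∃ u v : ℤ, (I : Ideal (𝓞 k)) ^ 2 = Ideal.span {(u : 𝓞 k) + v * h.X} ∧ u ^ 2 - d * v ^ 2 = n ^ 2 := by
    obtain ⟨u, v, rfl⟩ := h.int_coord'' hd ρ
    have h2 := congrArg Ideal.absNorm hρ
    rw [map_pow, Ideal.absNorm_span_singleton, h.norm_X] at h2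
    have h3 : |u ^ 2 - d * v ^ 2| = n ^ 2 := by
      rw [hn, Int.abs_eq_natAbs, ← h2]; push_cast; rfl
    rcases abs_eq (sq_nonneg n) |>.1 h3 with h4 | h4
    · exact ⟨u, v, hρ, h4⟩
    · rcases HN with ⟨u', v', h5⟩ | HN
      · have hun : IsUnit ((u' : 𝓞 k) + v' * h.X) := by
          refine IsUnit.of_mul_eq_one (-(u' - v' * h.X)) ?_
          have : (((u' ^ 2 - d * v' ^ 2 : ℤ)) : 𝓞 k) = -1 := by rw [h5]; simp
          push_cast at this
          linear_combination (v' : 𝓞 k) ^ 2 * h.X_sq - this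
        refine ⟨u * u' + d * v * v', u * v' + v * u', ?_, ?_⟩
        · rw [hρ, ← Ideal.span_singleton_mul_right_unit hun]
          congr 2
          push_cast
          linear_combination (v : 𝓞 k) * v' * h.X_sq
        · linear_combination (u' ^ 2 - d * v' ^ 2) * h4 - n ^ 2 * h5
      · exact absurd h4 (HN u v n hn0)
  obtain ⟨u, v, hI, hN⟩ := h1
  have key : ∀ (J : (Ideal (𝓞 k))⁰) (t : ℤ), t ≠ 0 → (J : Ideal (𝓞 k)) ^ 2 = Ideal.span {(t : 𝓞 k)} → ClassGroup.mk0 J ∈ A := by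
    intro J t ht hJ
    refine h.rat_root hd HT J t.natAbs (by simpa using ht) ?_
    rw [hJ]
    rcases Int.natAbs_eq t with h1 | h1
    · conv_lhs => rw [h1]
      simp
    · conv_lhs => rw [h1]
      rw [Int.cast_neg, Ideal.span_singleton_neg]; simp
  set γ : 𝓞 k := ((u + n : ℤ) : 𝓞 k) + v * h.X with hγ
  by_cases h0 : γ = 0
  · have h1 := h.X_coord_inj (u := u + n) (v := v) (u' := 0) (v' := 0) (by rw [← hγ, h0]; simp)
    refine key I u (by intro hu; apply hn0; omega) ?_
    rw [hI, h1.2]; simp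
  · have h2 : γ ^ 2 = ((2 * u + 2 * n : ℤ) : 𝓞 k) * (u + v * h.X) := by
      have : (((u ^ 2 - d * v ^ 2 : ℤ)) : 𝓞 k) = n ^ 2 := by rw [hN]; simp
      rw [hγ]
      push_cast at this ⊢
      linear_combination (v : 𝓞 k) ^ 2 * h.X_sq - this
    have h3 : (I : Ideal (𝓞 k)) ∣ Ideal.span {γ} := by
      rw [← UniqueFactorizationMonoid.pow_dvd_pow_iff_dvd two_ne_zero, Ideal.span_singleton_pow, h2, ← Ideal.span_singleton_mul_span_singleton, ← hI]
      exact dvd_mul_left _ _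
    obtain ⟨J, hJ⟩ := h3
    have hJ0 : J ≠ 0 := by
      rintro rfl
      rw [mul_zero] at hJ
      exact span_ne h0 hJ
    have hJ2 : J ^ 2 = Ideal.span {((2 * u + 2 * n : ℤ) : 𝓞 k)} := by
      have h4 : (I : Ideal (𝓞 k)) ^ 2 * J ^ 2 = (I : Ideal (𝓞 k)) ^ 2 * Ideal.span {((2 * u + 2 * n : ℤ) : 𝓞 k)} := by
        rw [← mul_pow, ← hJ, Ideal.span_singleton_pow, h2, ← Ideal.span_singleton_mul_span_singleton, ← hI, mul_comm]
      exact mul_left_cancel₀ (pow_ne_zero 2 hI0) h4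
    have ht : (2 * u + 2 * n : ℤ) ≠ 0 := by
      intro ht
      rw [ht] at h2
      exact h0 (by simpa using h2)
    have h5 := key ⟨J, nzd hJ0⟩ _ ht hJ2
    have h6 : ClassGroup.mk0 (I * ⟨J, nzd hJ0⟩) = 1 := mk0_span (y := γ) (by rw [Submonoid.coe_mul]; exact hJ.symm)
    rw [map_mul] at h6
    rw [eq_inv_of_mul_eq_one_left h6]
    exact inv_mem h5

lemma non_sq (h : QF k d x) (hd : d % 4 = 2 ∨ d % 4 = 3) {m : ℕ} (J : (Ideal (𝓞 k))⁰)
    (hJ : (J : Ideal (𝓞 k)) ^ 2 = Ideal.span {((m : ℕ) : 𝓞 k)})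
    (H : ∀ u v n δ : ℤ, n ≠ 0 → (δ = 1 ∨ δ = -1) → u ^ 2 - d * v ^ 2 ≠ δ * m * n ^ 2)
    (c : ClassGroup (𝓞 k)) (hc : c ^ 2 = ClassGroup.mk0 J) : False := by
  obtain ⟨I, hI⟩ := ClassGroup.mk0_surjective c⁻¹
  have h1 : ClassGroup.mk0 (I ^ 2 * J) = 1 := by rw [map_mul, map_pow, hI, ← hc]; simp
  rw [ClassGroup.mk0_eq_one_iff] at h1
  obtain ⟨ρ, hρ⟩ := h1
  rw [Ideal.submodule_span_eq] at hρ
  obtain ⟨u, v, rfl⟩ := h.int_coord'' hd ρ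
  have h2 := congrArg Ideal.absNorm hρ
  rw [Submonoid.coe_mul, SubmonoidClass.coe_pow, map_mul, map_pow, Ideal.absNorm_span_singleton, h.norm_X] at h2
  have h3 : Ideal.absNorm (J : Ideal (𝓞 k)) = m := by
    have h4 := congrArg Ideal.absNorm hJ
    have h5 := h.norm_X m 0
    rw [map_pow, Ideal.absNorm_span_singleton] at h4
    simp only [Int.cast_natCast, Int.cast_zero, zero_mul, add_zero] at h5
    rw [h5] at h4
    have : (((m : ℤ) ^ 2 - d * 0 ^ 2).natAbs) = m ^ 2 := by simp [Int.natAbs_pow]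
    rw [this] at h4
    exact Nat.pow_left_injective two_ne_zero h4
  have hn0 : ((Ideal.absNorm (I : Ideal (𝓞 k)) : ℕ) : ℤ) ≠ 0 := by
    simp only [ne_eq, Nat.cast_eq_zero, Ideal.absNorm_eq_zero_iff]; exact nonZeroDivisors.ne_zero I.2
  rw [h3] at h2
  have h4 : |u ^ 2 - d * v ^ 2| = m * ((Ideal.absNorm (I : Ideal (𝓞 k)) : ℕ) : ℤ) ^ 2 := by
    rw [Int.abs_eq_natAbs, ← h2]; push_cast; ring
  rcases abs_eq (by positivity) |>.1 h4 with h5 | h5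
  · exact H u v _ 1 hn0 (Or.inl rfl) (by rw [h5]; ring)
  · exact H u v _ (-1) hn0 (Or.inr rfl) (by rw [h5]; ring)

lemma root_ideal (p z w α β γ : 𝓞 k) (hp : p ≠ 0) (hz : z ^ 2 = p * w) (h1 : α * p + β * z + γ * w = 1) :
    ∃ J : (Ideal (𝓞 k))⁰, (J : Ideal (𝓞 k)) ^ 2 = Ideal.span {p} := by
  have h2 : (Ideal.span {p, z}) ^ 2 = Ideal.span {p} := by
    apply le_antisymm
    · rw [pow_two, Ideal.span_mul_span', Ideal.span_le]
      rintro _ ⟨a, ha, b, hb, rfl⟩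
      simp only [Set.mem_insert_iff, Set.mem_singleton_iff] at ha hb
      simp only [SetLike.mem_coe, Ideal.mem_span_singleton]
      rcases ha with rfl | rfl <;> rcases hb with rfl | rfl
      · exact ⟨_, rfl⟩
      · exact ⟨_, rfl⟩
      · exact ⟨_, mul_comm _ _⟩
      · exact ⟨w, by rw [← hz, pow_two]⟩
    · rw [Ideal.span_singleton_le_iff_mem]
      have e : p = α * (p * p) + β * (p * z) + γ * (z * z) := by linear_combination (-p) * h1 - γ * hz
      have hp' : p ∈ Ideal.span {p, z} := Ideal.subset_span (by simp)
      have hz' : z ∈ Ideal.span {p, z} := Ideal.subset_span (by simp)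
      rw [pow_two]
      have m1 := Ideal.mul_mem_left _ α (Ideal.mul_mem_mul hp' hp')
      have m2 := Ideal.mul_mem_left _ β (Ideal.mul_mem_mul hp' hz')
      have m3 := Ideal.mul_mem_left _ γ (Ideal.mul_mem_mul hz' hz')
      have m4 := Ideal.add_mem _ (Ideal.add_mem _ m1 m2) m3
      rwa [← e] at m4
  refine ⟨⟨Ideal.span {p, z}, nzd ?_⟩, h2⟩
  intro h0
  rw [h0] at h2
  exact span_ne hp (by rw [← h2]; simp)

lemma exists_root (h : QF k d x) (hd : d % 4 = 2 ∨ d % 4 = 3) {p : ℕ} (hp : p.Prime) (hpd : (p : ℤ) ∣ 2 * d) :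
    ∃ J : (Ideal (𝓞 k))⁰, (J : Ideal (𝓞 k)) ^ 2 = Ideal.span {((p : ℕ) : 𝓞 k)} := by
  have hp0 : (p : 𝓞 k) ≠ 0 := by exact_mod_cast hp.ne_zero
  by_cases h1 : (p : ℤ) ∣ d
  · obtain ⟨w, hw⟩ := h1
    have hc : IsCoprime (p : ℤ) w := by
      rw [Prime.coprime_iff_not_dvd (Nat.prime_iff_prime_int.1 hp)]
      rintro ⟨w', rfl⟩
      have := h.sf p ⟨w', by rw [hw]; ring⟩
      exact (Nat.prime_iff_prime_int.1 hp).not_isUnit this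
    obtain ⟨a, b, hab⟩ := hc
    refine root_ideal (p : 𝓞 k) h.X w a 0 b hp0 ?_ ?_
    · rw [h.X_sq, hw]; push_cast; ring
    · have : (((a * p + b * w : ℤ)) : 𝓞 k) = 1 := by rw [hab]; simp
      push_cast at this
      linear_combination this
  · have h2 : (p : ℤ) ∣ 2 := ((Nat.prime_iff_prime_int.1 hp).dvd_or_dvd hpd).resolve_right h1
    have h3 : p = 2 := by
      have : p ∣ 2 := by exact_mod_cast h2
      exact (Nat.prime_dvd_prime_iff_eq hp Nat.prime_two).1 this
    subst h3
    have h4 : d % 4 = 3 := by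
      rcases hd with h | h
      · exfalso; apply h1; push_cast; omega
      · exact h
    obtain ⟨f, hf⟩ : ∃ f, d = 4 * f + 3 := ⟨d / 4, by omega⟩
    refine root_ideal ((2 : ℕ) : 𝓞 k) (1 + h.X) ((2 * f + 2 : ℤ) + h.X) (-f : ℤ) (-1) 1 hp0 ?_ ?_
    · have := h.X_sq
      have h5 : (d : 𝓞 k) = 4 * f + 3 := by rw [hf]; push_cast; rfl
      rw [h5] at this
      push_cast
      linear_combination this
    · push_cast; ring
end QF
end

section
open NumberField Module nonZeroDivisors
set_option linter.unusedSectionVars false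
set_option linter.unusedVariables false

section
variable {k : Type*} [Field k] [NumberField k]

/-- up to squares, the class of the square root of `(m)` lies in `A` -/
def RT (A : Subgroup (ClassGroup (𝓞 k))) (m : ℕ) : Prop := ∃ m' w, TrA A m' ∧ m * m' = w ^ 2

variable {A : Subgroup (ClassGroup (𝓞 k))}

lemma TrA.rt {m : ℕ} (h : TrA A m) : RT A m := ⟨m, m, h, (pow_two m).symm⟩

lemma RT.one : RT A 1 := TrA.one.rt

lemma RT.mul {m n : ℕ} (h1 : RT A m) (h2 : RT A n) : RT A (m * n) := by
  obtain ⟨m', w, h1, h3⟩ := h1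
  obtain ⟨n', v, h2, h4⟩ := h2
  exact ⟨m' * n', w * v, h1.mul h2, by rw [mul_pow, ← h3, ← h4]; ring⟩

lemma RT.div {m n : ℕ} (h1 : RT A (m * n)) (h2 : RT A n) (hn : n ≠ 0) : RT A m := by
  obtain ⟨m', w, h1, h3⟩ := h1
  obtain ⟨n', v, h2, h4⟩ := h2
  have h5 : m * (m' * n') * n ^ 2 = (w * v) ^ 2 := by rw [mul_pow, ← h3, ← h4]; ring
  have h6 : n ∣ w * v := by
    rw [← Nat.pow_dvd_pow_iff two_ne_zero, ← h5]; exact dvd_mul_left _ _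
  obtain ⟨t, ht⟩ := h6
  refine ⟨m' * n', t, h1.mul h2, ?_⟩
  rw [ht] at h5
  have h7 : n ^ 2 * (m * (m' * n')) = n ^ 2 * t ^ 2 := by rw [mul_comm, h5]; ring
  exact Nat.eq_of_mul_eq_mul_left (by positivity) h7

lemma RT.all {M : ℕ} (h : ∀ p : ℕ, p.Prime → p ∣ M → RT A p) (m : ℕ) (hm : Squarefree m) (hmM : m ∣ M) : RT A m := by
  rw [← Nat.prod_primeFactors_of_squarefree hm]
  exact Finset.prod_induction _ (RT A) (fun _ _ h1 h2 => h1.mul h2) RT.one fun p hp =>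
    h p (Nat.prime_of_mem_primeFactors hp) ((Nat.dvd_of_mem_primeFactors hp).trans hmM)

lemma card_sat {G : Type*} [CommGroup G] [Finite G] (H : Subgroup G) (hs : ∀ x, x ^ 2 ∈ H → x ∈ H) : ∃ n, ¬ 2 ∣ n ∧ Nat.card G = Nat.card H * n :=
  ⟨H.index, UB.odd_index H Subgroup.index_ne_zero_of_finite hs, H.card_mul_index.symm⟩

/-- the four group spanned by two involutions -/
def four {G : Type*} [CommGroup G] (a b : G) (ha : a ^ 2 = 1) (hb : b ^ 2 = 1) : Subgroup G where
  carrier := {x | ∃ i j : ℕ, x = a ^ i * b ^ j}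
  mul_mem' := by
    rintro _ _ ⟨i, j, rfl⟩ ⟨i', j', rfl⟩
    exact ⟨i + i', j + j', by rw [pow_add, pow_add, mul_mul_mul_comm]⟩
  one_mem' := ⟨0, 0, by simp⟩
  inv_mem' := by
    rintro _ ⟨i, j, rfl⟩
    refine ⟨i, j, inv_eq_of_mul_eq_one_left ?_⟩
    rw [mul_mul_mul_comm, ← mul_pow, ← mul_pow, ← pow_two, ← pow_two, ha, hb]; simp

lemma four_cases {G : Type*} [CommGroup G] {a b : G} {ha : a ^ 2 = 1} {hb : b ^ 2 = 1} {x : G} (hx : x ∈ four a b ha hb) :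
    x = 1 ∨ x = a ∨ x = b ∨ x = a * b := by
  obtain ⟨i, j, rfl⟩ := hx
  rw [pow_eq_pow_mod i ha, pow_eq_pow_mod j hb]
  rcases Nat.mod_two_eq_zero_or_one i with h | h <;> rcases Nat.mod_two_eq_zero_or_one j with h' | h' <;> rw [h, h'] <;> simp

lemma four_card {G : Type*} [CommGroup G] {a b : G} {ha : a ^ 2 = 1} {hb : b ^ 2 = 1} (h1 : a ≠ 1) (h2 : b ≠ 1) (h3 : a * b ≠ 1) :
    Nat.card (four a b ha hb) = 4 := by
  classical
  have h4 : ((four a b ha hb : Subgroup G) : Set G) = (({1, a, b, a * b} : Finset G) : Set G) := by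
    ext x
    simp only [SetLike.mem_coe, Finset.coe_insert, Finset.coe_singleton, Set.mem_insert_iff, Set.mem_singleton_iff]
    constructor
    · exact four_cases
    · rintro (rfl | rfl | rfl | rfl)
      · exact one_mem _
      · exact ⟨1, 0, by simp⟩
      · exact ⟨0, 1, by simp⟩
      · exact ⟨1, 1, by simp⟩
  have h5 : a ≠ b := by rintro rfl; exact h3 (by rw [← pow_two, ha])
  change Nat.card ((four a b ha hb : Subgroup G) : Set G) = 4
  rw [h4, Nat.card_coe_set_eq, Set.ncard_coe_finset]
  rw [Finset.card_insert_of_notMem, Finset.card_insert_of_notMem, Finset.card_insert_of_notMem, Finset.card_singleton]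
  · simpa using h1
  · simp [h5, h2]
  · simp only [Finset.mem_insert, Finset.mem_singleton, not_or]
    exact ⟨h1.symm, h2.symm, h3.symm⟩

end

namespace QF
variable {k : Type*} [Field k] [NumberField k] {d : ℤ} {x : k}

lemma rt_d (h : QF k d x) {A : Subgroup (ClassGroup (𝓞 k))} {D : ℕ} (hD : (D : ℤ) = d) : RT A D := by
  have hg := h.gt
  refine (TrA.of_sq (by rintro rfl; simp at hD; omega) 1 ⟨x, ?_⟩).rt
  rw [h.sq, ← hD]; simp

lemma h_odd (h : QF k d x) (hd : d % 4 = 2 ∨ d % 4 = 3)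
    (HT : ∀ A : Subgroup (ClassGroup (𝓞 k)), ∀ p : ℕ, p.Prime → p ∣ (2 * d).natAbs → RT A p)
    (HN : (∃ u v : ℤ, u ^ 2 - d * v ^ 2 = -1) ∨ (∀ u v n : ℤ, n ≠ 0 → u ^ 2 - d * v ^ 2 ≠ - n ^ 2)) :
    ¬ 2 ∣ classNumber k := by
  obtain ⟨n, hn, hc⟩ := card_sat (⊥ : Subgroup (ClassGroup (𝓞 k))) fun y hy => 
    h.two_tors hd (RT.all (HT ⊥)) HN y (by simpa using hy)
  rw [classNumber, ← Nat.card_eq_fintype_card, hc]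
  simpa using hn

lemma h_four (h : QF k d x) (hd : d % 4 = 2 ∨ d % 4 = 3) (r : ℕ) [hr : Fact r.Prime] (hrd : (r : ℤ) ∣ d)
    (HT : ∀ A : Subgroup (ClassGroup (𝓞 k)), RT A 2 → RT A r → ∀ p : ℕ, p.Prime → p ∣ (2 * d).natAbs → RT A p)
    (HN : (∃ u v : ℤ, u ^ 2 - d * v ^ 2 = -1) ∨ (∀ u v n : ℤ, n ≠ 0 → u ^ 2 - d * v ^ 2 ≠ - n ^ 2))
    (HS : ∀ m : ℕ, m = 2 ∨ m = r ∨ m = 2 * r → ∀ u v n δ : ℤ, n ≠ 0 → (δ = 1 ∨ δ = -1) → u ^ 2 - d * v ^ 2 ≠ δ * m * n ^ 2) :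
    ∃ n, ¬ 2 ∣ n ∧ classNumber k = 4 * n := by
  obtain ⟨J, hJ⟩ := h.exists_root hd Nat.prime_two (by exact_mod_cast dvd_mul_right 2 d)
  obtain ⟨L, hL⟩ := h.exists_root hd hr.out (hrd.mul_left 2)
  have hJL : ((J * L : (Ideal (𝓞 k))⁰) : Ideal (𝓞 k)) ^ 2 = Ideal.span {((2 * r : ℕ) : 𝓞 k)} := by
    rw [Submonoid.coe_mul, mul_pow, hJ, hL, Ideal.span_singleton_mul_span_singleton]; push_cast; rfl
  have sJ := h.non_sq hd J hJ (HS 2 (by simp))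
  have sL := h.non_sq hd L hL (HS r (by simp))
  have sJL := h.non_sq hd (J * L) hJL (HS (2 * r) (by simp))
  rw [map_mul] at sJL
  have qJ : ClassGroup.mk0 J ^ 2 = 1 := by
    rw [← map_pow]; exact mk0_span (by rw [SubmonoidClass.coe_pow]; exact hJ)
  have qL : ClassGroup.mk0 L ^ 2 = 1 := by
    rw [← map_pow]; exact mk0_span (by rw [SubmonoidClass.coe_pow]; exact hL)
  set a := ClassGroup.mk0 J with ha
  set b := ClassGroup.mk0 L with hb
  have h2 : RT (four a b qJ qL) 2 := TrA.rt ⟨J, hJ, 1, 0, by rw [pow_one, pow_zero, mul_one]⟩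
  have hr : RT (four a b qJ qL) r := TrA.rt ⟨L, hL, 0, 1, by rw [pow_zero, pow_one, one_mul]⟩
  obtain ⟨n, hn, hc⟩ := card_sat (four a b qJ qL) fun y hy => by
    rcases four_cases hy with h1 | h1 | h1 | h1
    · exact h.two_tors hd (RT.all (HT _ h2 hr)) HN y h1
    · exact (sJ y h1).elim
    · exact (sL y h1).elim
    · exact (sJL y h1).elim
  rw [four_card (fun h => sJ 1 (by rw [h, one_pow])) (fun h => sL 1 (by rw [h, one_pow])) (fun h => sJL 1 (by rw [h, one_pow]))] at hc
  exact ⟨n, hn, by rw [classNumber, ← Nat.card_eq_fintype_card, hc]⟩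
end QF

namespace Ar
variable {q r s Q Q' : ℕ} [hqf : Fact q.Prime] [hrf : Fact r.Prime] [hsf : Fact s.Prime]
variable {k : Type*} [Field k] [NumberField k] {x : k}

lemma HN (h : Ar q r s Q Q') {d : ℤ} (hd : (q : ℤ) ∣ d) (hd2 : ¬ (q : ℤ) ^ 2 ∣ d) (u v n : ℤ) (hn : n ≠ 0) : u ^ 2 - d * v ^ 2 ≠ - n ^ 2 := by
  intro he
  have := sym_ls q d (-1) n u v hd hd2 (not_dvd_of_ls q _ (by rw [h.qn]; norm_num)) hn (by rw [he]; ring)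
  rw [h.qn] at this
  norm_num at this

lemma exists_fd {d : ℤ} (h : QF k d x) (φ : k →+* ℝ) : ∃ ε : (𝓞 k)ˣ, Fd φ ε ∧ ∃ u v : ℚ, ((ε : 𝓞 k) : k) = u + v * x := by
  obtain ⟨ε, h1, h2, h3⟩ := h.exists_fund φ
  obtain ⟨u, v, huv⟩ := h.exists_coord ((ε : 𝓞 k) : k)
  exact ⟨ε, ⟨h1, h2⟩, u, v, huv⟩

lemma prime_cases {p a b : ℕ} (hp : p.Prime) (hb : b.Prime) (h : p ∣ a * b) : p ∣ a ∨ p = b :=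
  (hp.dvd_mul.1 h).imp_right (Nat.prime_dvd_prime_iff_eq hp hb).1

lemma h_2 (hk : QF k ((2 : ℕ) : ℤ) x) : ¬ 2 ∣ classNumber k := by
  refine hk.h_odd (by norm_num) (fun A p hp hpd => ?_) (Or.inl ⟨1, 1, by norm_num⟩)
  have : p = 2 := by
    have h1 : p ∣ 2 * 2 := by simpa using hpd
    rcases prime_cases hp Nat.prime_two h1 with h1 | h1
    · exact (Nat.prime_dvd_prime_iff_eq hp Nat.prime_two).1 h1
    · exact h1
  rw [this]
  exact hk.rt_d rfl

lemma h_q (h : Ar q r s Q Q') {D0 : ℕ} (hD : D0 = Q ∨ D0 = Q') (hk : QF k (D0 : ℤ) x) (φ : k →+* ℝ) : ¬ 2 ∣ classNumber k := by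
  obtain ⟨h1, h2, -, h3⟩ := h.q_dvd hD
  have q4 := h.q4
  obtain ⟨ε, hf, u, v, huv⟩ := exists_fd hk φ
  obtain ⟨-, y, hy⟩ := h.fund_Q hD hk φ ε hf u v huv
  refine hk.h_odd (by rcases h3 with h | h <;> rw [h] <;> push_cast <;> omega) (fun A p hp hpd => ?_) (Or.inr (h.HN h1 h2))
  have R2 : RT A 2 := (TrA.of_sq two_ne_zero ε ⟨y, by exact_mod_cast hy⟩).rt
  have RD : RT A D0 := hk.rt_d rfl
  have Rq : RT A q := by
    rcases h3 with h | h
    · rwa [h] at RD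
    · rw [h, mul_comm] at RD
      exact RD.div R2 two_ne_zero
  have h5 : p ∣ 2 * 2 * q := by
    have h5 : p ∣ 2 * D0 := by simpa [Int.natAbs_mul] using hpd
    refine h5.trans ?_
    rcases h3 with h | h <;> rw [h]
    · exact ⟨2, by ring⟩
    · exact ⟨1, by ring⟩
  rcases prime_cases hp hqf.out h5 with h6 | rfl
  · rcases prime_cases hp Nat.prime_two h6 with h7 | rfl
    · rw [(Nat.prime_dvd_prime_iff_eq hp Nat.prime_two).1 h7]; exact R2
    · exact R2
  · exact Rq

lemma HS (h : Ar q r s Q Q') {D0 : ℕ} (hD : D0 = 2 ∨ D0 = Q') (m : ℕ) (hm : m = 2 ∨ m = r ∨ m = 2 * r) (u v n δ : ℤ) (hn : n ≠ 0) (hδ : δ = 1 ∨ δ = -1) :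
    u ^ 2 - (D0 * r * s : ℤ) * v ^ 2 ≠ δ * m * n ^ 2 := by
  intro he
  have hD' : D0 = 1 ∨ D0 = Q ∨ D0 = 2 ∨ D0 = Q' := by tauto
  have q3 : 3 ≤ q := by have := h.q4; omega
  have hQ2 : 2 ≠ Q ∧ 2 ≠ Q' ∧ 1 ≠ Q' ∧ 1 ≠ Q := by
    rcases h.hQ with ⟨h1, h2⟩ | ⟨h1, h2⟩ <;> rw [h1, h2] <;> have := h.q4 <;> refine ⟨?_, ?_, ?_, ?_⟩ <;> omega
  rcases hm with rfl | rfl | rfl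
  · have h1 := (h.classify (M0 := 2) (c := 0) (e := 0) hD' (by simp) (by simp) (by simp) δ hδ n u v hn (by rw [he]; push_cast; ring)).2 hD
    rcases h1 with h1 | h1
    · rcases h1.1 with h | h
      · omega
      · exact hQ2.1 h
    · omega
  · have h1 := (h.classify (M0 := 1) (c := 1) (e := 0) hD' (by simp) (by simp) (by simp) δ hδ n u v hn (by rw [he]; push_cast; ring)).2 hD
    omega
  · have h1 := (h.classify (M0 := 2) (c := 1) (e := 0) hD' (by simp) (by simp) (by simp) δ hδ n u v hn (by rw [he]; push_cast; ring)).2 hD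
    omega

lemma rs_mod (h : Ar q r s Q Q') : ((r : ℤ) * s) % 4 = 1 := by
  have h1 := h.r8
  have h2 := h.s8
  rw [Int.mul_emod, show (r : ℤ) % 4 = 1 by omega, show (s : ℤ) % 4 = 1 by omega]; rfl

lemma h_2rs (h : Ar q r s Q Q') (hk : QF k (((2 : ℕ) : ℤ) * r * s) x) (φ : k →+* ℝ) : ∃ n, ¬ 2 ∣ n ∧ classNumber k = 4 * n := by
  obtain ⟨ε, hf, u, v, huv⟩ := exists_fd hk φ
  have h1 := h.fund_2rs hk φ ε hf u v huv
  have hd : (((2 : ℕ) : ℤ) * r * s) % 4 = 2 ∨ (((2 : ℕ) : ℤ) * r * s) % 4 = 3 := by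
    left
    have := h.rs_mod
    push_cast
    rw [mul_assoc]
    omega
  refine hk.h_four hd r ⟨2 * s, by push_cast; ring⟩ ?_ (Or.inl ?_) (h.HS (Or.inl rfl))
  · intro A R2 Rr p hp hpd
    have RD : RT A (s * (2 * r)) := hk.rt_d (by push_cast; ring)
    have Rs : RT A s := RD.div (R2.mul Rr) (by have := hrf.out.pos; positivity)
    have h5 : p ∣ 2 * 2 * r * s := by
      have h5 : p ∣ 2 * (2 * r * s) := by simpa [Int.natAbs_mul] using hpd
      rwa [show 2 * 2 * r * s = 2 * (2 * r * s) by ring]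
    rcases prime_cases hp hsf.out h5 with h6 | rfl
    · rcases prime_cases hp hrf.out h6 with h6 | rfl
      · rcases prime_cases hp Nat.prime_two h6 with h7 | rfl
        · rw [(Nat.prime_dvd_prime_iff_eq hp Nat.prime_two).1 h7]; exact R2
        · exact R2
      · exact Rr
    · exact Rs
  · obtain ⟨a, b, hab⟩ := hk.int_coord' hd (ε : 𝓞 k)
    have h2 := hk.coord_inj (u := u) (v := v) (u' := a) (v' := b) (by rw [← huv, hab]; push_cast; rfl)
    rw [h2.1, h2.2] at h1
    exact ⟨a, b, by exact_mod_cast h1⟩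

lemma h_Q'rs (h : Ar q r s Q Q') (hk : QF k ((Q' : ℤ) * r * s) x) (φ : k →+* ℝ) : ∃ n, ¬ 2 ∣ n ∧ classNumber k = 4 * n := by
  obtain ⟨h1, -, h2, h3⟩ := h.q_dvd (Or.inr rfl : Q' = Q ∨ Q' = Q')
  obtain ⟨ε, hf, u, v, huv⟩ := exists_fd hk φ
  obtain ⟨-, y, hy⟩ := h.fund_Q'rs hk φ ε hf u v huv
  have q4 := h.q4
  have hq0 := hqf.out.pos
  have hr0 := hrf.out.pos
  have hd : ((Q' : ℤ) * r * s) % 4 = 2 ∨ ((Q' : ℤ) * r * s) % 4 = 3 := by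
    have := h.rs_mod
    rw [mul_assoc, Int.mul_emod, this, mul_one, Int.emod_emod]
    rcases h3 with h | h <;> rw [h] <;> push_cast <;> omega
  refine hk.h_four hd r ⟨Q' * s, by ring⟩ ?_ (Or.inr (h.HN ((h1.mul_right _).mul_right _) h2)) (h.HS (Or.inr rfl))
  intro A R2 Rr p hp hpd
  have hQ0 : Q ≠ 0 := by rcases h.hQ with ⟨h1, h2⟩ | ⟨h1, h2⟩ <;> omega
  have RQ : RT A Q := (TrA.of_sq hQ0 ε ⟨y, hy⟩).rt
  have Rq : RT A q := by
    rcases h.hQ with ⟨h1, h2⟩ | ⟨h1, h2⟩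
    · rwa [h1] at RQ
    · rw [h1, mul_comm] at RQ
      exact RQ.div R2 two_ne_zero
  have RQ' : RT A Q' := by
    rcases h3 with h | h <;> rw [h]
    · exact Rq
    · exact R2.mul Rq
  have RD : RT A (s * (Q' * r)) := hk.rt_d (by push_cast; ring)
  have Rs : RT A s := RD.div (RQ'.mul Rr) (by have : 0 < Q' := (by rcases h3 with h | h <;> omega); positivity)
  have h5 : p ∣ 2 * 2 * q * r * s := by
    have h5 : p ∣ 2 * (Q' * r * s) := by simpa [Int.natAbs_mul] using hpd
    refine h5.trans ?_
    rcases h3 with h | h <;> rw [h]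
    · exact ⟨2, by ring⟩
    · exact ⟨1, by ring⟩
  rcases prime_cases hp hsf.out h5 with h6 | rfl
  · rcases prime_cases hp hrf.out h6 with h6 | rfl
    · rcases prime_cases hp hqf.out h6 with h6 | rfl
      · rcases prime_cases hp Nat.prime_two h6 with h7 | rfl
        · rw [(Nat.prime_dvd_prime_iff_eq hp Nat.prime_two).1 h7]; exact R2
        · exact R2
      · exact Rq
    · exact Rr
  · exact Rs
end Ar
end

section
open NumberField Module
set_option linter.unusedSectionVars false
set_option linter.unusedVariables false

section
variable {k : Type*} [Field k] [NumberField k]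

lemma QF.pell {d : ℤ} {x : k} (hk : QF k d x) (hd : d % 4 = 2 ∨ d % 4 = 3) (φ : k →+* ℝ) (hx : 0 < φ x)
    (ε : (𝓞 k)ˣ) (hf : Fd φ ε) (u v : ℚ) (huv : ((ε : 𝓞 k) : k) = u + v * x) (hN : u ^ 2 - d * v ^ 2 = 1)
    (γ γ' : ℤ) (hγ : 0 < γ) (hγ' : 0 < γ')
    (hPell : γ ^ 2 - d * γ' ^ 2 = 1)
    (hfund : ∀ a b : ℤ, 0 < a → 0 < b → a ^ 2 - d * b ^ 2 = 1 → γ ≤ a) : u = γ := by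
  obtain ⟨A, B, hab⟩ := hk.int_coord' hd (ε : 𝓞 k)
  have h2 := hk.coord_inj (u := u) (v := v) (u' := A) (v' := B) (by rw [← huv, hab]; push_cast; rfl)
  rw [h2.1, h2.2] at hN
  have hN' : A ^ 2 - d * B ^ 2 = 1 := by exact_mod_cast hN
  have hNr : (A : ℝ) ^ 2 - d * B ^ 2 = 1 := by exact_mod_cast hN'
  have hPr : (γ : ℝ) ^ 2 - d * γ' ^ 2 = 1 := by exact_mod_cast hPell
  set y := φ x with hy
  have hy2 : y ^ 2 = d := by rw [hy, ← map_pow, hk.sq]; simp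
  have he : φ ((ε : 𝓞 k) : k) = A + B * y := by rw [hab]; simp [hy]
  have hgt := hf.gt
  change 1 < φ ((ε : 𝓞 k) : k) at hgt
  have hgt' := hgt
  rw [he] at hgt'
  have hm : ((A : ℝ) + B * y) * (A - B * y) = 1 := by linear_combination hNr - (B : ℝ) ^ 2 * hy2
  have h3 : 0 < (A : ℝ) - B * y := by
    by_contra hc
    nlinarith
  have h4 : (A : ℝ) - B * y < 1 := by
    by_contra hc
    nlinarith
  have hA : 0 < A := by
    have : (0 : ℝ) < A := by linarith
    exact_mod_cast this
  have hB : 0 < B := by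
    have : (0 : ℝ) < B * y := by linarith
    have := (mul_pos_iff_of_pos_right hx).1 this
    exact_mod_cast this
  have h5 := hfund A B hA hB hN'
  -- the Pell unit
  have hXs := hk.X_sq
  let g : (𝓞 k)ˣ := ⟨(γ : 𝓞 k) + γ' * hk.X, (γ : 𝓞 k) - γ' * hk.X, by
      have : ((γ ^ 2 - d * γ' ^ 2 : ℤ) : 𝓞 k) = 1 := by rw [hPell]; simp
      push_cast at this
      linear_combination this - (γ' : 𝓞 k) ^ 2 * hXs, by
      have : ((γ ^ 2 - d * γ' ^ 2 : ℤ) : 𝓞 k) = 1 := by rw [hPell]; simp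
      push_cast at this
      linear_combination this - (γ' : 𝓞 k) ^ 2 * hXs⟩
  have hg : φ ((g : 𝓞 k) : k) = γ + γ' * y := by
    have : ((g : 𝓞 k) : k) = γ + γ' * x := by
      have : ((g : 𝓞 k) : k) = (((γ : 𝓞 k) + γ' * hk.X : 𝓞 k) : k) := rfl
      rw [this]
      simp [hk.coe_X]
    rw [this]; simp [hy]
  have hγr : (1 : ℝ) ≤ γ := by exact_mod_cast hγ
  have hγr' : (0 : ℝ) < γ' := by exact_mod_cast hγ'
  have hg1 : 1 < φ ((g : 𝓞 k) : k) := by rw [hg]; nlinarith [mul_pos hγr' hx]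
  have hz : ∀ n : ℤ, φ (((ε ^ n : (𝓞 k)ˣ) : 𝓞 k) : k) = φ ((ε : 𝓞 k) : k) ^ n := by
    intro n
    have h1 := map_zpow (Units.map ((φ.comp (algebraMap (𝓞 k) k)) : 𝓞 k →* ℝ)) ε n
    have h2 := congrArg (fun z : ℝˣ => (z : ℝ)) h1
    simp only [Units.val_zpow_eq_zpow_val] at h2
    exact h2
  have hle : φ ((ε : 𝓞 k) : k) ≤ φ ((g : 𝓞 k) : k) := by
    obtain ⟨n, hn | hn⟩ := hf.gen g
    · rw [hn, hz] at hg1 ⊢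
      have hn0 : 0 < n := by
        by_contra hc
        have := zpow_le_one_of_nonpos₀ hgt.le (not_lt.1 hc)
        linarith
      calc _ = φ ((ε : 𝓞 k) : k) ^ (1 : ℤ) := by simp
        _ ≤ _ := zpow_le_zpow_right₀ hgt.le hn0
    · exfalso
      rw [hn] at hg1
      have : φ (((-ε ^ n : (𝓞 k)ˣ) : 𝓞 k) : k) = - φ (((ε ^ n : (𝓞 k)ˣ) : 𝓞 k) : k) := by
        simp
      rw [this, hz] at hg1
      have := zpow_pos (lt_trans one_pos hgt) n
      linarith
  rw [he, hg] at hle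
  have : A = γ := by
    refine le_antisymm ?_ h5
    by_contra hc
    have hc : γ < A := not_le.1 hc
    have : γ' < B := by
      by_contra h6
      have hd0 : 0 < d := by have := hk.gt; omega
      have h6 : B ≤ γ' := not_lt.1 h6
      have h7 : B ^ 2 ≤ γ' ^ 2 := by nlinarith
      nlinarith
    have h8 : (γ : ℝ) < A := by exact_mod_cast hc
    have h9 : (γ' : ℝ) < B := by exact_mod_cast this
    nlinarith
  rw [h2.1, this]

variable {q r s : ℕ} [hqf : Fact q.Prime] [hrf : Fact r.Prime] [hsf : Fact s.Prime]

lemma Ar.H5 {η Q' : ℕ} {x : k} (hη : η = 1 ∨ η = 2) (h : Ar q r s (η * q) Q') (hk : QF k (((η * q : ℕ) : ℤ) * r * s) x) (φ : k →+* ℝ) (hx : 0 < φ x)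
    (γ γ' : ℤ) (hγ : 0 < γ) (hγ' : 0 < γ')
    (hPell : γ ^ 2 - (η * q * r * s : ℕ) * γ' ^ 2 = 1)
    (hfund : ∀ a b : ℤ, 0 < a → 0 < b → a ^ 2 - (η * q * r * s : ℕ) * b ^ 2 = 1 → γ ≤ a)
    (hnsq : ¬ ∃ t : ℤ, 2 ^ (if η = 1 then 1 else 0) * (q : ℤ) * (γ - 1) = t ^ 2)
    (ε : (𝓞 k)ˣ) (u v : ℚ) (hf : Fd φ ε) (huv : ((ε : 𝓞 k) : k) = u + v * x) :
    ¬ ∃ t : ℤ, t ≠ 0 ∧ 2 + 2 * u = r * s * t ^ 2 := by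
  rintro ⟨t, ht0, ht⟩
  obtain ⟨h1, -, h2, h3⟩ := h.q_dvd (Or.inl rfl : η * q = η * q ∨ η * q = Q')
  have q4 := h.q4
  have hd : (((η * q : ℕ) : ℤ) * r * s) % 4 = 2 ∨ (((η * q : ℕ) : ℤ) * r * s) % 4 = 3 := by
    have := h.rs_mod
    rw [mul_assoc, Int.mul_emod, this, mul_one, Int.emod_emod]
    rcases h3 with h | h <;> rw [h] <;> push_cast <;> omega
  have hN := h.norm_one ((h1.mul_right _).mul_right _) h2 hk ε u v huv
  have hD : ((η * q * r * s : ℕ) : ℤ) = ((η * q : ℕ) : ℤ) * r * s := by push_cast; ring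
  rw [hD] at hPell
  have hu := hk.pell hd φ hx ε hf u v huv hN γ γ' hγ hγ' hPell (fun a b ha hb hab => hfund a b ha hb (by rw [hD]; exact hab))
  rw [hu] at ht
  have ht' : 2 + 2 * γ = r * s * t ^ 2 := by exact_mod_cast ht
  have hr0 : (r : ℤ) ≠ 0 := by exact_mod_cast hrf.out.ne_zero
  have hs0 : (s : ℤ) ≠ 0 := by exact_mod_cast hsf.out.ne_zero
  push_cast at hPell
  have h5 : t ^ 2 * (γ - 1) = 2 * (η * q) * γ' ^ 2 := by
    apply mul_left_cancel₀ (mul_ne_zero hr0 hs0)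
    linear_combination 2 * hPell - (γ - 1) * ht'
  have h6 : t ^ 2 * (2 * (η * q) * (γ - 1)) = (2 * (η * q) * γ') ^ 2 := by
    linear_combination (2 * (η * q) : ℤ) * h5
  have h7 : t ∣ 2 * (η * q) * γ' := by
    rw [← Int.pow_dvd_pow_iff two_ne_zero, ← h6]
    exact dvd_mul_right _ _
  obtain ⟨w, hw⟩ := h7
  have h8 : (2 * (η * q) * (γ - 1)) = w ^ 2 := by
    apply mul_left_cancel₀ (pow_ne_zero 2 ht0)
    rw [h6, hw]; ring
  rcases hη with rfl | rfl
  · exact hnsq ⟨w, by rw [← h8]; simp⟩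
  · have : (2 : ℤ) ∣ w := by
      apply Int.prime_two.dvd_of_dvd_pow (n := 2)
      rw [← h8]
      exact ⟨2 * q * (γ - 1), by push_cast; ring⟩
    obtain ⟨z, rfl⟩ := this
    refine hnsq ⟨z, ?_⟩
    push_cast at h8
    norm_num
    linarith
end
end

section
open IntermediateField NumberField

lemma QF.card_adjoin {k : Type*} [Field k] [NumberField k] {d : ℤ} {x : k} (hk : QF k d x) (φ : k →+* ℝ) (y : ℝ) (hy : φ x = y) :
    Nat.card (ClassGroup (𝓞 (IntermediateField.adjoin ℚ {y} : IntermediateField ℚ ℝ))) = classNumber k := by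
  have hm : ∀ z, φ z ∈ (IntermediateField.adjoin ℚ {y} : IntermediateField ℚ ℝ) := by
    intro z
    obtain ⟨u, v, rfl⟩ := hk.exists_coord z
    rw [map_add, map_mul, map_ratCast, map_ratCast, hy]
    have h1 : ∀ u : ℚ, (u : ℝ) ∈ (IntermediateField.adjoin ℚ {y} : IntermediateField ℚ ℝ) := fun u => by
      have := (IntermediateField.adjoin ℚ {y} : IntermediateField ℚ ℝ).algebraMap_mem u
      exact this
    exact add_mem (h1 u) (mul_mem (h1 v) (IntermediateField.mem_adjoin_simple_self ℚ y))
  let f : k →+* (IntermediateField.adjoin ℚ {y} : IntermediateField ℚ ℝ) := φ.codRestrict _ hm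
  have hf : ∀ z, ((f z : (IntermediateField.adjoin ℚ {y} : IntermediateField ℚ ℝ)) : ℝ) = φ z := fun z => rfl
  have hs : Function.Surjective f := by
    rintro ⟨z, hz⟩
    suffices ∃ w, φ w = z by
      obtain ⟨w, hw⟩ := this
      exact ⟨w, Subtype.ext hw⟩
    induction hz using IntermediateField.adjoin_induction with
    | mem w hx' => exact ⟨x, by rw [hy]; exact (Set.mem_singleton_iff.1 hx').symm⟩
    | algebraMap x => exact ⟨(x : k), by simp⟩
    | add x y _ _ h1 h2 => obtain ⟨a, rfl⟩ := h1; obtain ⟨b, rfl⟩ := h2; exact ⟨a + b, map_add _ _ _⟩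
    | inv x _ h1 => obtain ⟨a, rfl⟩ := h1; exact ⟨a⁻¹, map_inv₀ _ _⟩
    | mul x y _ _ h1 h2 => obtain ⟨a, rfl⟩ := h1; obtain ⟨b, rfl⟩ := h2; exact ⟨a * b, map_mul _ _ _⟩
  have e := RingEquiv.ofBijective f ⟨f.injective, hs⟩
  have g := ClassGroup.mulEquiv (NumberField.RingOfIntegers.mapRingEquiv e)
  rw [classNumber, ← Nat.card_eq_fintype_card]
  exact (Nat.card_congr g.toEquiv).symm

lemma final_arith {n hK a0 a1 a2 a3 n4 a5 n6 : ℕ} (hn : ¬ 2 ∣ n) (h0 : ¬ 2 ∣ a0) (h1 : ¬ 2 ∣ a1) (h2 : ¬ 2 ∣ a2)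
    (h4 : ¬ 2 ∣ n4) (h6 : ¬ 2 ∣ n6) (hK0 : hK ≠ 0) (h30 : a3 ≠ 0) (h50 : a5 ≠ 0)
    (h : 32 * hK = n * (a0 * a1 * a2 * a3 * (4 * n4) * a5 * (4 * n6))) :
    2 * 2 ^ (hK.factorization 2) = 2 ^ (a3.factorization 2) * 2 ^ (a5.factorization 2) := by
  have hp := Nat.prime_two
  have h7 : 2 * hK = (n * a0 * a1 * a2 * n4 * n6) * (a3 * a5) := by linarith
  have hodd : ¬ 2 ∣ n * a0 * a1 * a2 * n4 * n6 := by
    simp only [hp.dvd_mul]; tauto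
  have h8 := congrArg (fun z => z.factorization 2) h7
  have hne : n * a0 * a1 * a2 * n4 * n6 ≠ 0 := by rintro h; rw [h] at hodd; simp at hodd
  rw [Nat.factorization_mul two_ne_zero hK0, Nat.factorization_mul hne (mul_ne_zero h30 h50), Nat.factorization_mul h30 h50] at h8
  simp only [Finsupp.add_apply, hp.factorization_self, Nat.factorization_eq_zero_of_not_dvd hodd, zero_add] at h8
  rw [← pow_add, ← h8, pow_add, pow_one]

lemma KA.two_h {η q r s : ℕ} [Fact q.Prime] [Fact r.Prime] [Fact s.Prime]
    (hη : η = 1 ∨ η = 2)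
    (γ γ' : ℤ) (hγ : 0 < γ) (hγ' : 0 < γ')
    (hPell : γ ^ 2 - (η * q * r * s : ℕ) * γ' ^ 2 = 1)
    (hfund : ∀ a b : ℤ, 0 < a → 0 < b → a ^ 2 - (η * q * r * s : ℕ) * b ^ 2 = 1 → γ ≤ a)
    (hnsq : ¬ ∃ t : ℤ, 2 ^ (if η = 1 then 1 else 0) * (q : ℤ) * (γ - 1) = t ^ 2)
    {Q' : ℕ} {K : Type*} [Field K] [NumberField K] {a b b' c : K} {φ : K →+* ℝ}
    (h : KA q r s (η * q) Q' a b b' c φ) :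
    2 * 2 ^ ((classNumber K).factorization 2) = h2 (IntermediateField.adjoin ℚ {φ c}) * h2 (IntermediateField.adjoin ℚ {φ (b * c)}) := by
  have q0 : QF (KA.kk a b b' c 0) ((2 : ℕ) : ℤ) _ := h.qf 0
  have q1 : QF (KA.kk a b b' c 1) ((η * q : ℕ) : ℤ) _ := h.qf 1
  have q2 : QF (KA.kk a b b' c 2) (Q' : ℤ) _ := h.qf 2
  have q4 : QF (KA.kk a b b' c 4) (((2 : ℕ) : ℤ) * r * s) (IntermediateField.AdjoinSimple.gen ℚ (XX a b b' c 4)) := by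
    have := h.qf 4
    rwa [show (Ar.dN r s (η * q) Q' 4 : ℤ) = ((2 : ℕ) : ℤ) * r * s by simp [Ar.dN]] at this
  have q5 : QF (KA.kk a b b' c 5) (((η * q : ℕ) : ℤ) * r * s) (IntermediateField.AdjoinSimple.gen ℚ (XX a b b' c 5)) := by
    have := h.qf 5
    rwa [show (Ar.dN r s (η * q) Q' 5 : ℤ) = ((η * q : ℕ) : ℤ) * r * s by simp [Ar.dN]] at this
  have q6 : QF (KA.kk a b b' c 6) ((Q' : ℤ) * r * s) (IntermediateField.AdjoinSimple.gen ℚ (XX a b b' c 6)) := by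
    have := h.qf 6
    rwa [show (Ar.dN r s (η * q) Q' 6 : ℤ) = (Q' : ℤ) * r * s by simp [Ar.dN]] at this
  obtain ⟨e, N, hUD⟩ := h.exists_UD (fun ε u v hf huv => h.ar.H5 hη q5 _ (h.pX 5) γ γ' hγ hγ' hPell hfund hnsq ε u v hf huv)
  obtain ⟨α, β, θ, ζ, I, J, hUB⟩ := hUD.exists_UB
  obtain ⟨n, hn, hcl⟩ := hUB.class_eq
  obtain ⟨n4, hn4, h4⟩ := h.ar.h_2rs q4 (ph a b b' c φ 4)
  obtain ⟨n6, hn6, h6⟩ := h.ar.h_Q'rs q6 (ph a b b' c φ 6)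
  have h0 := Ar.h_2 q0
  have h1 := h.ar.h_q (Or.inl rfl) q1 (ph a b b' c φ 1)
  have h2' := h.ar.h_q (Or.inr rfl) q2 (ph a b b' c φ 2)
  rw [h2, h2, (h.qf 3).card_adjoin (ph a b b' c φ 3) (φ c) rfl, (h.qf 5).card_adjoin (ph a b b' c φ 5) (φ (b * c)) rfl]
  refine final_arith hn h0 h1 h2' hn4 hn6 ?_ ?_ ?_ ?_
  · exact Fintype.card_ne_zero
  · exact Fintype.card_ne_zero
  · exact Fintype.card_ne_zero
  · rw [hcl, ← h4, ← h6, Fin.prod_univ_seven]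
end

theorem statement_13 (η q r s : ℕ) [Fact q.Prime] [Fact r.Prime] [Fact s.Prime]
    (hη : η = 1 ∨ η = 2)
    (hq4 : q % 4 = 3) (hr8 : r % 8 = 5) (hs8 : s % 8 = 5)
    (hqr : legendreSym r q = (-1) ^ (if η = 2 then 1 else 0))
    (hqs : legendreSym s q = (-1) ^ (if η = 2 then 1 else 0))
    (hrs : legendreSym s r = 1)
    (γ γ' : ℤ) (hγ : 0 < γ) (hγ' : 0 < γ')
    (hPell : γ ^ 2 - (η * q * r * s : ℕ) * γ' ^ 2 = 1)
    (hfund : ∀ a b : ℤ, 0 < a → 0 < b → a ^ 2 - (η * q * r * s : ℕ) * b ^ 2 = 1 → γ ≤ a)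
    (hnsq : ¬ ∃ t : ℤ, 2 ^ (if η = 1 then 1 else 0) * (q : ℤ) * (γ - 1) = t ^ 2) :
    2 * h2 (IntermediateField.adjoin ℚ
        {Real.sqrt 2, Real.sqrt (q : ℕ), Real.sqrt (r * s : ℕ)}) =
      h2 (IntermediateField.adjoin ℚ {Real.sqrt (r * s : ℕ)}) *
        h2 (IntermediateField.adjoin ℚ {Real.sqrt (η * q * r * s : ℕ)}) := by
  have har := ar_of η q r s hη hq4 hr8 hs8 hqr hqs hrs
  set Q' := (if η = 1 then 2 * q else q) with hQ'
  set S : Set ℝ := {Real.sqrt 2, Real.sqrt (q : ℕ), Real.sqrt (r * s : ℕ)} with hS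
  have hq0 : 0 < q := (Fact.out : q.Prime).pos
  have hr0 : 0 < r := (Fact.out : r.Prime).pos
  have hs0 : 0 < s := (Fact.out : s.Prime).pos
  have hη0 : 0 < η := by omega
  have hQ0 : 0 < Q' := by rw [hQ']; split_ifs <;> omega
  let L : IntermediateField ℚ ℝ := IntermediateField.adjoin ℚ S
  have m2 : Real.sqrt 2 ∈ L := IntermediateField.subset_adjoin ℚ S (by simp [hS])
  have mq : Real.sqrt (q : ℕ) ∈ L := IntermediateField.subset_adjoin ℚ S (by simp [hS])
  have mc : Real.sqrt (r * s : ℕ) ∈ L := IntermediateField.subset_adjoin ℚ S (by simp [hS])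
  have e2q : Real.sqrt (2 * q : ℕ) = Real.sqrt 2 * Real.sqrt (q : ℕ) := by
    push_cast; rw [Real.sqrt_mul (by norm_num)]
  have mb : Real.sqrt (η * q : ℕ) ∈ L := by
    rcases hη with rfl | rfl
    · rwa [one_mul]
    · rw [e2q]; exact L.mul_mem m2 mq
  have mb' : Real.sqrt (Q' : ℕ) ∈ L := by
    rw [hQ']
    split_ifs
    · rw [e2q]; exact L.mul_mem m2 mq
    · exact mq
  have hsq : ∀ n : ℕ, Real.sqrt (n : ℕ) ^ 2 = n := fun n => Real.sq_sqrt (Nat.cast_nonneg n)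
  have hIntg : ∀ n : ℕ, IsIntegral ℚ (Real.sqrt (n : ℕ)) := by
    intro n
    refine IsIntegral.of_pow two_pos ?_
    rw [hsq]
    exact isIntegral_algebraMap (R := ℚ) (x := (n : ℚ)) |> fun h => by simpa using h
  have hfd : FiniteDimensional ℚ L := by
    have : Finite S := by rw [hS]; exact Set.toFinite _
    refine IntermediateField.finiteDimensional_adjoin ?_
    rintro x (rfl | rfl | rfl)
    · exact_mod_cast hIntg 2
    · exact hIntg q
    · exact hIntg (r * s)
  have : NumberField L := { to_charZero := inferInstance, to_finiteDimensional := hfd }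
  let a : L := ⟨Real.sqrt 2, m2⟩
  let b : L := ⟨Real.sqrt (η * q : ℕ), mb⟩
  let b' : L := ⟨Real.sqrt (Q' : ℕ), mb'⟩
  let c : L := ⟨Real.sqrt (r * s : ℕ), mc⟩
  let φ : L →+* ℝ := L.val.toRingHom
  have pos : ∀ n : ℕ, 0 < n → 0 < Real.sqrt (n : ℕ) := fun n hn => Real.sqrt_pos.2 (by exact_mod_cast hn)
  have h2' : Real.sqrt 2 ^ 2 = 2 := Real.sq_sqrt (by norm_num)
  have hb0 : 0 < η * q := Nat.mul_pos hη0 hq0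
  have hKA : KA q r s (η * q) Q' a b b' c φ := by
    refine ⟨har, ⟨?_, ?_, har.ns⟩, ?_, ?_, ?_, ?_, ?_, ?_⟩
    · intro i
      fin_cases i
      · exact Subtype.ext (h2'.trans (by simp; rfl))
      · exact Subtype.ext ((hsq (η * q)).trans (by simp))
      · exact Subtype.ext ((hsq (r * s)).trans (by simp))
    · rw [eq_top_iff]
      have ha : a ∈ IntermediateField.adjoin ℚ (Set.range ![a, b, c]) := IntermediateField.subset_adjoin ℚ _ ⟨0, rfl⟩
      have hb : b ∈ IntermediateField.adjoin ℚ (Set.range ![a, b, c]) := IntermediateField.subset_adjoin ℚ _ ⟨1, rfl⟩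
      have hc : c ∈ IntermediateField.adjoin ℚ (Set.range ![a, b, c]) := IntermediateField.subset_adjoin ℚ _ ⟨2, rfl⟩
      rintro ⟨x, hx⟩ -
      induction hx using IntermediateField.adjoin_induction with
      | mem x hx' =>
        rcases hx' with rfl | rfl | rfl
        · exact ha
        · rcases hη with h1 | h1
          · have : (⟨Real.sqrt (q : ℕ), mq⟩ : L) = b := Subtype.ext (by simp [b, h1])
            rw [this]; exact hb
          · have : (⟨Real.sqrt (q : ℕ), mq⟩ : L) = a⁻¹ * b := Subtype.ext (by
              change Real.sqrt (q : ℕ) = (Real.sqrt 2)⁻¹ * Real.sqrt (η * q : ℕ)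
              rw [h1, e2q]
              have : Real.sqrt 2 ≠ 0 := by positivity
              field_simp)
            rw [this]; exact mul_mem (inv_mem ha) hb
        · exact hc
      | algebraMap x => exact IntermediateField.algebraMap_mem _ x
      | add x y _ _ h1 h2 => exact IntermediateField.add_mem _ h1 h2
      | inv x _ h1 => exact IntermediateField.inv_mem _ h1
      | mul x y _ _ h1 h2 => exact IntermediateField.mul_mem _ h1 h2
    · exact Subtype.ext ((hsq Q').trans (by simp))
    · obtain ⟨κ, hκ, hk⟩ := har.exists_kappa
      refine ⟨κ, hκ, Subtype.ext ?_⟩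
      change (κ : ℝ) * Real.sqrt (Q' : ℕ) = Real.sqrt 2 * Real.sqrt (η * q : ℕ)
      rw [← pow_left_inj₀ (by positivity) (by positivity) two_ne_zero, mul_pow, mul_pow, hsq, hsq, h2']
      exact_mod_cast hk
    · exact_mod_cast pos 2 two_pos
    · exact pos _ hb0
    · exact pos _ hQ0
    · exact pos _ (Nat.mul_pos hr0 hs0)
  have key := KA.two_h hη γ γ' hγ hγ' hPell hfund hnsq hKA
  have e1 : φ c = Real.sqrt (r * s : ℕ) := rfl
  have e2 : φ (b * c) = Real.sqrt (η * q * r * s : ℕ) := by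
    change Real.sqrt (η * q : ℕ) * Real.sqrt (r * s : ℕ) = _
    rw [← Real.sqrt_mul (Nat.cast_nonneg _)]
    congr 1
    push_cast
    ring
  rw [e1, e2] at key
  rw [← key]
  rw [classNumber, ← Nat.card_eq_fintype_card]
  rfl
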